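/- Let g be the finite-dimensional simple Lie algebra of type E₆ over ℂ, and let (h,e,f) be an sl₂-triple in g. Then e lies in the derived subalgebra [g_e,g_e] of the centralizer g_e of e if and only if the Lie subalgebra of g generated by g(1)_e contains g(k)_e for every integer k ≥ 1 (equivalently, the subalgebra g(≥1)_e spanned by the g(k)_e with k ≥ 1 is generated as a Lie algebra by g(1)_e). -/

import Mathlib

/-- The centralizer `g_e` of `e`, i.e. the kernel of `ad e`. -/
noncomputable def centralizer (e : LieAlgebra.e₆ ℂ) : Submodule ℂ (LieAlgebra.e₆ ℂ) :=
  LinearMap.ker (LieAlgebra.ad ℂ (LieAlgebra.e₆ ℂ) e)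

/-- The derived subalgebra `[g_e, g_e]` of the centralizer, as the linear span of all
brackets of pairs of elements of `g_e`. -/
noncomputable def derived (e : LieAlgebra.e₆ ℂ) : Submodule ℂ (LieAlgebra.e₆ ℂ) :=
  Submodule.span ℂ
    {z : LieAlgebra.e₆ ℂ | ∃ x ∈ centralizer e, ∃ y ∈ centralizer e, ⁅x, y⁆ = z}

namespace Sl2

variable {M : Type*} [AddCommGroup M] [Module ℂ M]
  {H E F : Module.End ℂ M}

lemma apply_raise (hE : H * E - E * H = (2 : ℂ) • E) {μ : ℂ} {v : M} (hv : H v = μ • v) :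
    H (E v) = (μ + 2) • E v := by
  have := LinearMap.congr_fun hE v
  simp only [LinearMap.sub_apply, Module.End.mul_apply, LinearMap.smul_apply, hv, map_smul] at this
  rw [sub_eq_iff_eq_add] at this
  rw [this, add_smul, add_comm]

lemma pow_raise (hE : H * E - E * H = (2 : ℂ) • E) {μ : ℂ} {v : M} (hv : H v = μ • v) (n : ℕ) :
    H ((E ^ n) v) = (μ + 2 * n) • (E ^ n) v := by
  induction n with
  | zero => simpa using hv
  | succ n ih =>
    rw [pow_succ', Module.End.mul_apply, apply_raise hE ih]
    congr 1
    push_cast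
    ring

lemma exists_pow_apply_eq_zero [FiniteDimensional ℂ M] {c : ℂ} (hc : c ≠ 0)
    (hE : H * E - E * H = c • E) : ∃ n, E ^ n = 0 := by
  by_contra! hne
  let A : Module.End ℂ (Module.End ℂ M) :=
    LinearMap.mulLeft ℂ H - LinearMap.mulRight ℂ H
  have key : ∀ n : ℕ, A (E ^ n) = ((n : ℂ) * c) • E ^ n := by
    intro n
    induction n with
    | zero => simp [A]
    | succ n ih =>
      simp only [A, LinearMap.sub_apply, LinearMap.mulLeft_apply, LinearMap.mulRight_apply] at ih ⊢
      have : H * E ^ (n + 1) - E ^ (n + 1) * H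
          = (H * E ^ n - E ^ n * H) * E + E ^ n * (H * E - E * H) := by
        simp only [pow_succ]; noncomm_ring
      rw [this, ih, hE]
      simp only [smul_mul_assoc, mul_smul_comm, ← pow_succ, ← add_smul]
      congr 1
      push_cast
      ring
  have hev : ∀ n : ℕ, A.HasEigenvalue ((n : ℂ) * c) := fun n =>
    Module.End.hasEigenvalue_of_hasEigenvector
      ⟨Module.End.mem_eigenspace_iff.mpr (key n), hne n⟩
  have hfin := Module.End.finite_hasEigenvalue A
  exact Set.infinite_of_injective_forall_mem
    (f := fun n : ℕ => (n : ℂ) * c)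
    (fun a b hab => by exact_mod_cast mul_right_cancel₀ hc hab) hev hfin

lemma raise_pow_lower (hF : H * F - F * H = (-2 : ℂ) • F)
    (hEF : E * F - F * E = H) (k : ℕ) :
    E * F ^ (k + 1) = F ^ (k + 1) * E + ((k : ℂ) + 1) • (F ^ k * (H - (k : ℂ) • 1)) := by
  have hHF : ∀ k : ℕ, H * F ^ k = F ^ k * H - (2 * k : ℂ) • F ^ k := by
    intro k
    induction k with
    | zero => simp
    | succ k ih =>
      have h1 : H * F = F * H - (2 : ℂ) • F := by
        rw [sub_eq_iff_eq_add] at hF; rw [hF]; module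
      rw [pow_succ, ← mul_assoc, ih, sub_mul, mul_assoc, h1]
      simp only [mul_sub, mul_smul_comm, smul_mul_assoc, mul_assoc]
      push_cast
      module
  have h2 : E * F = F * E + H := by rw [sub_eq_iff_eq_add] at hEF; rw [hEF, add_comm]
  induction k with
  | zero => simp [h2]
  | succ k ih =>
    rw [pow_succ' F (k + 1), ← mul_assoc, h2, add_mul, mul_assoc, ih, hHF (k + 1)]
    simp only [mul_add, mul_smul_comm, ← mul_assoc, ← pow_succ', mul_sub, mul_one]
    push_cast
    module

section finite

variable [FiniteDimensional ℂ M] (hE : H * E - E * H = (2 : ℂ) • E)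
  (hF : H * F - F * H = (-2 : ℂ) • F) (hEF : E * F - F * E = H)

include hEF

section

include hF

/-- The weight of a vector killed by the raising operator is a natural number. -/
lemma primitive_weight {μ : ℂ} {v : M} (hv0 : v ≠ 0) (hv : H v = μ • v) (hEv : E v = 0) :
    ∃ n : ℕ, μ = n := by
  by_contra! hne
  obtain ⟨N, hN⟩ := exists_pow_apply_eq_zero (H := H) (E := F) (by norm_num : (-2 : ℂ) ≠ 0) hF
  have : ∀ k : ℕ, (F ^ k) v ≠ 0 := by
    intro k
    induction k with
    | zero => simpa using hv0
    | succ k ih =>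
      intro h0
      have := LinearMap.congr_fun (raise_pow_lower hF hEF k) v
      simp only [Module.End.mul_apply, h0, map_zero, LinearMap.add_apply, hEv,
        LinearMap.smul_apply, LinearMap.sub_apply, Module.End.one_apply, hv, zero_add,
        ← sub_smul, map_smul, smul_smul] at this
      have hk : ((k : ℂ) + 1) * (μ - k) ≠ 0 :=
        mul_ne_zero (by exact_mod_cast Nat.succ_ne_zero k) (sub_ne_zero.mpr (hne k))
      exact (smul_ne_zero hk ih) this.symm
  exact this N (by rw [hN]; rfl)

end

section

include hE

lemma raise_lower_injective {m : ℤ} (hm : 1 ≤ m) {y : M} (hy : H y = (m : ℂ) • y)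
    (h0 : E (F y) = 0) : y = 0 := by
  by_contra hy0
  obtain ⟨N, hN⟩ := exists_pow_apply_eq_zero (by norm_num : (2 : ℂ) ≠ 0) hE
  have key : ∀ j : ℕ, (E ^ j) y ≠ 0 ∧
      ∃ c : ℕ, F (E ((E ^ j) y)) = -((m : ℂ) + c) • (E ^ j) y := by
    intro j
    induction j with
    | zero =>
      refine ⟨by simpa using hy0, 0, ?_⟩
      have := LinearMap.congr_fun hEF y
      simp only [LinearMap.sub_apply, Module.End.mul_apply, h0, hy] at this
      simp only [pow_zero, Module.End.one_apply, Nat.cast_zero, add_zero, neg_smul, ← this]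
      abel
    | succ j ih =>
      obtain ⟨hj, c, hc⟩ := ih
      have hne : (E ^ (j + 1)) y ≠ 0 := by
        intro h
        rw [pow_succ', Module.End.mul_apply] at h
        rw [h, map_zero] at hc
        have hmc : -((m : ℂ) + c) ≠ 0 := by
          have : (0 : ℤ) < m + c := by positivity
          exact neg_ne_zero.mpr (by exact_mod_cast this.ne')
        exact smul_ne_zero hmc hj hc.symm
      have hmul : ∀ x, (E ^ (j + 1)) x = E ((E ^ j) x) := fun x => by
        rw [pow_succ', Module.End.mul_apply]
      refine ⟨hne, c + (m + 2 * (j + 1)).toNat, ?_⟩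
      have := LinearMap.congr_fun hEF ((E ^ (j + 1)) y)
      rw [LinearMap.sub_apply, Module.End.mul_apply, Module.End.mul_apply,
        pow_raise hE hy (j + 1)] at this
      have h1 : F (E ((E ^ (j + 1)) y)) = E (F ((E ^ (j + 1)) y))
          - ((m : ℂ) + 2 * ((j + 1 : ℕ) : ℂ)) • (E ^ (j + 1)) y := by
        rw [← this]; abel
      have hcast : (((m + 2 * (j + 1)).toNat : ℕ) : ℂ) = (m : ℂ) + 2 * (j + 1) := by
        have : (((m + 2 * (j + 1)).toNat : ℕ) : ℤ) = m + 2 * (j + 1) :=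
          Int.toNat_of_nonneg (by positivity)
        exact_mod_cast congrArg (Int.cast (R := ℂ)) this
      rw [h1, hmul, hc, map_smul, ← sub_smul]
      congr 1
      push_cast [hcast]
      ring
  exact (key N).1 (by rw [hN]; rfl)

end

include hE hF

/-- Every eigenvalue of the Cartan operator is an integer. -/
lemma weight_int {μ : ℂ} {v : M} (hv0 : v ≠ 0) (hv : H v = μ • v) : ∃ n : ℤ, μ = n := by
  obtain ⟨N, hN⟩ := exists_pow_apply_eq_zero (by norm_num : (2 : ℂ) ≠ 0) hE
  have hex : ∃ n, (E ^ n) v = 0 := ⟨N, by rw [hN]; rfl⟩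
  classical
  have hpos : Nat.find hex ≠ 0 := fun h => hv0 (by simpa [h] using Nat.find_spec hex)
  obtain ⟨j, hj⟩ := Nat.exists_eq_succ_of_ne_zero hpos
  have hne : (E ^ j) v ≠ 0 := Nat.find_min hex (by omega)
  have hz : E ((E ^ j) v) = 0 := by
    rw [← Module.End.mul_apply, ← pow_succ', ← Nat.succ_eq_add_one, ← hj]
    exact Nat.find_spec hex
  obtain ⟨n, hn⟩ := primitive_weight hF hEF hne (pow_raise hE hv j) hz
  exact ⟨n - 2 * j, by push_cast; linear_combination hn⟩

/-- On weight spaces of positive weight, `E` is onto. -/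
lemma raise_lower_surjective {m : ℤ} (hm : 1 ≤ m) {y : M} (hy : H y = (m : ℂ) • y) :
    ∃ x, H x = (m : ℂ) • x ∧ E (F x) = y := by
  let W := Module.End.eigenspace H (m : ℂ)
  have hW : ∀ x ∈ W, (E * F) x ∈ W := by
    intro x hx
    rw [Module.End.mem_eigenspace_iff] at hx ⊢
    have hF' : (-H) * F - F * (-H) = (2 : ℂ) • F := by
      have : (-H) * F - F * (-H) = -(H * F - F * H) := by noncomm_ring
      rw [this, hF]; module
    have h1 : H (F x) = ((m : ℂ) - 2) • F x := by
      have := apply_raise hF' (μ := -(m : ℂ)) (v := x) (by simp [hx])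
      rw [LinearMap.neg_apply, neg_eq_iff_eq_neg] at this
      rw [this, ← neg_smul]; congr 1; ring
    have := apply_raise hE h1
    simpa using this
  let T : W →ₗ[ℂ] W := (E * F).restrict hW
  have hT : Function.Injective T := by
    rw [← LinearMap.ker_eq_bot, LinearMap.ker_eq_bot']
    rintro ⟨x, hx⟩ h
    have h' : E (F x) = 0 := congrArg Subtype.val h
    exact Subtype.ext (raise_lower_injective hE hEF hm (Module.End.mem_eigenspace_iff.mp hx) h')
  obtain ⟨⟨x, hx⟩, hxy⟩ := LinearMap.injective_iff_surjective.mp hT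
    ⟨y, Module.End.mem_eigenspace_iff.mpr hy⟩
  exact ⟨x, Module.End.mem_eigenspace_iff.mp hx, congrArg Subtype.val hxy⟩

lemma raise_surjective {m : ℤ} (hm : 1 ≤ m) {y : M} (hy : H y = (m : ℂ) • y) :
    ∃ x, H x = ((m : ℂ) - 2) • x ∧ E x = y := by
  obtain ⟨x, hx, hxy⟩ := raise_lower_surjective hE hF hEF hm hy
  refine ⟨F x, ?_, hxy⟩
  have hF' : (-H) * F - F * (-H) = (2 : ℂ) • F := by
    have : (-H) * F - F * (-H) = -(H * F - F * H) := by noncomm_ring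
    rw [this, hF]; module
  have := apply_raise hF' (μ := -(m : ℂ)) (v := x)
      (by rw [LinearMap.neg_apply, hx, neg_smul])
  rw [LinearMap.neg_apply, neg_eq_iff_eq_neg] at this
  rw [this, ← neg_smul]; congr 1; ring

lemma eq_zero_of_primitive_jordan {n : ℕ} {v : M} (hEv : E v = 0)
    (hu : H (H v - (n : ℂ) • v) = (n : ℂ) • (H v - (n : ℂ) • v)) : H v = (n : ℂ) • v := by
  obtain ⟨N, hN⟩ := exists_pow_apply_eq_zero (H := H) (E := F) (by norm_num : (-2 : ℂ) ≠ 0) hF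
  have h1 : ∀ k : ℕ, E ((F ^ (k + 1)) v)
      = ((k : ℂ) + 1) • (((n : ℂ) - k) • (F ^ k) v + (F ^ k) (H v - (n : ℂ) • v)) := by
    intro k
    have := LinearMap.congr_fun (raise_pow_lower hF hEF k) v
    simp only [Module.End.mul_apply, map_zero, LinearMap.add_apply, hEv,
      LinearMap.smul_apply, LinearMap.sub_apply, Module.End.one_apply, zero_add] at this
    rw [this]
    simp only [map_sub, map_smul]
    module
  set u := H v - (n : ℂ) • v with hudef
  by_contra hne
  have hu0 : u ≠ 0 := fun h => hne (sub_eq_zero.mp h)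
  have hEu : E u = 0 := by
    have := LinearMap.congr_fun hE v
    simp only [LinearMap.sub_apply, Module.End.mul_apply, LinearMap.smul_apply, hEv, map_zero,
      smul_zero, zero_sub, neg_eq_zero] at this
    rw [hudef, map_sub, this, map_smul, hEv, smul_zero, sub_zero]
  have h2 : ∀ k : ℕ, E ((F ^ (k + 1)) u) = ((k : ℂ) + 1) • (((n : ℂ) - k) • (F ^ k) u) := by
    intro k
    have := LinearMap.congr_fun (raise_pow_lower hF hEF k) u
    simp only [Module.End.mul_apply, map_zero, LinearMap.add_apply, hEu,
      LinearMap.smul_apply, LinearMap.sub_apply, Module.End.one_apply, zero_add, hu] at this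
    rw [this]
    simp only [map_sub, map_smul]
    module
  have hk1 : ∀ k : ℕ, (k : ℂ) + 1 ≠ 0 := fun k => by exact_mod_cast Nat.succ_ne_zero k
  have hlow : ∀ k : ℕ, k ≤ n → (F ^ k) u ≠ 0 := by
    intro k hk
    induction k with
    | zero => simpa using hu0
    | succ k ih =>
      intro h0
      have := h2 k
      rw [h0, map_zero] at this
      have hnk : (n : ℂ) - k ≠ 0 := sub_ne_zero.mpr (by exact_mod_cast (by omega : n ≠ k))
      exact smul_ne_zero (hk1 k) (smul_ne_zero hnk (ih (by omega))) this.symm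
  have htop : (F ^ (n + 1)) u = 0 := by
    by_contra h
    have hz : E ((F ^ (n + 1)) u) = 0 := by rw [h2 n]; simp
    have hF' : (-H) * F - F * (-H) = (2 : ℂ) • F := by
      have : (-H) * F - F * (-H) = -(H * F - F * H) := by noncomm_ring
      rw [this, hF]; module
    have hw := pow_raise hF' (μ := -(n : ℂ)) (v := u) (by simp [hu]) (n + 1)
    rw [LinearMap.neg_apply, neg_eq_iff_eq_neg, ← neg_smul] at hw
    obtain ⟨m, hm⟩ := primitive_weight hF hEF h hw hz
    have : (m : ℂ) + n + 2 = 0 := by rw [← hm]; push_cast; ring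
    have h3 : m + n + 2 = 0 := by exact_mod_cast this
    omega
  have hhigh : ∀ k : ℕ, (F ^ (n + 1 + k)) u = 0 := by
    intro k
    rw [add_comm, pow_add, Module.End.mul_apply, htop, map_zero]
  have hv : ∀ k : ℕ, (F ^ (n + 1 + k)) v ≠ 0 := by
    intro k
    induction k with
    | zero =>
      intro h0
      have := h1 n
      rw [add_zero] at h0
      rw [h0, map_zero, sub_self, zero_smul, zero_add] at this
      exact smul_ne_zero (hk1 n) (hlow n le_rfl) this.symm
    | succ k ih =>
      intro h0
      have := h1 (n + 1 + k)
      rw [show n + 1 + (k + 1) = n + 1 + k + 1 from rfl] at h0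
      rw [h0, map_zero, hhigh k, add_zero] at this
      have hnk : (n : ℂ) - ((n + 1 + k : ℕ) : ℂ) ≠ 0 :=
        sub_ne_zero.mpr (by exact_mod_cast (by omega : n ≠ n + 1 + k))
      exact smul_ne_zero (hk1 _) (smul_ne_zero hnk ih) this.symm
  exact hv N (by rw [pow_add, Module.End.mul_apply, hN, LinearMap.zero_apply, map_zero])

lemma eigen_of_sq {μ : ℂ} {v : M} (hu : H (H v - μ • v) = μ • (H v - μ • v)) :
    H v = μ • v := by
  by_contra hne
  obtain ⟨N, hN⟩ := exists_pow_apply_eq_zero (by norm_num : (2 : ℂ) ≠ 0) hE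
  have hu0 : H v - μ • v ≠ 0 := fun h => hne (sub_eq_zero.mp h)
  have hHE : ∀ x, H (E x) = E (H x) + (2 : ℂ) • E x := fun x => by
    have := LinearMap.congr_fun hE x
    simp only [LinearMap.sub_apply, Module.End.mul_apply, LinearMap.smul_apply] at this
    rw [← this]; abel
  have hcomm : ∀ j : ℕ, (E ^ j) (H v - μ • v) = H ((E ^ j) v) - (μ + 2 * j) • (E ^ j) v := by
    intro j
    induction j with
    | zero => simp
    | succ j ih =>
      rw [pow_succ', Module.End.mul_apply, ih, Module.End.mul_apply, hHE, map_sub, map_smul]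
      push_cast
      module
  have hex : ∃ n, (E ^ n) (H v - μ • v) = 0 := ⟨N, by rw [hN]; rfl⟩
  classical
  have hpos : Nat.find hex ≠ 0 := fun h => hu0 (by
    have := Nat.find_spec hex
    rwa [h, pow_zero, Module.End.one_apply] at this)
  obtain ⟨j, hj⟩ := Nat.exists_eq_succ_of_ne_zero hpos
  have hne' : (E ^ j) (H v - μ • v) ≠ 0 := Nat.find_min hex (by omega)
  have hz : E ((E ^ j) (H v - μ • v)) = 0 := by
    rw [← Module.End.mul_apply, ← pow_succ', ← Nat.succ_eq_add_one, ← hj]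
    exact Nat.find_spec hex
  have hw := pow_raise hE hu j
  obtain ⟨n, hn⟩ := primitive_weight hF hEF hne' hw hz
  set v₁ := (E ^ j) v
  rw [hn] at hw
  rw [hcomm j, hn] at hw hne' hz
  have hy : H (E v₁) = (((n + 2 : ℕ) : ℤ) : ℂ) • E v₁ := by
    rw [map_sub, map_smul, sub_eq_zero] at hz
    rw [hHE, hz]; push_cast; module
  obtain ⟨x, hx, hxy⟩ := raise_lower_surjective hE hF hEF (by omega) hy
  have hF' : (-H) * F - F * (-H) = (2 : ℂ) • F := by
    have : (-H) * F - F * (-H) = -(H * F - F * H) := by noncomm_ring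
    rw [this, hF]; module
  have hFx : H (F x) = (n : ℂ) • F x := by
    have := apply_raise hF' (μ := -(((n + 2 : ℕ) : ℤ) : ℂ)) (v := x)
      (by rw [LinearMap.neg_apply, hx, neg_smul])
    rw [LinearMap.neg_apply, neg_eq_iff_eq_neg] at this
    rw [this, ← neg_smul]; congr 1; push_cast; ring
  have hsame : H (v₁ - F x) - (n : ℂ) • (v₁ - F x) = H v₁ - (n : ℂ) • v₁ := by
    rw [map_sub, hFx, smul_sub]; abel
  have := eq_zero_of_primitive_jordan hE hF hEF (n := n) (v := v₁ - F x)
    (by rw [map_sub, hxy, sub_self]) (by rw [hsame, hw])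
  exact hne' (by rw [← hsame, this, sub_self])

/-- The Cartan operator of an `sl₂`-triple of endomorphisms is diagonalizable. -/
lemma iSup_eigenspace : ⨆ μ : ℂ, Module.End.eigenspace H μ = ⊤ := by
  rw [← Module.End.iSup_maxGenEigenspace_eq_top H]
  refine iSup_congr fun μ => le_antisymm ?_ ?_
  · exact Module.End.eigenspace_le_maxGenEigenspace
  · intro v hv
    rw [Module.End.mem_maxGenEigenspace] at hv
    obtain ⟨k, hk⟩ := hv
    rw [Module.End.mem_eigenspace_iff]
    induction k generalizing v with
    | zero => simp at hk; simp [hk]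
    | succ k ih =>
      rw [pow_succ, Module.End.mul_apply] at hk
      have := ih hk
      simp only [LinearMap.sub_apply, LinearMap.smul_apply, Module.End.one_apply] at this
      exact eigen_of_sq hE hF hEF this

end finite

end Sl2

namespace LieExp

open NormedSpace Topology Module

variable (L : Type*) [LieRing L] [LieAlgebra ℂ L] [FiniteDimensional ℂ L]

/-- Coordinates on a finite-dimensional Lie algebra. -/
noncomputable def coord : L ≃ₗ[ℂ] (Fin (finrank ℂ L) → ℂ) := (finBasis ℂ L).equivFun

/-- The adjoint representation in coordinates. -/
noncomputable def adCoord :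
    L →ₗ[ℂ] ((Fin (finrank ℂ L) → ℂ) →L[ℂ] (Fin (finrank ℂ L) → ℂ)) :=
  LinearMap.toContinuousLinearMap.toLinearMap ∘ₗ (coord L).conj.toLinearMap ∘ₗ
    (LieModule.toEnd ℂ L L : L →ₗ[ℂ] Module.End ℂ L)

variable {L}

lemma adCoord_apply (x y : L) : adCoord L x (coord L y) = coord L ⁅x, y⁆ := by
  simp [adCoord, LinearEquiv.conj_apply]

/-- The exponential of `ad x` as a linear endomorphism. -/
noncomputable def expLin (x : L) : L →ₗ[ℂ] L :=
  (coord L).symm.toLinearMap ∘ₗ (exp (adCoord L x)).toLinearMap ∘ₗ (coord L).toLinearMap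

lemma coord_expLin (x y : L) : coord L (expLin x y) = exp (adCoord L x) (coord L y) := by
  simp [expLin]

lemma hasDerivAt_exp_apply {V : Type*} [NormedAddCommGroup V] [NormedSpace ℂ V] [CompleteSpace V]
    (D : V →L[ℂ] V) (v : V) (t : ℂ) :
    HasDerivAt (fun s : ℂ => exp (s • D) v) (D (exp (t • D) v)) t := by
  have := (hasDerivAt_exp_smul_const' (𝕂 := ℂ) D t).clm_apply (hasDerivAt_const t v)
  simpa using this

/-- The bracket in coordinates. -/
noncomputable def bracketCoord : (Fin (finrank ℂ L) → ℂ) →L[ℂ] (Fin (finrank ℂ L) → ℂ) →L[ℂ]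
    (Fin (finrank ℂ L) → ℂ) :=
  LinearMap.toContinuousLinearMap (adCoord L ∘ₗ (coord L).symm.toLinearMap)

lemma bracketCoord_apply (x y : L) :
    bracketCoord (L := L) (coord L x) (coord L y) = coord L ⁅x, y⁆ := by
  simp only [bracketCoord, LinearMap.coe_toContinuousLinearMap', LinearMap.comp_apply,
    LinearEquiv.coe_coe, LinearEquiv.symm_apply_apply, adCoord_apply]

lemma exp_neg_mul_exp {V : Type*} [NormedAddCommGroup V] [NormedSpace ℂ V] [CompleteSpace V]
    (D : V →L[ℂ] V) : exp (-D) * exp D = 1 := by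
  let _ : NormedAlgebra ℚ (V →L[ℂ] V) := NormedAlgebra.restrictScalars ℚ ℂ _
  rw [← NormedSpace.exp_add_of_commute (Commute.neg_left (Commute.refl D)), neg_add_cancel,
    exp_zero]

lemma exp_derivation {V : Type*} [NormedAddCommGroup V] [NormedSpace ℂ V] [CompleteSpace V]
    (D : V →L[ℂ] V) (β : V →L[ℂ] V →L[ℂ] V) (hD : ∀ u v, D (β u v) = β (D u) v + β u (D v))
    (u v : V) : exp D (β u v) = β (exp D u) (exp D v) := by
  have hneg : ∀ t : ℂ, exp (-t • D) * exp (t • D) = 1 := fun t => by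
    rw [neg_smul, exp_neg_mul_exp]
  have hneg' : ∀ t : ℂ, exp (t • D) * exp (-t • D) = 1 := fun t => by
    simpa using hneg (-t)
  have hderiv : ∀ t : ℂ, HasDerivAt
      (fun s : ℂ => exp (-s • D) (β (exp (s • D) u) (exp (s • D) v))) 0 t := by
    intro t
    have h1 : HasDerivAt (fun s : ℂ => exp (-s • D)) (-(exp (-t • D) * D)) t := by
      have := (hasDerivAt_exp_smul_const (𝕂 := ℂ) D (-t)).scomp t (hasDerivAt_neg t)
      simpa [Function.comp_def] using this
    have h2 : HasDerivAt (fun s : ℂ => β (exp (s • D) u) (exp (s • D) v))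
        (D (β (exp (t • D) u) (exp (t • D) v))) t := by
      have ha : HasDerivAt (fun s : ℂ => β (exp (s • D) u)) (β (D (exp (t • D) u))) t :=
        (β.hasFDerivAt (x := exp (t • D) u)).comp_hasDerivAt t (hasDerivAt_exp_apply D u t)
      have := ha.clm_apply (hasDerivAt_exp_apply D v t)
      rw [hD]
      exact this
    have := h1.clm_apply h2
    convert this using 1
    simp
  have hconst := is_const_of_deriv_eq_zero (𝕜 := ℂ) (fun t => (hderiv t).differentiableAt)
    (fun t => (hderiv t).deriv) 1 0
  simp only [neg_zero, zero_smul, exp_zero, one_apply_eq_self, one_smul] at hconst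
  rw [← hconst, ← mul_apply_eq_comp, ← one_smul ℂ D, smul_smul, mul_one]
  rw [hneg' 1, one_apply_eq_self, one_smul]

lemma expLin_lie (x y z : L) : expLin x ⁅y, z⁆ = ⁅expLin x y, expLin x z⁆ := by
  apply (coord L).injective
  rw [coord_expLin, ← bracketCoord_apply, exp_derivation, ← coord_expLin, ← coord_expLin,
    bracketCoord_apply]
  intro u v
  obtain ⟨u, rfl⟩ := (coord L).surjective u
  obtain ⟨v, rfl⟩ := (coord L).surjective v
  simp only [bracketCoord_apply, adCoord_apply, leibniz_lie x u v, map_add]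

lemma expLin_neg (x y : L) : expLin (-x) (expLin x y) = y := by
  apply (coord L).injective
  rw [coord_expLin, coord_expLin, map_neg, ← mul_apply_eq_comp,
    exp_neg_mul_exp, one_apply_eq_self]

/-- The automorphism `exp (ad x)`. -/
noncomputable def expAd (x : L) : L ≃ₗ⁅ℂ⁆ L where
  toFun := expLin x
  map_add' := map_add _
  map_smul' := map_smul _
  map_lie' := expLin_lie x _ _
  invFun := expLin (-x)
  left_inv := expLin_neg x
  right_inv y := by simpa using expLin_neg (-x) y

lemma coord_expAd (x y : L) : coord L (expAd x y) = exp (adCoord L x) (coord L y) :=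
  coord_expLin x y

lemma expAd_apply_of_cube {x y : L} (h : ⁅x, ⁅x, ⁅x, y⁆⁆⁆ = 0) :
    expAd x y = y + ⁅x, y⁆ + (2⁻¹ : ℂ) • ⁅x, ⁅x, y⁆⁆ := by
  apply (coord L).injective
  rw [coord_expAd]
  have hs := (NormedSpace.exp_series_hasSum_exp' (𝕂 := ℂ) (adCoord L x)).mapL
    (ContinuousLinearMap.apply ℂ _ (coord L y))
  have h3 : (adCoord L x ^ 3) (coord L y) = 0 := by
    simp only [pow_succ, pow_zero, one_mul, mul_apply_eq_comp, adCoord_apply, h,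
      map_zero]
  have hf := hasSum_sum_of_ne_finset_zero (L := .unconditional ℕ) (s := Finset.range 3)
    (f := fun n : ℕ => (ContinuousLinearMap.apply ℂ _ (coord L y))
      (((n.factorial : ℂ)⁻¹) • adCoord L x ^ n)) (fun n hn => by
      obtain ⟨k, rfl⟩ := Nat.exists_eq_add_of_le (not_lt.mp (fun h => hn (Finset.mem_range.mpr h)))
      rw [add_comm, pow_add, ContinuousLinearMap.apply_apply, smul_apply,
        mul_apply_eq_comp, h3, map_zero, smul_zero])
  have := hs.unique hf
  rw [ContinuousLinearMap.apply_apply] at this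
  rw [this]
  simp [Finset.sum_range_succ, adCoord_apply, Nat.factorial]

lemma expAd_apply_of_sq {x y : L} (h : ⁅x, ⁅x, y⁆⁆ = 0) : expAd x y = y + ⁅x, y⁆ := by
  rw [expAd_apply_of_cube (by rw [h, lie_zero]), h, smul_zero, add_zero]

lemma expAd_mem {x : L} (W : Submodule ℂ L) (hW : ∀ y ∈ W, ⁅x, y⁆ ∈ W) {y : L} (hy : y ∈ W) :
    expAd x y ∈ W := by
  have hcl := Submodule.closed_of_finiteDimensional (W.map (coord L).toLinearMap)
  have hs := (NormedSpace.exp_series_hasSum_exp' (𝕂 := ℂ) (adCoord L x)).mapL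
    (ContinuousLinearMap.apply ℂ _ (coord L y))
  have hpow : ∀ n : ℕ, (adCoord L x ^ n) (coord L y) ∈ W.map (coord L).toLinearMap := by
    intro n
    induction n with
    | zero => exact ⟨y, hy, by simp⟩
    | succ n ih =>
      obtain ⟨z, hz, hz'⟩ := ih
      refine ⟨⁅x, z⁆, hW z hz, ?_⟩
      rw [pow_succ', mul_apply_eq_comp, ← hz']
      exact (adCoord_apply x z).symm
  have hm := hcl.mem_of_tendsto hs (Filter.Eventually.of_forall fun s =>
    Submodule.sum_mem _ fun n _ => by
      simpa using Submodule.smul_mem _ (n.factorial : ℂ)⁻¹ (hpow n))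
  obtain ⟨z, hz, hz'⟩ := hm
  have : z = expAd x y := (coord L).injective (by rw [coord_expAd]; exact hz')
  rwa [← this]

/-- The map `(x, b) ↦ exp (ad x) (y + b)` is open at the origin once `[A, y] + B` is everything. -/
theorem eventually_exists_expAd (A B : Submodule ℂ L) (y : L)
    (h : ∀ w : L, ∃ x ∈ A, ∃ b ∈ B, w = ⁅x, y⁆ + b) :
    ∀ᶠ w in 𝓝 (coord L y), ∃ x ∈ A, ∃ b ∈ B, w = coord L (expAd x (y + b)) := by
  let Φ : A × B →ₗ[ℂ] L :=
    LinearMap.coprod ((-(LieModule.toEnd ℂ L L y : Module.End ℂ L)) ∘ₗ A.subtype) B.subtype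
  have hΦ : LinearMap.range Φ = ⊤ := by
    rw [LinearMap.range_eq_top]
    intro w
    obtain ⟨x, hx, b, hb, rfl⟩ := h w
    exact ⟨(⟨x, hx⟩, ⟨b, hb⟩), by simp [Φ]⟩
  obtain ⟨s, hs⟩ := Φ.exists_rightInverse_of_surjective hΦ
  let S : (Fin (finrank ℂ L) → ℂ) →ₗ[ℂ] L :=
    A.subtype ∘ₗ LinearMap.fst ℂ A B ∘ₗ s ∘ₗ (coord L).symm.toLinearMap
  let T : (Fin (finrank ℂ L) → ℂ) →ₗ[ℂ] L :=
    B.subtype ∘ₗ LinearMap.snd ℂ A B ∘ₗ s ∘ₗ (coord L).symm.toLinearMap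
  have hST : ∀ w, ⁅S w, y⁆ + T w = (coord L).symm w := fun w => by
    have := LinearMap.congr_fun hs ((coord L).symm w)
    rw [← lie_skew]
    simpa [Φ, S, T, -lie_skew] using this
  let P := LinearMap.toContinuousLinearMap (adCoord L ∘ₗ S)
  let Q := LinearMap.toContinuousLinearMap ((coord L).toLinearMap ∘ₗ T)
  have hd : HasStrictFDerivAt (fun w => exp (P w) (coord L y + Q w))
      ((ContinuousLinearEquiv.refl ℂ (Fin (finrank ℂ L) → ℂ) :
        (Fin (finrank ℂ L) → ℂ) →L[ℂ] (Fin (finrank ℂ L) → ℂ))) 0 := by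
    have h1 : HasStrictFDerivAt (fun w => exp (P w)) P 0 := by
      have he : HasStrictFDerivAt exp
          (1 : ((Fin (finrank ℂ L) → ℂ) →L[ℂ] (Fin (finrank ℂ L) → ℂ)) →L[ℂ] _) (P 0) := by
        rw [map_zero]; exact hasStrictFDerivAt_exp_zero (𝕂 := ℂ)
      exact he.comp 0 P.hasStrictFDerivAt
    have h2 : HasStrictFDerivAt (fun w => coord L y + Q w) Q 0 := Q.hasStrictFDerivAt.const_add _
    refine (h1.clm_apply h2).congr_fderiv (ContinuousLinearMap.ext fun w => ?_)
    obtain ⟨w, rfl⟩ := (coord L).surjective w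
    have := congrArg (coord L) (hST (coord L w))
    rw [map_add, LinearEquiv.symm_apply_apply] at this
    change exp (P 0) (Q (coord L w)) + P (coord L w) (coord L y + Q 0) = coord L w
    rw [map_zero, map_zero, add_zero, exp_zero, one_apply_eq_self, add_comm]
    refine Eq.trans ?_ this
    rw [← adCoord_apply]
    rfl
  have hm := hd.map_nhds_eq_of_equiv
  simp only [map_zero, exp_zero, add_zero, one_apply_eq_self] at hm
  rw [← hm, Filter.eventually_map]
  refine Filter.Eventually.of_forall fun w => ⟨S w, by simp [S], T w, by simp [T], ?_⟩
  rw [coord_expAd, map_add (coord L)]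
  rfl

end LieExp

namespace LieExp

open NormedSpace Topology Module LieAlgebra

lemma related_of_locally_related {s : Set ℂ} (hs : sᶜ.Finite) {r : ℂ → ℂ → Prop}
    (hsymm : ∀ a b, r a b → r b a) (htrans : ∀ a b c, r a b → r b c → r a c)
    (hloc : ∀ a ∈ s, ∀ᶠ b in 𝓝 a, b ∈ s → r a b) {a b : ℂ} (ha : a ∈ s) (hb : b ∈ s) :
    r a b := by
  have hc : IsPreconnected s := by
    have := (hs.countable.isPathConnected_compl_of_one_lt_rank
      (by rw [Complex.rank_real_complex]; norm_num)).isConnected.isPreconnected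
    rwa [compl_compl] at this
  exact hc.induction₂ r (fun x hx => eventually_nhdsWithin_iff.mpr (hloc x hx))
    (fun x y z _ _ _ => htrans x y z) (fun x y _ _ => hsymm x y) ha hb

lemma map_engel {L : Type*} [LieRing L] [LieAlgebra ℂ L] (φ : L ≃ₗ⁅ℂ⁆ L) (x y : L) :
    φ y ∈ LieSubalgebra.engel ℂ (φ x) ↔ y ∈ LieSubalgebra.engel ℂ x := by
  have key : ∀ n : ℕ, ((LieAlgebra.ad ℂ L (φ x)) ^ n) (φ y) = φ ((LieAlgebra.ad ℂ L x ^ n) y) := by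
    intro n
    induction n with
    | zero => simp
    | succ n ih =>
      rw [pow_succ', pow_succ', Module.End.mul_apply, Module.End.mul_apply, ih, LieAlgebra.ad_apply,
        LieAlgebra.ad_apply, LieEquiv.map_lie]
  simp only [LieSubalgebra.mem_engel_iff, key]
  simp

variable {L : Type*} [LieRing L] [LieAlgebra ℂ L] [FiniteDimensional ℂ L]

lemma exists_polynomial_isRegular (x y : L) :
    ∃ p : Polynomial ℂ, ∀ t : ℂ, IsRegular ℂ (x + t • y) ↔ p.eval t ≠ 0 := by
  classical
  let b := finBasis ℂ L
  refine ⟨MvPolynomial.aeval (fun i => Polynomial.C (b.repr x i) +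
    Polynomial.X * Polynomial.C (b.repr y i))
    (((LieModule.toEnd ℂ L L : L →ₗ[ℂ] Module.End ℂ L).polyCharpoly b).coeff
      (LieAlgebra.rank ℂ L)), fun t => ?_⟩
  rw [LieAlgebra.isRegular_iff_coeff_polyCharpoly_rank_ne_zero ℂ b]
  rw [not_iff_not, ← Polynomial.coe_evalRingHom, MvPolynomial.aeval_def, MvPolynomial.hom_eval₂,
    MvPolynomial.eval, MvPolynomial.coe_eval₂Hom]
  have h1 : (Polynomial.evalRingHom t).comp (algebraMap ℂ (Polynomial ℂ)) = RingHom.id ℂ := by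
    ext; simp
  have h2 : (fun i => b.repr (x + t • y) i) = (⇑(Polynomial.evalRingHom t) ∘ fun i =>
      Polynomial.C (b.repr x i) + Polynomial.X * Polynomial.C (b.repr y i)) := by
    ext i; simp [mul_comm t]
  rw [h1]
  exact iff_of_eq (congrArg (fun v => MvPolynomial.eval₂ (RingHom.id ℂ) v _ = 0) h2)

lemma exists_isRegular_of_eventually {y : L} {P : (Fin (finrank ℂ L) → ℂ) → Prop}
    (h : ∀ᶠ w in 𝓝 (coord L y), P w) : ∃ z : L, IsRegular ℂ z ∧ P (coord L z) := by
  obtain ⟨z, hz⟩ := LieAlgebra.exists_isRegular ℂ L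
  obtain ⟨p, hp⟩ := exists_polynomial_isRegular y (z - y)
  have hp0 : p ≠ 0 := fun h0 => by
    have := (hp 1).mp (by simpa using hz)
    simp [h0] at this
  have hcont : Filter.Tendsto (fun t : ℂ => coord L (y + t • (z - y))) (𝓝 0) (𝓝 (coord L y)) := by
    have : Continuous fun t : ℂ => coord L y + t • coord L (z - y) := by fun_prop
    simpa using this.tendsto 0
  have h1 : ∀ᶠ t in 𝓝[≠] (0 : ℂ), P (coord L (y + t • (z - y))) :=
    (hcont.eventually h).filter_mono nhdsWithin_le_nhds
  have h2 : ∀ᶠ t in 𝓝[≠] (0 : ℂ), p.eval t ≠ 0 := by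
    have hfin : {t : ℂ | p.IsRoot t}.Finite := Polynomial.finite_setOfPred_isRoot hp0
    have := (hfin.subset (Set.sdiff_subset (t := {0}))).isClosed.isOpen_compl.mem_nhds
      (x := (0 : ℂ)) (by simp)
    filter_upwards [nhdsWithin_le_nhds this, self_mem_nhdsWithin] with t ht h0 hr
    exact ht ⟨hr, h0⟩
  obtain ⟨t, ht1, ht2⟩ := (h1.and h2).exists
  exact ⟨_, (hp t).mpr ht2, ht1⟩

lemma isRegular_map (φ : L ≃ₗ⁅ℂ⁆ L) {x : L} (hx : IsRegular ℂ (φ x)) : IsRegular ℂ x := by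
  rw [LieAlgebra.isRegular_iff_finrank_engel_eq_rank] at hx ⊢
  rw [← hx]
  have : (LieSubalgebra.engel ℂ x).toSubmodule.map (φ.toLinearEquiv : L →ₗ[ℂ] L) =
      (LieSubalgebra.engel ℂ (φ x)).toSubmodule := by
    ext z
    constructor
    · rintro ⟨y, hy, rfl⟩
      exact (map_engel φ x y).mpr hy
    · intro hz
      exact ⟨φ.symm z, (map_engel φ x _).mp (by simpa using hz), by simp⟩
  exact ((φ.toLinearEquiv.finrank_map_eq (LieSubalgebra.engel ℂ x).toSubmodule).symm.trans
    (by rw [this]; rfl))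

lemma engel_eq_of_isRegular {y z : L} (hy : IsRegular ℂ y) (hz : IsRegular ℂ z)
    (hzy : z ∈ LieSubalgebra.engel ℂ y) :
    LieSubalgebra.engel ℂ z = LieSubalgebra.engel ℂ y := by
  rw [LieAlgebra.isRegular_iff_finrank_engel_eq_rank] at hy hz
  have hmin : IsMin (⟨LieSubalgebra.engel ℂ y, y, LieSubalgebra.self_mem_engel ℂ y, rfl⟩ :
      {x | ∃ x_1 ∈ LieSubalgebra.engel ℂ y, LieSubalgebra.engel ℂ x_1 = x}) := by
    rintro ⟨_, w, hw, rfl⟩ hle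
    change LieSubalgebra.engel ℂ w ≤ LieSubalgebra.engel ℂ y at hle
    change LieSubalgebra.engel ℂ y ≤ LieSubalgebra.engel ℂ w
    have := Submodule.eq_of_le_of_finrank_le
      (show (LieSubalgebra.engel ℂ w).toSubmodule ≤ (LieSubalgebra.engel ℂ y).toSubmodule from hle)
      (hy.le.trans (LieAlgebra.rank_le_finrank_engel ℂ w))
    exact fun x hx => this.ge hx
  have hbot := LieAlgebra.engel_isBot_of_isMin
    (Cardinal.natCast_le_aleph0.trans (Cardinal.infinite_iff.mp inferInstance))
    (LieSubalgebra.engel ℂ y) _ le_rfl hmin ⟨LieSubalgebra.engel ℂ z, z, hzy, rfl⟩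
  have := Submodule.eq_of_le_of_finrank_le
    (show (LieSubalgebra.engel ℂ y).toSubmodule ≤ (LieSubalgebra.engel ℂ z).toSubmodule from hbot)
    (hz.le.trans hy.ge)
  exact le_antisymm (fun x hx => this.ge hx) hbot

lemma eventually_conj_engel {y : L} (hy : IsRegular ℂ y) :
    ∀ᶠ w in 𝓝 (coord L y), ∀ z, w = coord L z → IsRegular ℂ z → ∃ φ : L ≃ₗ⁅ℂ⁆ L,
      ∀ x, x ∈ LieSubalgebra.engel ℂ y ↔ φ x ∈ LieSubalgebra.engel ℂ z := by
  have hfit : ∀ w : L, ∃ x ∈ (⊤ : Submodule ℂ L), ∃ b ∈ (LieSubalgebra.engel ℂ y).toSubmodule,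
      w = ⁅x, y⁆ + b := by
    intro w
    obtain ⟨n, hn, hc⟩ := ((Filter.eventually_gt_atTop 0).and
      (LieAlgebra.ad ℂ L y).eventually_isCompl_ker_pow_range_pow).exists
    have hw : w ∈ LinearMap.ker (LieAlgebra.ad ℂ L y ^ n) ⊔
        LinearMap.range (LieAlgebra.ad ℂ L y ^ n) := by
      rw [hc.sup_eq_top]; trivial
    obtain ⟨b, hb, _, ⟨x, rfl⟩, rfl⟩ := Submodule.mem_sup.mp hw
    obtain ⟨m, rfl⟩ := Nat.exists_eq_succ_of_ne_zero hn.ne'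
    refine ⟨-((LieAlgebra.ad ℂ L y ^ m) x), trivial, b,
      (LieSubalgebra.mem_engel_iff ℂ y b).mpr ⟨_, hb⟩, ?_⟩
    rw [pow_succ', Module.End.mul_apply, LieAlgebra.ad_apply, neg_lie, lie_skew, add_comm]
  filter_upwards [eventually_exists_expAd _ _ y hfit] with w hw z hwz hz
  obtain ⟨x, -, b, hb, rfl⟩ := hw
  have hzz := (coord L).injective hwz
  rw [← hzz] at hz ⊢
  have hyb : y + b ∈ LieSubalgebra.engel ℂ y := add_mem (LieSubalgebra.self_mem_engel ℂ y) hb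
  exact ⟨expAd x, fun v => by
    rw [map_engel, engel_eq_of_isRegular hy (isRegular_map _ hz) hyb]⟩

theorem exists_conj_engel {y z : L} (hy : IsRegular ℂ y) (hz : IsRegular ℂ z) :
    ∃ φ : L ≃ₗ⁅ℂ⁆ L, ∀ x, x ∈ LieSubalgebra.engel ℂ y ↔ φ x ∈ LieSubalgebra.engel ℂ z := by
  obtain ⟨p, hp⟩ := exists_polynomial_isRegular y (z - y)
  have hp0 : p ≠ 0 := fun h0 => by
    have := (hp 0).mp (by simpa using hy)
    simp [h0] at this
  have key := related_of_locally_related (s := {t : ℂ | IsRegular ℂ (y + t • (z - y))})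
    (r := fun a b => ∃ φ : L ≃ₗ⁅ℂ⁆ L, ∀ x, x ∈ LieSubalgebra.engel ℂ (y + a • (z - y)) ↔
      φ x ∈ LieSubalgebra.engel ℂ (y + b • (z - y)))
    ((Polynomial.finite_setOfPred_isRoot hp0).subset fun t ht => by
      by_contra h
      exact ht ((hp t).mpr h))
    (fun a b ⟨φ, hφ⟩ => ⟨φ.symm, fun x => by rw [hφ]; simp⟩)
    (fun a b c ⟨φ, hφ⟩ ⟨ψ, hψ⟩ => ⟨φ.trans ψ, fun x => by rw [hφ, hψ]; rfl⟩)
    (fun a ha => by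
      have hcont : Continuous fun t : ℂ => coord L (y + t • (z - y)) := by
        have : Continuous fun t : ℂ => coord L y + t • coord L (z - y) := by fun_prop
        simpa using this
      filter_upwards [(hcont.tendsto a).eventually (eventually_conj_engel ha)] with b hb hreg
      exact hb _ rfl hreg)
    (a := 0) (b := 1) (by simpa using hy) (by simpa using hz)
  simpa using key

lemma exists_isRegular_commute {h : L}
    (hss : ∀ w : L, ∃ x z : L, ⁅h, z⁆ = 0 ∧ w = ⁅x, h⁆ + z) :
    ∃ y : L, IsRegular ℂ y ∧ ⁅h, y⁆ = 0 := by
  have := eventually_exists_expAd ⊤ (LinearMap.ker (LieAlgebra.ad ℂ L h)) h (fun w => by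
    obtain ⟨x, z, hz, hw⟩ := hss w
    exact ⟨x, trivial, z, hz, hw⟩)
  obtain ⟨_, hreg, x, -, b, hb, hz⟩ := exists_isRegular_of_eventually this
  rw [(coord L).injective hz] at hreg
  exact ⟨h + b, isRegular_map _ hreg, by
    rw [lie_add, lie_self, zero_add]; exact hb⟩

/-- Every `ad`-semisimple element is conjugate into the centralizer `H₀` of `h₀`, provided that
`h₀` is `ad`-semisimple and `H₀` is abelian. -/
theorem exists_conj_mem {h h₀ : L} (hss : ∀ w : L, ∃ x z : L, ⁅h, z⁆ = 0 ∧ w = ⁅x, h⁆ + z)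
    (hss₀ : ∀ w : L, ∃ x z : L, ⁅h₀, z⁆ = 0 ∧ w = ⁅x, h₀⁆ + z) (H₀ : Submodule ℂ L)
    (hab : ∀ x ∈ H₀, ∀ y ∈ H₀, ⁅x, y⁆ = 0)
    (hen : ∀ x ∈ LieSubalgebra.engel ℂ h₀, x ∈ H₀) :
    ∃ φ : L ≃ₗ⁅ℂ⁆ L, φ h ∈ H₀ := by
  obtain ⟨y, hy, hyh⟩ := exists_isRegular_commute hss
  obtain ⟨y₀, hy₀, hyh₀⟩ := exists_isRegular_commute hss₀
  have hy₀H : y₀ ∈ H₀ := hen _ ((LieSubalgebra.mem_engel_iff ℂ _ _).mpr ⟨1, by simpa using hyh₀⟩)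
  have hle : H₀ ≤ (LieSubalgebra.engel ℂ y₀).toSubmodule := fun x hx =>
    (LieSubalgebra.mem_engel_iff ℂ _ _).mpr ⟨1, by simpa using hab _ hy₀H _ hx⟩
  have heq : H₀ = (LieSubalgebra.engel ℂ y₀).toSubmodule := by
    refine Submodule.eq_of_le_of_finrank_le hle ?_
    rw [LieAlgebra.isRegular_iff_finrank_engel_eq_rank] at hy₀
    exact (hy₀.le.trans (LieAlgebra.rank_le_finrank_engel ℂ h₀)).trans
      (Submodule.finrank_mono (s := (LieSubalgebra.engel ℂ h₀).toSubmodule) hen)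
  obtain ⟨φ, hφ⟩ := exists_conj_engel hy hy₀
  refine ⟨φ, ?_⟩
  rw [heq]
  refine (hφ h).mp ((LieSubalgebra.mem_engel_iff ℂ _ _).mpr ⟨1, ?_⟩)
  rw [pow_one, LieAlgebra.ad_apply, ← lie_skew, hyh, neg_zero]

lemma finite_not_surjective {V W : Type*} [AddCommGroup V] [Module ℂ V] [AddCommGroup W]
    [Module ℂ W] [FiniteDimensional ℂ W] (M N : V →ₗ[ℂ] W) (hM : Function.Surjective M) :
    {t : ℂ | ¬ Function.Surjective (M + t • N)}.Finite := by
  obtain ⟨s, hs⟩ := M.exists_rightInverse_of_surjective (LinearMap.range_eq_top.mpr hM)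
  have hfin : {t : ℂ | Module.End.HasEigenvalue (N ∘ₗ s) (-t⁻¹)}.Finite :=
    Set.Finite.preimage (f := fun t : ℂ => -t⁻¹)
      (fun a _ b _ hab => inv_injective (neg_injective hab))
      (Module.End.finite_hasEigenvalue (N ∘ₗ s))
  refine hfin.subset fun t ht => ?_
  have hns : ¬ Function.Surjective ((M + t • N) ∘ₗ s) := fun h => ht (by
    intro w
    obtain ⟨v, hv⟩ := h w
    exact ⟨s v, hv⟩)
  rw [← LinearMap.injective_iff_surjective, injective_iff_map_eq_zero] at hns
  push Not at hns
  obtain ⟨w, hw, hw0⟩ := hns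
  have hw' : w + t • N (s w) = 0 := by
    have := LinearMap.congr_fun hs w
    simp only [LinearMap.comp_apply, LinearMap.id_apply] at this
    simpa [this] using hw
  have ht0 : t ≠ 0 := fun h0 => hw0 (by simpa [h0] using hw')
  refine Module.End.hasEigenvalue_of_hasEigenvector (x := w)
    ⟨Module.End.mem_eigenspace_iff.mpr ?_, hw0⟩
  have := congrArg (fun z => t⁻¹ • z) hw'
  simp only [smul_add, smul_smul, inv_mul_cancel₀ ht0, one_smul, smul_zero] at this
  rw [LinearMap.comp_apply, neg_smul]
  exact (neg_eq_of_add_eq_zero_right this).symm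

lemma eventually_conj_of_lie_eq {h y : L} {G B : Submodule ℂ L}
    (hG : ∀ x : L, ⁅h, x⁆ = 0 → ∀ w ∈ G, ⁅x, w⁆ ∈ G) (hGB : Disjoint G B)
    (htop : ∀ w, ∃ u ∈ G, ∃ b ∈ B, w = u + b) (hy : y ∈ G)
    (hsurj : ∀ w ∈ G, ∃ x : L, ⁅h, x⁆ = 0 ∧ ⁅x, y⁆ = w) :
    ∀ᶠ w in 𝓝 (coord L y), ∀ z ∈ G, w = coord L z →
      ∃ φ : L ≃ₗ⁅ℂ⁆ L, φ h = h ∧ φ y = z := by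
  filter_upwards [eventually_exists_expAd (LinearMap.ker (LieAlgebra.ad ℂ L h)) B y (fun w => by
    obtain ⟨u, hu, b, hb, rfl⟩ := htop w
    obtain ⟨x, hx, rfl⟩ := hsurj u hu
    exact ⟨x, hx, b, hb, rfl⟩)] with w hw z hz hwz
  obtain ⟨x, hx, b, hb, rfl⟩ := hw
  have hzz := (coord L).injective hwz
  have hx' : ⁅h, x⁆ = 0 := hx
  have hmem : y + b ∈ G := by
    have := expAd_mem (x := -x) G (hG (-x) (by rw [lie_neg, hx', neg_zero])) hz
    rw [← hzz] at this
    have h2 : expAd (-x) (expAd x (y + b)) = y + b := expLin_neg x (y + b)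
    rwa [h2] at this
  have hb0 : b = 0 := Submodule.disjoint_def.mp hGB b (by simpa using sub_mem hmem hy) hb
  refine ⟨expAd x, ?_, by rw [← hzz, hb0, add_zero]⟩
  have hxh : ⁅x, h⁆ = 0 := by rw [← lie_skew, hx', neg_zero]
  rw [expAd_apply_of_sq (by rw [hxh, lie_zero]), hxh, add_zero]

theorem exists_conj_of_lie_eq {h y z : L} {G B : Submodule ℂ L}
    (hG : ∀ x : L, ⁅h, x⁆ = 0 → ∀ w ∈ G, ⁅x, w⁆ ∈ G) (hGB : Disjoint G B)
    (htop : ∀ w, ∃ u ∈ G, ∃ b ∈ B, w = u + b) (hy : y ∈ G) (hz : z ∈ G)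
    (hsurj : ∀ w ∈ G, ∃ x : L, ⁅h, x⁆ = 0 ∧ ⁅x, y⁆ = w)
    (hsurj' : ∀ w ∈ G, ∃ x : L, ⁅h, x⁆ = 0 ∧ ⁅x, z⁆ = w) :
    ∃ φ : L ≃ₗ⁅ℂ⁆ L, φ h = h ∧ φ y = z := by
  let K : Submodule ℂ L := LinearMap.ker (LieAlgebra.ad ℂ L h)
  let m : G → K →ₗ[ℂ] G := fun v =>
    { toFun := fun x => ⟨⁅(x : L), (v : L)⁆, hG x x.2 v v.2⟩
      map_add' := fun a b => Subtype.ext (by simp)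
      map_smul' := fun a b => Subtype.ext (by simp) }
  have hm : ∀ v : G, Function.Surjective (m v) ↔ ∀ w ∈ G, ∃ x : L, ⁅h, x⁆ = 0 ∧ ⁅x, (v : L)⁆ = w :=
    fun v => ⟨fun hs w hw => by
      obtain ⟨x, hx⟩ := hs ⟨w, hw⟩
      exact ⟨x, x.2, congrArg Subtype.val hx⟩, fun hs w => by
      obtain ⟨x, hx, hxw⟩ := hs w w.2
      exact ⟨⟨x, hx⟩, Subtype.ext hxw⟩⟩
  let Y : G := ⟨y, hy⟩
  let Z : G := ⟨z, hz⟩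
  have hlin : ∀ t : ℂ, m (Y + t • (Z - Y)) = m Y + t • m (Z - Y) := fun t => by
    ext x; simp [m]
  have key := related_of_locally_related
    (s := {t : ℂ | Function.Surjective (m (Y + t • (Z - Y)))})
    (r := fun a b => ∃ φ : L ≃ₗ⁅ℂ⁆ L, φ h = h ∧ φ (y + a • (z - y)) = y + b • (z - y))
    ((finite_not_surjective (m Y) (m (Z - Y)) ((hm Y).mpr hsurj)).subset fun t ht => by
      rw [Set.mem_compl_iff, Set.mem_ofPred_eq, hlin] at ht
      exact ht)
    (fun a b ⟨φ, hφ, hφ'⟩ => ⟨φ.symm, by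
      rw [LieEquiv.symm_apply_eq, hφ], by rw [LieEquiv.symm_apply_eq, hφ']⟩)
    (fun a b c ⟨φ, hφ, hφ'⟩ ⟨ψ, hψ, hψ'⟩ => ⟨φ.trans ψ, by
      rw [LieEquiv.trans_apply, hφ, hψ], by rw [LieEquiv.trans_apply, hφ', hψ']⟩)
    (fun a ha => by
      have hcont : Continuous fun t : ℂ => coord L (y + t • (z - y)) := by
        have : Continuous fun t : ℂ => coord L y + t • coord L (z - y) := by fun_prop
        simpa using this
      filter_upwards [(hcont.tendsto a).eventually (eventually_conj_of_lie_eq hG hGB htop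
        (Y + a • (Z - Y)).2 ((hm _).mp ha))] with b hb _
      exact hb _ (Y + b • (Z - Y)).2 rfl)
    (a := 0) (b := 1) (by simpa using (hm Y).mpr hsurj) (by simpa using (hm Z).mpr hsurj')
  simpa using key

end LieExp

namespace E6

/-! ### Root combinatorics

The roots of `E₆` are numbered `0, …, 71`: first the simple roots, then the other positive roots by
height, then the negatives of these in the same order.  The numbers `72, …, 77` stand for the simple
coroots.  A root is encoded by the hexadecimal digits of its coefficients, each shifted by `8`; thus
`8947848` with the digits `888888` is the code of zero. -/

/-- The codes of the positive roots, six hexadecimal digits each. -/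
def positiveCodes : ℕ :=
  74344428862043954252848799157715025657193140690091573807810842652599635211317309875220777105763893762435052703002046013308006771495069110914763172438586989243362867902966082455583636894173168862538649100984148615092622404085372110967829402100102727995918682249

/-- The code of the `k`-th root, or of zero if `72 ≤ k`. -/
def code (k : ℕ) : ℕ :=
  bif k.blt 36 then (positiveCodes >>> (24 * k)) % 16777216
  else bif k.blt 72 then 17895696 - (positiveCodes >>> (24 * (k - 36))) % 16777216
  else 8947848

/-- A hash table, with respect to the residue modulo `198`, of the numbers of the roots. -/
def indexTable : ℕ :=
  51762013007469528855548010902274067967548186143344336392224889955263836054804988019464103158146695281134372840654590573464992221375932505625469761134961096682496850508982754164940074376501051150386359934228265402151955621748553820767139778430638781171850494474649103653167027263259260653726851303864511959859719965194231928068464559044297244351895383863627887791089842505302153116598374359442003550346163969545908595066560165092926713978637082986188583507903702846087888896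

/-- The number of the root with the given code; it is at least `72` if there is none. -/
def index (c : ℕ) : ℕ :=
  let k := (indexTable >>> (8 * (c % 198))) % 256
  bif (code k).beq c then k else 100

/-- The coefficient of the `k`-th root at the `i`-th simple root. -/
def coeff (k i : ℕ) : ℤ := ((code k >>> (4 * i)) % 16 : ℕ) - 8

/-- The sign `ε(α, β)` of a bilinear cocycle with `ε(α, α) = (-1) ^ ((α, α) / 2)`. -/
def sign (c d : ℕ) : ℤ :=
  bif ((c &&& d &&& 1118481) % 15 + (c &&& (d >>> 8) &&& 17) % 15 +
    (c &&& (d >>> 4) &&& 69888) % 15) % 2 == 0 then 1 else -1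

/-- The Cartan matrix of type `E₆`. -/
def cartan (i j : ℕ) : ℤ :=
  bif i.beq j then 2 else
    bif ((1 <<< (6 * i + j)) &&& 17856762372).beq 0 then 0 else -1

/-- The pairing of the `k`-th root with the `i`-th simple coroot. -/
def pairing (i k : ℕ) : ℤ :=
  cartan i 0 * coeff k 0 + cartan i 1 * coeff k 1 + cartan i 2 * coeff k 2 +
    cartan i 3 * coeff k 3 + cartan i 4 * coeff k 4 + cartan i 5 * coeff k 5

/-- A positive root smaller than the `d`-th positive root by a simple root. -/
def parent (d : ℕ) : ℕ :=
  (66302086794266674373869820330249216550121687292697898578444745189070486734102868262912 >>> (8 * d)) % 256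

/-- The simple root by which the `d`-th positive root exceeds its parent. -/
def parentStep (d : ℕ) : ℕ := (1666705712407739497618246900063864432361472 >>> (4 * d)) % 16


/-- The number of the sum of the `i`-th simple root and the `d`-th positive root, or `36`. -/
def up (i d : ℕ) : ℕ :=
  bif d.blt 36 then min 36 (index (code i + code d - 8947848)) else 36

/-- The number of the difference of the `d`-th positive root and the `i`-th simple root, or `36`. -/
def down (i d : ℕ) : ℕ := min 36 (index (code d + 8947848 - code i))

section Positive

variable {L : Type*} [LieRing L]

/-- The root vectors attached to the positive roots. -/
def posVec (E : ℕ → L) (d : ℕ) : L :=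
  if d < 6 then E d
  else if _h : parent d < d ∧ d < 36 then
    sign (code (parentStep d)) (code (parent d)) • ⁅E (parentStep d), posVec E (parent d)⁆
  else 0
termination_by d
decreasing_by exact _h.1

theorem sign_mul_self (c d : ℕ) : sign c d * sign c d = 1 := by
  unfold sign
  cases (_ == 0 : Bool) <;> simp

/-- The rule for the bracket of a simple root vector with a positive root vector. -/
def Raises (E : ℕ → L) (i d : ℕ) : Prop :=
  ⁅E i, posVec E d⁆ = sign (code i) (code d) • posVec E (up i d)

theorem posVec_of_lt (E : ℕ → L) {d : ℕ} (h : d < 6) : posVec E d = E d := by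
  rw [posVec, if_pos h]

theorem posVec_eq_zero (E : ℕ → L) : posVec E 36 = 0 := by
  rw [posVec, if_neg (by norm_num), dif_neg (by norm_num)]

/-- The root `b` is obtained from its parent `d` by adding the `i`-th simple root. -/
def IsStep (i d b : ℕ) : Prop :=
  6 ≤ b ∧ b < 36 ∧ parent b = d ∧ parentStep b = i ∧ d < b

instance (i d b : ℕ) : Decidable (IsStep i d b) := inferInstanceAs (Decidable (_ ∧ _))

theorem Raises.of_isStep {E : ℕ → L} {i d : ℕ} (h : IsStep i d (up i d)) : Raises E i d := by
  obtain ⟨h1, h2, h3, h4, h5⟩ := h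
  unfold Raises
  generalize up i d = b at *
  rw [posVec.eq_def E b, if_neg (by omega), dif_pos ⟨by omega, h2⟩, h3, h4, smul_smul,
    sign_mul_self, one_smul]

theorem Raises.posVec_eq {E : ℕ → L} {j c d : ℕ} (h : Raises E j c) (hd : up j c = d) :
    posVec E d = sign (code j) (code c) • ⁅E j, posVec E c⁆ := by
  rw [h, smul_smul, sign_mul_self, one_smul, hd]

theorem Raises.of_eq_zero {E : ℕ → L} {i d : ℕ} (h : up i d = 36) (h' : ⁅E i, posVec E d⁆ = 0) :
    Raises E i d := by
  rw [Raises, h, h', posVec_eq_zero, smul_zero]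

theorem Raises.eq_zero {E : ℕ → L} {i d : ℕ} (h : Raises E i d) (hu : up i d = 36) :
    ⁅E i, posVec E d⁆ = 0 := by
  rw [h, hu, posVec_eq_zero, smul_zero]

/-- The Serre relations satisfied by the generators of the positive part. -/
structure Serre (E : ℕ → L) : Prop where
  comm : ∀ i < 6, ∀ j < 6, cartan i j = 0 → ⁅E i, E j⁆ = 0
  cube : ∀ i < 6, ∀ j < 6, cartan i j = -1 → ⁅E i, ⁅E i, E j⁆⁆ = 0

theorem Serre.lie_lie_comm {E : ℕ → L} (hE : Serre E) {i j : ℕ} (hi : i < 6) (hj : j < 6)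
    (h : cartan i j = 0) (x : L) : ⁅E i, ⁅E j, x⁆⁆ = ⁅E j, ⁅E i, x⁆⁆ := by
  rw [leibniz_lie, hE.comm i hi j hj h, zero_lie, zero_add]

theorem Serre.lie_lie_lie {E : ℕ → L} (hE : Serre E) {i j : ℕ} (hi : i < 6) (hj : j < 6)
    (h : cartan i j = -1) (x : L) :
    ⁅E i, ⁅E i, ⁅E j, x⁆⁆⁆ = (2 : ℤ) • ⁅E i, ⁅E j, ⁅E i, x⁆⁆⁆ - ⁅E j, ⁅E i, ⁅E i, x⁆⁆⁆ := by
  have h1 := hE.cube i hi j hj h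
  have h2 : ⁅⁅E i, ⁅E i, E j⁆⁆, x⁆ = 0 := by rw [h1, zero_lie]
  rw [lie_lie, lie_lie, lie_lie, lie_sub] at h2
  have : ⁅E i, ⁅E i, ⁅E j, x⁆⁆⁆ = ⁅E i, ⁅E i, ⁅E j, x⁆⁆⁆ - 0 := by rw [sub_zero]
  rw [this, ← h2]
  abel

/-- The ways in which the rule for the pair `(i, d)` follows from the rules for smaller roots. -/
def Derivable (i d : ℕ) : Prop :=
  IsStep i d (up i d) ∨
  (d < 6 ∧ (up i d = 36 ∧ (i = d ∨ cartan i d = 0) ∨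
    IsStep d i (up d i) ∧ up i d = up d i ∧
      sign (code i) (code d) = -sign (code d) (code i))) ∨
  (∃ j < 6, cartan i j = 0 ∧ down j d < d ∧ up j (down j d) = d ∧
    (up i (down j d) = 36 ∧ up i d = 36 ∨
      (up i (down j d) < d ∨ IsStep j (up i (down j d)) (up i d)) ∧
      up j (up i (down j d)) = up i d ∧
      (up i d = 36 ∨ sign (code j) (code (down j d)) * sign (code i) (code (down j d)) *
        sign (code j) (code (up i (down j d))) = sign (code i) (code d)))) ∨
  (up i d = 36 ∧ down i d < d ∧ up i (down i d) = d ∧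
    (down i d < 6 ∧ cartan i (down i d) = -1 ∨
      ∃ k < 6, cartan i k = -1 ∧ down k (down i d) < d ∧
        up k (down k (down i d)) = down i d ∧ up i (down k (down i d)) = 36)) ∨
  (up i d = 36 ∧ ∃ j < 6, cartan i j = -1 ∧ down j d < d ∧ up j (down j d) = d ∧
    down i (down j d) < d ∧ up i (down i (down j d)) = down j d ∧
    up j (down i (down j d)) = 36 ∧ up i (down j d) = 36)

instance (i d : ℕ) : Decidable (Derivable i d) := inferInstanceAs (Decidable (_ ∨ _))

set_option maxRecDepth 10000 in
theorem derivable : ∀ d < 36, ∀ i < 6, Derivable i d := by decide +kernel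

theorem Serre.raises [IsAddTorsionFree L] {E : ℕ → L} (hE : Serre E) :
    ∀ d < 36, ∀ i < 6, Raises E i d := by
  intro d
  induction d using Nat.strong_induction_on with
  | _ d ih =>
  intro hd i hi
  rcases derivable d hd i hi with h | ⟨hd6, h⟩ | ⟨j, hj, hij, hlt, hup, h⟩ | ⟨hu, hlt, hup, h⟩ |
    ⟨hu, j, hj, hij, hlt, hup, hlt', hup', hj', hi'⟩
  · exact Raises.of_isStep h
  · rcases h with ⟨hu, rfl | h⟩ | ⟨hs, hu, hsign⟩
    · exact Raises.of_eq_zero hu (by rw [posVec_of_lt E hd6, lie_self])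
    · exact Raises.of_eq_zero hu (by rw [posVec_of_lt E hd6, hE.comm i hi d hd6 h])
    · have h1 : Raises E d i := Raises.of_isStep hs
      rw [Raises, posVec_of_lt E hi] at h1
      rw [Raises, posVec_of_lt E hd6, ← lie_skew, h1, hu, hsign, neg_smul]
  · have h1 := ih _ hlt (by omega) j hj
    have h2 := ih _ hlt (by omega) i hi
    generalize down j d = c at *
    have h3 : ⁅E i, posVec E d⁆ = (sign (code j) (code c) * sign (code i) (code c)) •
        ⁅E j, posVec E (up i c)⁆ := by
      rw [h1.posVec_eq hup, lie_smul, hE.lie_lie_comm hi hj hij, h2, lie_smul, smul_smul]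
    rcases h with ⟨h4, h5⟩ | ⟨h4, h5, h6⟩
    · exact Raises.of_eq_zero h5 (by rw [h3, h4, posVec_eq_zero, lie_zero, smul_zero])
    · have h7 : Raises E j (up i c) := by
        rcases h4 with h4 | h4
        · exact ih _ h4 (by omega) j hj
        · exact Raises.of_isStep (by rwa [h5])
      rcases h6 with h6 | h6
      · exact Raises.of_eq_zero h6 (by rw [h3, h7.eq_zero (by rw [h5, h6]), smul_zero])
      · rw [Raises, h3, h7, smul_smul, h5, h6]
  · refine Raises.of_eq_zero hu ?_
    have h1 := ih _ hlt (by omega) i hi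
    rw [h1.posVec_eq hup, lie_smul]
    generalize down i d = c at *
    rcases h with ⟨hc, hic⟩ | ⟨k, hk, hik, hlt', hup', h⟩
    · rw [posVec_of_lt E hc, hE.cube i hi c hc hic, smul_zero]
    · have h2 := ih _ hlt' (by omega) k hk
      have h3 := (ih _ hlt' (by omega) i hi).eq_zero h
      rw [h2.posVec_eq hup', lie_smul, lie_smul, hE.lie_lie_lie hi hk hik, h3]
      simp
  · refine Raises.of_eq_zero hu ?_
    have h1 := ih _ hlt (by omega) j hj
    have h4 := (ih _ hlt (by omega) i hi).eq_zero hi'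
    rw [h1.posVec_eq hup, lie_smul]
    generalize down j d = c at *
    have h2 := ih _ hlt' (by omega) i hi
    have h3 := (ih _ hlt' (by omega) j hj).eq_zero hj'
    rw [h2.posVec_eq hup'] at h4 ⊢
    have h5 := hE.lie_lie_lie hi hj hij (posVec E (down i c))
    rw [lie_smul] at h4
    have h6 : ⁅E i, ⁅E i, posVec E (down i c)⁆⁆ = 0 := by
      have := congrArg (sign (code i) (code (down i c)) • ·) h4
      simpa [smul_smul, sign_mul_self] using this
    rw [h3, h6] at h5
    simp only [lie_zero, sub_zero] at h5
    have h7 := zsmul_right_injective (show (2 : ℤ) ≠ 0 by norm_num)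
      (h5.symm.trans (smul_zero (2 : ℤ)).symm)
    rw [lie_smul, lie_smul, h7, smul_zero, smul_zero]

end Positive

/-! ### Formal combinations of basis elements -/

section Formal

/-- Insert a term into a sorted formal combination. -/
def insertTerm (k : ℕ) (c : ℤ) : List (ℕ × ℤ) → List (ℕ × ℤ)
  | [] => [(k, c)]
  | p :: l =>
    bif k.blt p.1 then (k, c) :: p :: l
    else bif k.beq p.1 then (bif c + p.2 == 0 then l else (k, c + p.2) :: l)
    else p :: insertTerm k c l

/-- The sorted form of a formal combination. -/
def normalize : List (ℕ × ℤ) → List (ℕ × ℤ)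
  | [] => []
  | p :: l => bif p.2 == 0 then normalize l else insertTerm p.1 p.2 (normalize l)

/-- Scalar multiples of formal combinations. -/
def scale (c : ℤ) (l : List (ℕ × ℤ)) : List (ℕ × ℤ) := l.map fun p => (p.1, c * p.2)

/-- Whether the formal combination is zero. -/
def isZero (l : List (ℕ × ℤ)) : Bool := (normalize l).isEmpty

variable {L : Type*} [AddCommGroup L]

/-- The value of a formal combination. -/
def ev (b : ℕ → L) : List (ℕ × ℤ) → L
  | [] => 0
  | p :: l => p.2 • b p.1 + ev b l

variable (b : ℕ → L)

theorem ev_insertTerm (k : ℕ) (c : ℤ) (l : List (ℕ × ℤ)) :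
    ev b (insertTerm k c l) = c • b k + ev b l := by
  induction l with
  | nil => simp [insertTerm, ev]
  | cons p l ih =>
    rw [insertTerm]
    cases hlt : k.blt p.1
    · cases heq : k.beq p.1
      · simp only [cond_false, ev, ih]
        abel
      · have hk : k = p.1 := Nat.eq_of_beq_eq_true heq
        cases hc : (c + p.2 == 0)
        · simp only [cond_false, cond_true, ev, hk, add_smul]
          abel
        · have hc' : c + p.2 = 0 := by simpa using hc
          simp only [cond_false, cond_true, ev, hk]
          rw [← add_assoc, ← add_smul, hc', zero_smul, zero_add]
    · simp [ev]

theorem ev_normalize (l : List (ℕ × ℤ)) : ev b (normalize l) = ev b l := by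
  induction l with
  | nil => rfl
  | cons p l ih =>
    rw [normalize]
    cases hc : (p.2 == 0)
    · simp [ev, ev_insertTerm, ih]
    · have hc' : p.2 = 0 := by simpa using hc
      simp [ev, ih, hc']

theorem ev_append (l l' : List (ℕ × ℤ)) : ev b (l ++ l') = ev b l + ev b l' := by
  induction l with
  | nil => simp [ev]
  | cons p l ih => simp [ev, ih, add_assoc]

theorem ev_scale (c : ℤ) (l : List (ℕ × ℤ)) : ev b (scale c l) = c • ev b l := by
  induction l with
  | nil => simp [ev, scale]
  | cons p l ih =>
    simp only [scale, List.map_cons, ev, smul_add, mul_smul] at ih ⊢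
    rw [ih]

theorem ev_eq_zero {l : List (ℕ × ℤ)} (h : isZero l = true) : ev b l = 0 := by
  rw [← ev_normalize, List.isEmpty_iff.mp h, ev]

end Formal

/-! ### The multiplication table -/

/-- The bracket of two basis elements. -/
def table (t k : ℕ) : List (ℕ × ℤ) :=
  bif Nat.ble 72 t then
    bif Nat.ble 72 k then []
    else let c := pairing (t - 72) k; bif c == 0 then [] else [(k, c)]
  else bif Nat.ble 72 k then
    let c := pairing (k - 72) t; bif c == 0 then [] else [(t, -c)]
  else
    let s := code t + code k - 8947848
    bif s.beq 8947848 then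
      normalize [(72, -coeff t 0), (73, -coeff t 1), (74, -coeff t 2), (75, -coeff t 3),
        (76, -coeff t 4), (77, -coeff t 5)]
    else
      let m := index s
      bif m.blt 72 then [(m, sign (code t) (code k))] else []

/-- The bracket of a basis element with a formal combination. -/
def act (t : ℕ) : List (ℕ × ℤ) → List (ℕ × ℤ)
  | [] => []
  | p :: l => scale p.2 (table t p.1) ++ act t l

/-- The bracket of two formal combinations. -/
def bracket : List (ℕ × ℤ) → List (ℕ × ℤ) → List (ℕ × ℤ)
  | [], _ => []
  | p :: l, l' => scale p.2 (act p.1 l') ++ bracket l l'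

section Table

variable {L : Type*} [LieRing L]

/-- The bracket of the basis elements `t` and `k` is given by the table. -/
def Tabulated (b : ℕ → L) (t k : ℕ) : Prop := ⁅b t, b k⁆ = ev b (table t k)

theorem lie_ev {b : ℕ → L} {t : ℕ} {l : List (ℕ × ℤ)} (h : ∀ p ∈ l, Tabulated b t p.1) :
    ⁅b t, ev b l⁆ = ev b (act t l) := by
  induction l with
  | nil => simp [ev, act]
  | cons p l ih =>
    rw [ev, act, ev_append, ev_scale, lie_add, lie_smul, h p (by simp),
      ih fun q hq => h q (by simp [hq])]

theorem ev_lie_ev {b : ℕ → L} {l l' : List (ℕ × ℤ)}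
    (h : ∀ p ∈ l, ∀ q ∈ l', Tabulated b p.1 q.1) :
    ⁅ev b l, ev b l'⁆ = ev b (bracket l l') := by
  induction l with
  | nil => simp [ev, bracket]
  | cons p l ih =>
    rw [ev, bracket, ev_append, ev_scale, add_lie, smul_lie, lie_ev (h p (by simp)),
      ih fun q hq => h q (by simp [hq])]

/-- The Jacobi identity, expanding the second factor. -/
theorem Tabulated.of_right {b : ℕ → L} {t j g k : ℕ} {s : ℤ} (hk : b k = s • ⁅b j, b g⁆)
    (h1 : Tabulated b t j) (h2 : ∀ p ∈ table t j, Tabulated b p.1 g) (h3 : Tabulated b t g)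
    (h4 : ∀ p ∈ table t g, Tabulated b j p.1)
    (h : isZero (scale s (bracket (table t j) [(g, 1)] ++ act j (table t g)) ++
      scale (-1) (table t k)) = true) : Tabulated b t k := by
  have := ev_eq_zero b h
  rw [ev_append, ev_scale, ev_append, ev_scale, ← lie_ev h4, ← ev_lie_ev (by simpa using h2),
    ← h1, ← h3] at this
  have h5 : ev b [(g, 1)] = b g := by simp [ev]
  rw [h5, neg_one_smul, ← sub_eq_add_neg, sub_eq_zero] at this
  rw [Tabulated, hk, lie_smul, leibniz_lie, this]

/-- The Jacobi identity, expanding the first factor. -/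
theorem Tabulated.of_left {b : ℕ → L} {t j g k : ℕ} {s : ℤ} (ht : b t = s • ⁅b j, b g⁆)
    (h1 : Tabulated b j k) (h2 : ∀ p ∈ table j k, Tabulated b g p.1) (h3 : Tabulated b g k)
    (h4 : ∀ p ∈ table g k, Tabulated b j p.1)
    (h : isZero (scale s (act j (table g k) ++ scale (-1) (act g (table j k))) ++
      scale (-1) (table t k)) = true) : Tabulated b t k := by
  have := ev_eq_zero b h
  rw [ev_append, ev_scale, ev_append, ev_scale, ev_scale, ← lie_ev h4, ← lie_ev h2,
    ← h1, ← h3, neg_one_smul, neg_one_smul, ← sub_eq_add_neg, ← sub_eq_add_neg,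
    sub_eq_zero] at this
  rw [Tabulated, ht, smul_lie, lie_lie, this]

/-- Generators satisfying the Serre presentation of type `E₆`. -/
structure Chevalley (E F H : ℕ → L) : Prop where
  HH : ∀ i < 6, ∀ j < 6, ⁅H i, H j⁆ = 0
  HE : ∀ i < 6, ∀ j < 6, ⁅H i, E j⁆ = cartan i j • E j
  HF : ∀ i < 6, ∀ j < 6, ⁅H i, F j⁆ = -cartan i j • F j
  EF : ∀ i < 6, ∀ j < 6, ⁅E i, F j⁆ = if i = j then H i else 0
  serreE : Serre E
  serreF : Serre F

theorem Serre.neg {F : ℕ → L} (h : Serre F) : Serre (fun i => -F i) where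
  comm i hi j hj hij := by simp only [neg_lie, lie_neg, h.comm i hi j hj hij, neg_zero]
  cube i hi j hj hij := by simp only [neg_lie, lie_neg, h.cube i hi j hj hij, neg_zero]

/-- The Chevalley basis: positive root vectors, negative root vectors and simple coroots. -/
def vec (E F H : ℕ → L) (k : ℕ) : L :=
  if k < 36 then posVec E k else if k < 72 then posVec (fun i => -F i) (k - 36) else H (k - 72)

theorem vec_pos (E F H : ℕ → L) {k : ℕ} (h : k < 36) : vec E F H k = posVec E k := by
  rw [vec, if_pos h]

theorem vec_neg (E F H : ℕ → L) {k : ℕ} (h : k < 36) :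
    vec E F H (k + 36) = posVec (fun i => -F i) k := by
  rw [vec, if_neg (by omega), if_pos (by omega), Nat.add_sub_cancel]

theorem vec_coroot (E F H : ℕ → L) (i : ℕ) : vec E F H (i + 72) = H i := by
  rw [vec, if_neg (by omega), if_neg (by omega), Nat.add_sub_cancel]

namespace Chevalley

variable {E F H : ℕ → L}

theorem table_coroot : ∀ i < 6, ∀ k < 72,
    table (i + 72) k = if pairing i k = 0 then [] else [(k, pairing i k)] := by
  decide +kernel

theorem table_coroot' : ∀ i < 6, ∀ k < 72,
    table k (i + 72) = if pairing i k = 0 then [] else [(k, -pairing i k)] := by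
  decide +kernel

theorem pairing_rec : ∀ i < 6, ∀ d < 36, (d < 6 → pairing i d = cartan i d) ∧
    (6 ≤ d → parent d < d ∧ pairing i d = cartan i (parentStep d) + pairing i (parent d)) ∧
    pairing i (d + 36) = - pairing i d := by
  decide +kernel

theorem parentStep_lt : ∀ d < 36, parentStep d < 6 := by decide +kernel

theorem lie_posVec {X : ℕ → L} {c : ℤ} {i : ℕ} (hi : i < 6) {h : L}
    (hX : ∀ j < 6, ⁅h, X j⁆ = (c * cartan i j) • X j) (d : ℕ) (hd : d < 36) :
    ⁅h, posVec X d⁆ = (c * pairing i d) • posVec X d := by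
  induction d using Nat.strong_induction_on with
  | _ d ih =>
  rcases lt_or_ge d 6 with h6 | h6
  · rw [posVec_of_lt X h6, hX d h6, (pairing_rec i hi d hd).1 h6]
  · obtain ⟨h1, h2⟩ := (pairing_rec i hi d hd).2.1 h6
    rw [posVec.eq_def, if_neg (by omega), dif_pos ⟨h1, hd⟩, lie_smul, leibniz_lie,
      hX _ (parentStep_lt d hd), ih _ h1 (by omega), h2, mul_add, add_smul, smul_lie, lie_smul,
      smul_add, smul_comm, smul_comm (sign _ _) (c * pairing _ _)]

theorem table_coroot_coroot : ∀ i < 6, ∀ j < 6, table (i + 72) (j + 72) = [] := by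
  decide +kernel

theorem tabulated_coroot_left (hC : Chevalley E F H) : ∀ i < 6, ∀ k < 78,
    Tabulated (vec E F H) (i + 72) k := by
  intro i hi k hk
  rcases lt_or_ge k 72 with h | h
  · have : ⁅H i, vec E F H k⁆ = pairing i k • vec E F H k := by
      rcases lt_or_ge k 36 with h' | h'
      · rw [vec_pos E F H h', lie_posVec (c := 1) hi (by simpa using hC.HE i hi) k h', one_mul]
      · obtain ⟨d, rfl⟩ := Nat.exists_eq_add_of_le' h'
        rw [vec_neg E F H (by omega), lie_posVec (c := -1) hi _ d (by omega),
          (pairing_rec i hi d (by omega)).2.2, neg_one_mul]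
        intro j hj
        rw [lie_neg, hC.HF i hi j hj, smul_neg, neg_one_mul]
    rw [Tabulated, vec_coroot, this, table_coroot i hi k h]
    split_ifs with h0 <;> simp [ev, h0]
  · obtain ⟨j, rfl⟩ := Nat.exists_eq_add_of_le' h
    rw [Tabulated, vec_coroot, vec_coroot, hC.HH i hi j (by omega),
      table_coroot_coroot i hi j (by omega), ev]

theorem tabulated_coroot_right (hC : Chevalley E F H) (i : ℕ) (hi : i < 6) (k : ℕ) (hk : k < 78) :
    Tabulated (vec E F H) k (i + 72) := by
  have h1 := hC.tabulated_coroot_left i hi k hk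
  rw [Tabulated] at h1 ⊢
  rw [← lie_skew, h1]
  rcases lt_or_ge k 72 with h | h
  · rw [table_coroot i hi k h, table_coroot' i hi k h]
    split_ifs <;> simp [ev]
  · obtain ⟨j, rfl⟩ := Nat.exists_eq_add_of_le' h
    rw [table_coroot_coroot i hi j (by omega), table_coroot_coroot j (by omega) i hi, ev, neg_zero]

theorem table_up : ∀ i < 6, ∀ d < 36,
    table i d = (if up i d = 36 then [] else [(up i d, sign (code i) (code d))]) ∧
    table (i + 36) (d + 36) =
      (if up i d = 36 then [] else [(up i d + 36, sign (code i) (code d))]) ∧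
    up i d ≤ 36 := by
  decide +kernel

theorem tabulated_pos [IsAddTorsionFree L] (hC : Chevalley E F H) (i : ℕ) (hi : i < 6) (d : ℕ)
    (hd : d < 36) : Tabulated (vec E F H) i d := by
  obtain ⟨h1, -, h3⟩ := table_up i hi d hd
  have h := hC.serreE.raises d hd i hi
  rw [Raises] at h
  rw [Tabulated, vec_pos E F H hd, vec_pos E F H (by omega), posVec_of_lt E hi, h, h1]
  split_ifs with h0
  · simp [h0, posVec_eq_zero, ev]
  · simp [ev, vec_pos E F H (show up i d < 36 by omega)]

theorem tabulated_neg [IsAddTorsionFree L] (hC : Chevalley E F H) (i : ℕ) (hi : i < 6) (d : ℕ)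
    (hd : d < 36) : Tabulated (vec E F H) (i + 36) (d + 36) := by
  obtain ⟨-, h2, h3⟩ := table_up i hi d hd
  have h := hC.serreF.neg.raises d hd i hi
  rw [Raises] at h
  rw [Tabulated, vec_neg E F H hd, vec_neg E F H (by omega), posVec_of_lt _ hi, h, h2]
  split_ifs with h0
  · simp [h0, posVec_eq_zero, ev]
  · simp [ev, vec_neg E F H (show up i d < 36 by omega)]

/-- The step from the parent of a root, positive or negative. -/
def rootParent (k : ℕ) : ℕ × ℕ :=
  if k < 36 then (parentStep k, parent k) else (parentStep (k - 36) + 36, parent (k - 36) + 36)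

theorem rootParent_lt : ∀ k < 72, 6 ≤ k % 36 →
    (rootParent k).1 % 36 < 6 ∧ (rootParent k).2 % 36 < k % 36 ∧ (rootParent k).1 / 36 = k / 36 ∧
      (rootParent k).2 / 36 = k / 36 := by
  decide +kernel

theorem sign_neg : ∀ d < 36, 6 ≤ d →
    sign (code (parentStep d + 36)) (code (parent d + 36)) =
      sign (code (parentStep d)) (code (parent d)) := by
  decide +kernel

theorem vec_eq (k : ℕ) (hk : k < 72) (h6 : 6 ≤ k % 36) :
    vec E F H k = sign (code (rootParent k).1) (code (rootParent k).2) •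
      ⁅vec E F H (rootParent k).1, vec E F H (rootParent k).2⁆ := by
  rcases lt_or_ge k 36 with h | h
  · have h1 := rootParent_lt k hk h6
    rw [Nat.mod_eq_of_lt h] at h6 h1
    simp only [rootParent, if_pos h] at h1 ⊢
    rw [vec_pos E F H h, posVec.eq_def, if_neg (by omega), dif_pos (by omega),
      vec_pos E F H (by omega), vec_pos E F H (by omega), posVec_of_lt E (parentStep_lt k h)]
  · obtain ⟨d, rfl⟩ := Nat.exists_eq_add_of_le' h
    have h1 := rootParent_lt (d + 36) hk h6
    have hd : d < 36 := by omega
    have hp := parentStep_lt d hd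
    have hs := sign_neg d hd (by omega)
    simp only [rootParent, if_neg (show ¬ d + 36 < 36 by omega), Nat.add_sub_cancel] at h1 ⊢
    rw [vec_neg E F H hd, posVec.eq_def, if_neg (by omega), dif_pos (by omega),
      vec_neg E F H (by omega), vec_neg E F H (by omega), posVec_of_lt _ hp, hs]

theorem vec_simple {i : ℕ} (hi : i < 6) : vec E F H i = E i := by
  rw [vec_pos E F H (by omega), posVec_of_lt E hi]

theorem vec_neg_simple {i : ℕ} (hi : i < 6) : vec E F H (i + 36) = -F i := by
  rw [vec_neg E F H (by omega), posVec_of_lt _ hi]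

theorem table_simple : ∀ i < 6, ∀ j < 6,
    table i (j + 36) = (if i = j then [(i + 72, -1)] else []) ∧
    table (j + 36) i = (if i = j then [(i + 72, 1)] else []) := by
  decide +kernel

/-- The brackets of simple root vectors with root vectors of opposite sign follow by induction. -/
def Reducible (t k : ℕ) : Prop :=
  (∀ p ∈ table t (rootParent k).1, 72 ≤ p.1 ∧ p.1 < 78) ∧
  (∀ p ∈ table t (rootParent k).2, 72 ≤ p.1 ∧ p.1 < 78 ∨ p.1 < 72 ∧ p.1 / 36 = k / 36) ∧
  isZero (scale (sign (code (rootParent k).1) (code (rootParent k).2))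
    (bracket (table t (rootParent k).1) [((rootParent k).2, 1)] ++
      act (rootParent k).1 (table t (rootParent k).2)) ++ scale (-1) (table t k)) = true

instance (t k : ℕ) : Decidable (Reducible t k) := inferInstanceAs (Decidable (_ ∧ _))

theorem reducible : ∀ i < 6, ∀ d < 36, 6 ≤ d → Reducible i (d + 36) ∧ Reducible (i + 36) d := by
  decide +kernel

theorem tabulated_of_le (hC : Chevalley E F H) {j k : ℕ} (hj : j < 78) (hk : 72 ≤ k)
    (hk' : k < 78) : Tabulated (vec E F H) j k := by
  obtain ⟨k, rfl⟩ := Nat.exists_eq_add_of_le' hk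
  exact hC.tabulated_coroot_right k (by omega) j hj

theorem tabulated_of_le' (hC : Chevalley E F H) {j k : ℕ} (hj : j < 78) (hk : 72 ≤ k)
    (hk' : k < 78) : Tabulated (vec E F H) k j := by
  obtain ⟨k, rfl⟩ := Nat.exists_eq_add_of_le' hk
  exact hC.tabulated_coroot_left k (by omega) j hj

variable [IsAddTorsionFree L]

theorem tabulated_same_sign (hC : Chevalley E F H) {j k : ℕ} (hj : j < 72) (hk : k < 72)
    (hj' : j % 36 < 6) (h : j / 36 = k / 36) : Tabulated (vec E F H) j k := by
  rcases lt_or_ge j 36 with h1 | h1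
  · exact hC.tabulated_pos j (by omega) k (by omega)
  · obtain ⟨j, rfl⟩ := Nat.exists_eq_add_of_le' h1
    obtain ⟨k, rfl⟩ := Nat.exists_eq_add_of_le' (show 36 ≤ k by omega)
    exact hC.tabulated_neg j (by omega) k (by omega)

theorem tabulated_opposite (hC : Chevalley E F H) {t : ℕ} (ht : t < 72) (ht' : t % 36 < 6)
    (k : ℕ) (hk : k < 72) (h : t / 36 ≠ k / 36) : Tabulated (vec E F H) t k := by
  induction hd : k % 36 using Nat.strong_induction_on generalizing k with
  | _ d ih =>
  subst hd
  rcases lt_or_ge (k % 36) 6 with h6 | h6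
  · rcases lt_or_ge t 36 with h1 | h1
    · obtain ⟨k, rfl⟩ := Nat.exists_eq_add_of_le' (show 36 ≤ k by omega)
      have hk6 : k < 6 := by omega
      have ht6 : t < 6 := by omega
      rw [Tabulated, vec_neg_simple hk6, vec_simple ht6, lie_neg, hC.EF t ht6 k hk6,
        (table_simple t ht6 k hk6).1]
      split_ifs <;> simp [ev, vec_coroot]
    · obtain ⟨t, rfl⟩ := Nat.exists_eq_add_of_le' h1
      have hk6 : k < 6 := by omega
      have ht6 : t < 6 := by omega
      rw [Tabulated, vec_neg_simple ht6, vec_simple hk6, neg_lie, lie_skew, hC.EF k hk6 t ht6,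
        (table_simple k hk6 t ht6).2]
      split_ifs <;> simp [ev, vec_coroot]
  · have hr : Reducible t k := by
      rcases lt_or_ge t 36 with h1 | h1
      · obtain ⟨k, rfl⟩ := Nat.exists_eq_add_of_le' (show 36 ≤ k by omega)
        exact (reducible t (by omega) k (by omega) (by omega)).1
      · obtain ⟨t, rfl⟩ := Nat.exists_eq_add_of_le' h1
        exact (reducible t (by omega) k (by omega) (by omega)).2
    obtain ⟨h1, h2, h3⟩ := hr
    obtain ⟨p1, p2, p3, p4⟩ := rootParent_lt k hk h6
    refine Tabulated.of_right (vec_eq k hk h6) (ih _ (by omega) _ (by omega) (by omega) rfl)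
      (fun p hp => ?_) (ih _ p2 _ (by omega) (by omega) rfl) (fun p hp => ?_) h3
    · exact hC.tabulated_of_le' (by omega) (h1 p hp).1 (h1 p hp).2
    · rcases h2 p hp with ⟨h4, h5⟩ | ⟨h4, h5⟩
      · exact hC.tabulated_of_le (by omega) h4 h5
      · exact hC.tabulated_same_sign (by omega) h4 p1 (by omega)

theorem tabulated_generator (hC : Chevalley E F H) {t : ℕ} (ht : t < 72) (ht' : t % 36 < 6)
    (k : ℕ) (hk : k < 78) : Tabulated (vec E F H) t k := by
  rcases lt_or_ge k 72 with h | h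
  · by_cases h1 : t / 36 = k / 36
    · exact hC.tabulated_same_sign ht h ht' h1
    · exact hC.tabulated_opposite ht ht' k h h1
  · exact hC.tabulated_of_le (by omega) h hk

theorem table_lt : ∀ t < 78, ∀ k < 78, ∀ p ∈ table t k, p.1 < 78 := by
  decide +kernel

theorem table_rec : ∀ t < 72, 6 ≤ t % 36 → ∀ k < 78,
    isZero (scale (sign (code (rootParent t).1) (code (rootParent t).2))
      (act (rootParent t).1 (table (rootParent t).2 k) ++
        scale (-1) (act (rootParent t).2 (table (rootParent t).1 k))) ++
      scale (-1) (table t k)) = true := by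
  decide +kernel

/-- The multiplication table of the Chevalley basis. -/
theorem tabulated (hC : Chevalley E F H) (t : ℕ) (ht : t < 78) (k : ℕ) (hk : k < 78) :
    Tabulated (vec E F H) t k := by
  rcases lt_or_ge t 72 with h | h
  · induction hd : t % 36 using Nat.strong_induction_on generalizing t k with
    | _ d ih =>
    subst hd
    rcases lt_or_ge (t % 36) 6 with h6 | h6
    · exact hC.tabulated_generator h h6 k hk
    · obtain ⟨p1, p2, p3, p4⟩ := rootParent_lt t h h6
      have h1 : (rootParent t).1 < 72 := by omega
      have h2 : (rootParent t).2 < 72 := by omega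
      exact Tabulated.of_left (vec_eq t h h6) (hC.tabulated_generator h1 p1 k hk)
        (fun p hp => ih _ p2 _ (by omega) _ (table_lt _ (by omega) k hk p hp) h2 rfl)
        (ih _ p2 _ (by omega) _ hk h2 rfl)
        (fun p hp => hC.tabulated_generator h1 p1 _ (table_lt _ (by omega) k hk p hp))
        (table_rec t h h6 k hk)
  · exact hC.tabulated_of_le' hk h ht

end Chevalley

end Table

end E6

namespace E6

open CartanMatrix

/-! ### The Lie algebra of type `E₆` -/

/-- The projection from the free Lie algebra. -/
noncomputable def proj : FreeLieAlgebra ℂ (Generators (Fin 6)) →ₗ⁅ℂ⁆ LieAlgebra.e₆ ℂ where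
  toLinearMap := (LieSubmodule.Quotient.mk' (Relations.toIdeal ℂ E₆)).toLinearMap
  map_lie' := rfl

theorem proj_surjective : Function.Surjective proj :=
  LieSubmodule.Quotient.surjective_mk' (Relations.toIdeal ℂ E₆)

theorem proj_eq_zero {x : FreeLieAlgebra ℂ (Generators (Fin 6))} :
    proj x = 0 ↔ x ∈ Relations.toIdeal ℂ E₆ :=
  LieSubmodule.Quotient.mk_eq_zero (N := Relations.toIdeal ℂ E₆)

/-- A family of elements indexed by `Fin 6`, extended by zero. -/
def extend {L : Type*} [Zero L] (x : Fin 6 → L) (i : ℕ) : L := if h : i < 6 then x ⟨i, h⟩ else 0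

theorem extend_val {L : Type*} [Zero L] (x : Fin 6 → L) (i : Fin 6) : extend x i = x i := by
  rw [extend, dif_pos i.2]

/-- The positive simple root vectors. -/
noncomputable def genE : ℕ → LieAlgebra.e₆ ℂ :=
  extend fun i => proj (FreeLieAlgebra.of ℂ (Generators.E i))

/-- The negative simple root vectors. -/
noncomputable def genF : ℕ → LieAlgebra.e₆ ℂ :=
  extend fun i => proj (FreeLieAlgebra.of ℂ (Generators.F i))

/-- The simple coroots. -/
noncomputable def genH : ℕ → LieAlgebra.e₆ ℂ :=
  extend fun i => proj (FreeLieAlgebra.of ℂ (Generators.H i))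

theorem cartan_eq (i j : Fin 6) : E₆ i j = cartan i j := by
  fin_cases i <;> fin_cases j <;> rfl

theorem cartan_cases : ∀ i < 6, ∀ j < 6, i ≠ j → cartan i j = 0 ∨ cartan i j = -1 := by
  decide +kernel

theorem forall_lt_six {p : ℕ → Prop} (h : ∀ i : Fin 6, p i) : ∀ i < 6, p i :=
  fun i hi => h ⟨i, hi⟩

theorem chevalley_gen : Chevalley genE genF genH := by
  have hmem : ∀ x ∈ Relations.toSet ℂ E₆, proj x = 0 := fun x hx =>
    proj_eq_zero.mpr (LieSubmodule.subset_lieSpan hx)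
  refine ⟨?_, ?_, ?_, ?_, ⟨?_, ?_⟩, ⟨?_, ?_⟩⟩ <;>
    refine forall_lt_six fun i => forall_lt_six fun j => ?_
  · have := hmem (Relations.HH ℂ (i, j)) (by simp [Relations.toSet])
    simpa [genH, extend_val, Relations.HH] using this
  · have := hmem (Relations.HE ℂ E₆ (i, j)) (by simp [Relations.toSet])
    simpa [genH, genE, extend_val, Relations.HE, sub_eq_zero, cartan_eq] using this
  · have := hmem (Relations.HF ℂ E₆ (i, j)) (by simp [Relations.toSet])
    simpa [genH, genF, extend_val, Relations.HF, add_eq_zero_iff_eq_neg, cartan_eq] using this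
  · have := hmem (Relations.EF ℂ (i, j)) (by simp [Relations.toSet])
    by_cases hij : i = j
    · simpa [genH, genE, genF, extend_val, Relations.EF, hij, sub_eq_zero] using this
    · simpa [genH, genE, genF, extend_val, Relations.EF, hij, Fin.val_inj] using this
  · intro h
    have := hmem (Relations.adE ℂ E₆ (i, j)) (by simp [Relations.toSet])
    simpa [genE, extend_val, Relations.adE, cartan_eq, h] using this
  · intro h
    have := hmem (Relations.adE ℂ E₆ (i, j)) (by simp [Relations.toSet])
    simpa [genE, extend_val, Relations.adE, cartan_eq, h] using this
  · intro h
    have := hmem (Relations.adF ℂ E₆ (i, j)) (by simp [Relations.toSet])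
    simpa [genF, extend_val, Relations.adF, cartan_eq, h] using this
  · intro h
    have := hmem (Relations.adF ℂ E₆ (i, j)) (by simp [Relations.toSet])
    simpa [genF, extend_val, Relations.adF, cartan_eq, h] using this

theorem mem_of_gen_mem (K : LieSubalgebra ℂ (LieAlgebra.e₆ ℂ)) (hE : ∀ i < 6, genE i ∈ K)
    (hF : ∀ i < 6, genF i ∈ K) (hH : ∀ i < 6, genH i ∈ K) (x : LieAlgebra.e₆ ℂ) : x ∈ K := by
  obtain ⟨a, rfl⟩ := proj_surjective x
  let g : Generators (Fin 6) → K
    | .E i => ⟨genE i, hE i i.2⟩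
    | .F i => ⟨genF i, hF i i.2⟩
    | .H i => ⟨genH i, hH i i.2⟩
  have h : K.incl.comp (FreeLieAlgebra.lift ℂ g) = proj := by
    refine FreeLieAlgebra.hom_ext fun x => ?_
    rw [LieHom.comp_apply, FreeLieAlgebra.lift_of_apply]
    cases x with
    | E i => exact extend_val (fun i => proj (FreeLieAlgebra.of ℂ (Generators.E i))) i
    | F i => exact extend_val (fun i => proj (FreeLieAlgebra.of ℂ (Generators.F i))) i
    | H i => exact extend_val (fun i => proj (FreeLieAlgebra.of ℂ (Generators.H i))) i
  rw [← h, LieHom.comp_apply]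
  exact Subtype.prop _

theorem exists_hom {L : Type*} [LieRing L] [LieAlgebra ℂ L] {E F H : ℕ → L}
    (hC : Chevalley E F H) : ∃ φ : LieAlgebra.e₆ ℂ →ₗ⁅ℂ⁆ L, (∀ i < 6, φ (genE i) = E i) ∧
      (∀ i < 6, φ (genF i) = F i) ∧ ∀ i < 6, φ (genH i) = H i := by
  let g : Generators (Fin 6) → L
    | .E i => E i
    | .F i => F i
    | .H i => H i
  let ψ := FreeLieAlgebra.lift ℂ g
  have hψ : ∀ x, ψ (FreeLieAlgebra.of ℂ x) = g x := fun x => FreeLieAlgebra.lift_of_apply _ _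
  have hle : Relations.toIdeal ℂ E₆ ≤ ψ.ker := by
    refine LieSubmodule.lieSpan_le.mpr ?_
    rintro x (((((⟨⟨i, j⟩, rfl⟩ | ⟨⟨i, j⟩, rfl⟩) | ⟨⟨i, j⟩, rfl⟩) | ⟨⟨i, j⟩, rfl⟩) |
      ⟨⟨i, j⟩, rfl⟩) | ⟨⟨i, j⟩, rfl⟩) <;>
      refine LieHom.mem_ker.mpr ?_
    · simpa [Relations.HH, hψ, g] using hC.HH i i.2 j j.2
    · have := hC.EF i i.2 j j.2
      by_cases hij : i = j
      · simpa [Relations.EF, hψ, g, hij, sub_eq_zero] using this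
      · simpa [Relations.EF, hψ, g, hij, Fin.val_inj] using this
    · simpa [Relations.HE, hψ, g, sub_eq_zero, cartan_eq] using hC.HE i i.2 j j.2
    · simpa [Relations.HF, hψ, g, add_eq_zero_iff_eq_neg, cartan_eq] using hC.HF i i.2 j j.2
    · rcases eq_or_ne i j with rfl | hij
      · simp [Relations.adE]
      · rcases cartan_cases i i.2 j j.2 (by simpa [Fin.val_inj] using hij) with h | h
        · simpa [Relations.adE, hψ, g, cartan_eq, h] using hC.serreE.comm i i.2 j j.2 h
        · simpa [Relations.adE, hψ, g, cartan_eq, h] using hC.serreE.cube i i.2 j j.2 h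
    · rcases eq_or_ne i j with rfl | hij
      · simp [Relations.adF]
      · rcases cartan_cases i i.2 j j.2 (by simpa [Fin.val_inj] using hij) with h | h
        · simpa [Relations.adF, hψ, g, cartan_eq, h] using hC.serreF.comm i i.2 j j.2 h
        · simpa [Relations.adF, hψ, g, cartan_eq, h] using hC.serreF.cube i i.2 j j.2 h
  let φ : LieAlgebra.e₆ ℂ →ₗ[ℂ] L :=
    Submodule.liftQ (Relations.toIdeal ℂ E₆).toSubmodule ψ.toLinearMap (fun x hx => hle hx)
  have hφ : ∀ x, φ (proj x) = ψ x := fun x => rfl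
  refine ⟨{ φ with map_lie' := ?_ }, forall_lt_six fun i => ?_, forall_lt_six fun i => ?_,
    forall_lt_six fun i => ?_⟩
  · intro x y
    obtain ⟨x, rfl⟩ := proj_surjective x
    obtain ⟨y, rfl⟩ := proj_surjective y
    change φ ⁅proj x, proj y⁆ = ⁅φ (proj x), φ (proj y)⁆
    rw [← LieHom.map_lie, hφ, hφ, hφ, LieHom.map_lie]
  · change φ (genE i) = _
    rw [genE, extend_val, hφ, hψ]
  · change φ (genF i) = _
    rw [genF, extend_val, hφ, hψ]
  · change φ (genH i) = _
    rw [genH, extend_val, hφ, hψ]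

/-- The Chevalley basis of the Lie algebra of type `E₆`. -/
noncomputable def rootVec : ℕ → LieAlgebra.e₆ ℂ := vec genE genF genH

instance : IsAddTorsionFree (LieAlgebra.e₆ ℂ) := .of_isTorsionFree ℂ _

theorem lie_rootVec {t k : ℕ} (ht : t < 78) (hk : k < 78) :
    ⁅rootVec t, rootVec k⁆ = ev rootVec (table t k) :=
  chevalley_gen.tabulated t ht k hk

end E6

/-! ### The minuscule representation -/

namespace E6

/-- The codes of the weights of the minuscule representation; a weight is encoded by the
hexadecimal digits of the threefold of its coefficients, each shifted by `8`. -/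
def weightCodes : ℕ :=
  306331132993979451912227639398585529084314693531018094352607246496777980230324039380931804201588795739413316146741826807595086583171686680577232611424934440566647476327851655673560436944524864956

/-- The code of the `m`-th weight. -/
def weightCode (m : ℕ) : ℕ := (weightCodes >>> (24 * m)) % 16777216

/-- A hash table, with respect to the residue modulo `79`, of the numbers of the weights. -/
def weightTable : ℕ :=
  25494623661635411426017911104176321613174306441921785515010949576261172677838113110681969094455514316089841345824872527441205855784389014226109945867922322277537940751055410675486556166

/-- The number of the weight with the given code. -/
def weightIndex (c : ℕ) : ℕ := (weightTable >>> (8 * (c % 79))) % 256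

/-- Three times the coefficient of the `m`-th weight at the `j`-th simple root. -/
def weightCoeff (m j : ℕ) : ℤ := ((weightCode m >>> (4 * j)) % 16 : ℕ) - 8

/-- The pairing of the `m`-th weight with the `i`-th simple coroot. -/
def weightPairing (i m : ℕ) : ℤ :=
  (cartan i 0 * weightCoeff m 0 + cartan i 1 * weightCoeff m 1 + cartan i 2 * weightCoeff m 2 +
    cartan i 3 * weightCoeff m 3 + cartan i 4 * weightCoeff m 4 + cartan i 5 * weightCoeff m 5) / 3

/-- The image of the `m`-th weight vector under a generator: the numbers `0, …, 5` stand for the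
positive generators, `6, …, 11` for the negative ones and `12, …, 17` for the coroots. -/
def weightMove (s m : ℕ) : List (ℕ × ℤ) :=
  bif m.blt 27 then
    bif s.blt 6 then
      bif weightPairing s m == -1 then [(weightIndex (weightCode m + 3 <<< (4 * s)), 1)] else []
    else bif s.blt 12 then
      bif weightPairing (s - 6) m == 1 then
        [(weightIndex (weightCode m - 3 <<< (4 * (s - 6))), 1)] else []
    else [(m, weightPairing (s - 12) m)]
  else []

/-- The action of a generator on a formal combination of weight vectors. -/
def weightAct (s : ℕ) : List (ℕ × ℤ) → List (ℕ × ℤ)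
  | [] => []
  | p :: l => scale p.2 (weightMove s p.1) ++ weightAct s l

/-- The weight vectors. -/
def weightVec (m : ℕ) : Fin 27 → ℂ := if h : m < 27 then Pi.single ⟨m, h⟩ 1 else 0

theorem weightVec_val (m : Fin 27) : weightVec m = Pi.single m 1 := dif_pos m.2

/-- The action of the generators on the minuscule representation. -/
noncomputable def weightOp (s : ℕ) : Module.End ℂ (Fin 27 → ℂ) :=
  (Pi.basisFun ℂ (Fin 27)).constr ℂ fun m => ev weightVec (weightMove s m)

theorem weightOp_apply (s m : ℕ) : weightOp s (weightVec m) = ev weightVec (weightMove s m) := by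
  by_cases h : m < 27
  · rw [show weightVec m = Pi.basisFun ℂ (Fin 27) ⟨m, h⟩ by
      rw [Pi.basisFun_apply]; exact weightVec_val ⟨m, h⟩, weightOp, Module.Basis.constr_basis]
  · rw [weightVec, dif_neg h, map_zero, weightMove,
      show m.blt 27 = false from Bool.eq_false_iff.mpr (by rwa [Ne, Nat.blt_eq]), cond_false, ev]

theorem weightOp_ev (s : ℕ) (l : List (ℕ × ℤ)) :
    weightOp s (ev weightVec l) = ev weightVec (weightAct s l) := by
  induction l with
  | nil => simp [ev, weightAct]
  | cons p l ih => rw [ev, map_add, ih, map_zsmul, weightOp_apply, weightAct, ev_append, ev_scale]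

theorem weight_ext {f g : Module.End ℂ (Fin 27 → ℂ)}
    (h : ∀ m < 27, f (weightVec m) = g (weightVec m)) : f = g := by
  refine (Pi.basisFun ℂ (Fin 27)).ext fun m => ?_
  rw [Pi.basisFun_apply, ← weightVec_val]
  exact h m m.2

theorem ev_eq_of_isZero {M : Type*} [AddCommGroup M] (b : ℕ → M) {l l' : List (ℕ × ℤ)}
    (h : isZero (l ++ scale (-1) l') = true) : ev b l = ev b l' := by
  have := ev_eq_zero b h
  rwa [ev_append, ev_scale, neg_one_smul, add_neg_eq_zero] at this

section

attribute [local instance] LieRing.ofAssociativeRing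

/-- The commutator of two generators on a weight vector. -/
def weightComm (s t m : ℕ) : List (ℕ × ℤ) :=
  weightAct s (weightMove t m) ++ scale (-1) (weightAct t (weightMove s m))

theorem weightOp_lie (s t m : ℕ) :
    ⁅weightOp s, weightOp t⁆ (weightVec m) = ev weightVec (weightComm s t m) := by
  change weightOp s (weightOp t _) - weightOp t (weightOp s _) = _
  rw [weightOp_apply, weightOp_apply, weightOp_ev, weightOp_ev,
    weightComm, ev_append, ev_scale, neg_one_smul, sub_eq_add_neg]

theorem weight_relations : ∀ i < 6, ∀ j < 6, ∀ m < 27,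
    isZero (weightComm (i + 12) (j + 12) m) = true ∧
    isZero (weightComm (i + 12) j m ++ scale (-1) (scale (cartan i j) (weightMove j m))) = true ∧
    isZero (weightComm (i + 12) (j + 6) m ++
      scale (-1) (scale (-cartan i j) (weightMove (j + 6) m))) = true ∧
    isZero (weightComm i (j + 6) m ++
      scale (-1) (if i = j then weightMove (i + 12) m else [])) = true := by
  decide +kernel

theorem weight_serre : ∀ i < 6, ∀ j < 6, ∀ s ∈ [0, 6], ∀ m < 27,
    (cartan i j = 0 → isZero (weightComm (i + s) (j + s) m) = true) ∧
    (cartan i j = -1 → isZero (weightAct (i + s) (weightComm (i + s) (j + s) m) ++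
      scale (-1) (weightAct (i + s) (weightAct (j + s) (weightMove (i + s) m)) ++
        scale (-1) (weightAct (j + s) (weightAct (i + s) (weightMove (i + s) m))))) = true) := by
  decide +kernel

theorem weight_serre' (s : ℕ) (hs : s ∈ [0, 6]) : Serre fun i => weightOp (i + s) := by
  refine ⟨fun i hi j hj h => weight_ext fun m hm => ?_, fun i hi j hj h =>
    weight_ext fun m hm => ?_⟩
  · rw [weightOp_lie, ev_eq_zero _ ((weight_serre i hi j hj s hs m hm).1 h)]
    rfl
  · have h1 := ev_eq_of_isZero weightVec ((weight_serre i hi j hj s hs m hm).2 h)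
    rw [ev_append, ev_scale, neg_one_smul, ← sub_eq_add_neg, ← weightOp_ev, ← weightOp_ev,
      ← weightOp_ev, ← weightOp_ev, ← weightOp_ev, ← weightOp_apply, ← weightOp_lie] at h1
    change weightOp (i + s) (⁅weightOp (i + s), weightOp (j + s)⁆ _) -
      (weightOp (i + s) (weightOp (j + s) (weightOp (i + s) _)) -
        weightOp (j + s) (weightOp (i + s) (weightOp (i + s) _))) = 0
    rw [h1, sub_self]

theorem chevalley_weight :
    Chevalley weightOp (fun i => weightOp (i + 6)) (fun i => weightOp (i + 12)) := by
  refine ⟨fun i hi j hj => weight_ext fun m hm => ?_, fun i hi j hj => weight_ext fun m hm => ?_,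
    fun i hi j hj => weight_ext fun m hm => ?_, fun i hi j hj => weight_ext fun m hm => ?_,
    weight_serre' 0 (by simp), weight_serre' 6 (by simp)⟩ <;>
    obtain ⟨h1, h2, h3, h4⟩ := weight_relations i hi j hj m hm
  · rw [weightOp_lie, ev_eq_zero _ h1]
    rfl
  · rw [weightOp_lie, ev_eq_of_isZero _ h2, ev_scale, ← weightOp_apply]
    rfl
  · rw [weightOp_lie, ev_eq_of_isZero _ h3, ev_scale, ← weightOp_apply]
    rfl
  · rw [weightOp_lie, ev_eq_of_isZero _ h4]
    split_ifs
    · rw [← weightOp_apply]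
    · rfl

theorem exists_rep : ∃ φ : LieAlgebra.e₆ ℂ →ₗ⁅ℂ⁆ Module.End ℂ (Fin 27 → ℂ), ∀ i < 6, ∀ m < 27,
    φ (genH i) (weightVec m) = (weightPairing i m : ℂ) • weightVec m := by
  obtain ⟨φ, -, -, h⟩ := exists_hom chevalley_weight
  refine ⟨φ, fun i hi m hm => ?_⟩
  have h1 : (i + 12).blt 6 = false := Bool.eq_false_iff.mpr (by rw [Ne, Nat.blt_eq]; omega)
  have h2 : (i + 12).blt 12 = false := Bool.eq_false_iff.mpr (by rw [Ne, Nat.blt_eq]; omega)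
  rw [h i hi, weightOp_apply, weightMove, Nat.blt_eq.mpr hm, h1, h2]
  simp only [cond_true, cond_false, ev, add_zero, Nat.add_sub_cancel, Int.cast_smul_eq_zsmul]

end

end E6

/-! ### The Chevalley basis -/

namespace E6

theorem ev_mem {M : Type*} [AddCommGroup M] [Module ℂ M] (p : Submodule ℂ M) {b : ℕ → M}
    {l : List (ℕ × ℤ)} (h : ∀ q ∈ l, b q.1 ∈ p) : ev b l ∈ p := by
  induction l with
  | nil => exact p.zero_mem
  | cons q l ih =>
    rw [ev]
    exact p.add_mem (zsmul_mem (h q (by simp)) _) (ih fun q hq => h q (by simp [hq]))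

theorem rootVec_simple {i : ℕ} (hi : i < 6) : rootVec i = genE i := Chevalley.vec_simple hi

theorem rootVec_neg_simple {i : ℕ} (hi : i < 6) : rootVec (i + 36) = -genF i :=
  Chevalley.vec_neg_simple hi

theorem rootVec_coroot (i : ℕ) : rootVec (i + 72) = genH i := vec_coroot _ _ _ i

theorem span_rootVec :
    Submodule.span ℂ (Set.range fun k : Fin 78 => rootVec k) = ⊤ := by
  set p := Submodule.span ℂ (Set.range fun k : Fin 78 => rootVec k)
  have hp : ∀ k < 78, rootVec k ∈ p := fun k hk => Submodule.subset_span ⟨⟨k, hk⟩, rfl⟩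
  refine (Submodule.eq_top_iff'.mpr fun x => ?_)
  refine mem_of_gen_mem { p with lie_mem' := ?_ } (fun i hi => ?_) (fun i hi => ?_)
    (fun i hi => ?_) x
  · intro x y hx hy
    refine Submodule.span_induction₂ (p := fun x y _ _ => ⁅x, y⁆ ∈ p) ?_ ?_ ?_ ?_ ?_ ?_ ?_ hx hy
    · rintro _ _ ⟨j, rfl⟩ ⟨k, rfl⟩
      rw [lie_rootVec j.2 k.2]
      exact ev_mem p fun q hq => hp _ (Chevalley.table_lt j j.2 k k.2 q hq)
    · simp
    · simp
    · intro x y z _ _ _ h1 h2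
      rw [add_lie]
      exact p.add_mem h1 h2
    · intro x y z _ _ _ h1 h2
      rw [lie_add]
      exact p.add_mem h1 h2
    · intro c x y _ _ h
      rw [smul_lie]
      exact p.smul_mem c h
    · intro c x y _ _ h
      rw [lie_smul]
      exact p.smul_mem c h
  · rw [← rootVec_simple hi]
    exact hp _ (by omega)
  · rw [← neg_neg (genF i), ← rootVec_neg_simple hi]
    exact p.neg_mem (hp _ (by omega))
  · rw [← rootVec_coroot]
    exact hp _ (by omega)

theorem pairing_eq_zero : ∀ i < 6, ∀ k < 78, 72 ≤ k → pairing i k = 0 := by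
  decide +kernel

theorem lie_genH {i k : ℕ} (hi : i < 6) (hk : k < 78) :
    ⁅genH i, rootVec k⁆ = (pairing i k : ℂ) • rootVec k := by
  rw [← rootVec_coroot, lie_rootVec (by omega) hk, Int.cast_smul_eq_zsmul]
  rcases lt_or_ge k 72 with h | h
  · rw [Chevalley.table_coroot i hi k h]
    split_ifs with h0 <;> simp [ev, h0]
  · obtain ⟨k, rfl⟩ := Nat.exists_eq_add_of_le' h
    rw [Chevalley.table_coroot_coroot i hi k (by omega), ev, pairing_eq_zero i hi _ hk h, zero_smul]

/-- The element of the Cartan subalgebra with the given coordinates. -/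
noncomputable def toral (a : ℕ → ℂ) : LieAlgebra.e₆ ℂ :=
  a 0 • genH 0 + a 1 • genH 1 + a 2 • genH 2 + a 3 • genH 3 + a 4 • genH 4 + a 5 • genH 5

/-- The value of the `j`-th simple root. -/
def label (a : ℕ → ℂ) (j : ℕ) : ℂ :=
  cartan 0 j * a 0 + cartan 1 j * a 1 + cartan 2 j * a 2 + cartan 3 j * a 3 + cartan 4 j * a 4 +
    cartan 5 j * a 5

/-- The value of the `k`-th root in terms of those of the simple roots. -/
def degree {R : Type*} [CommRing R] (n : ℕ → R) (k : ℕ) : R :=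
  coeff k 0 * n 0 + coeff k 1 * n 1 + coeff k 2 * n 2 + coeff k 3 * n 3 + coeff k 4 * n 4 +
    coeff k 5 * n 5

theorem lie_toral (a : ℕ → ℂ) {k : ℕ} (hk : k < 78) :
    ⁅toral a, rootVec k⁆ = degree (label a) k • rootVec k := by
  have hsymm : ∀ i < 6, ∀ j < 6, cartan i j = cartan j i := by decide +kernel
  simp only [toral, add_lie, smul_lie, lie_genH (show 0 < 6 by norm_num) hk,
    lie_genH (show 1 < 6 by norm_num) hk, lie_genH (show 2 < 6 by norm_num) hk,
    lie_genH (show 3 < 6 by norm_num) hk, lie_genH (show 4 < 6 by norm_num) hk,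
    lie_genH (show 5 < 6 by norm_num) hk, smul_smul, ← add_smul]
  congr 1
  simp only [degree, label, pairing]
  push_cast
  ring


theorem label_formula (a : ℕ → ℂ) :
    label a 0 = 2 * a 0 - a 2 ∧ label a 1 = 2 * a 1 - a 3 ∧ label a 2 = 2 * a 2 - a 0 - a 3 ∧
    label a 3 = 2 * a 3 - a 1 - a 2 - a 4 ∧ label a 4 = 2 * a 4 - a 3 - a 5 ∧
    label a 5 = 2 * a 5 - a 4 := by
  refine ⟨?_, ?_, ?_, ?_, ?_, ?_⟩ <;> simp [label, cartan, Nat.beq] <;> ring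

theorem eq_zero_of_label {a : ℕ → ℂ} (h : ∀ j < 6, label a j = 0) : ∀ i < 6, a i = 0 := by
  obtain ⟨e0, e1, e2, e3, e4, e5⟩ := label_formula a
  rw [h _ (by norm_num)] at e0 e1 e2 e3 e4 e5
  intro i hi
  interval_cases i
  · linear_combination (-4 * e0 - 3 * e1 - 5 * e2 - 6 * e3 - 4 * e4 - 2 * e5) / 3
  · linear_combination (-3 * e0 - 6 * e1 - 6 * e2 - 9 * e3 - 6 * e4 - 3 * e5) / 3
  · linear_combination (-5 * e0 - 6 * e1 - 10 * e2 - 12 * e3 - 8 * e4 - 4 * e5) / 3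
  · linear_combination (-6 * e0 - 9 * e1 - 12 * e2 - 18 * e3 - 12 * e4 - 6 * e5) / 3
  · linear_combination (-4 * e0 - 6 * e1 - 8 * e2 - 12 * e3 - 10 * e4 - 5 * e5) / 3
  · linear_combination (-2 * e0 - 3 * e1 - 4 * e2 - 6 * e3 - 5 * e4 - 4 * e5) / 3

theorem genH_ne_zero {i : ℕ} (hi : i < 6) : genH i ≠ 0 := by
  obtain ⟨φ, hφ⟩ := exists_rep
  have h : ∀ i < 6, ∃ m < 27, weightPairing i m = 1 := by decide +kernel
  obtain ⟨m, hm, h⟩ := h i hi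
  intro h0
  have := hφ i hi m hm
  rw [h0, map_zero, h, Int.cast_one, one_smul, LinearMap.zero_apply] at this
  have h1 := congrFun this ⟨m, hm⟩
  rw [show weightVec m = _ from weightVec_val ⟨m, hm⟩] at h1
  simp at h1

theorem genE_ne_zero {i : ℕ} (hi : i < 6) : genE i ≠ 0 := by
  intro h
  have := chevalley_gen.EF i hi i hi
  rw [h, zero_lie, if_pos rfl] at this
  exact genH_ne_zero hi this.symm

theorem table_opposite : ∀ k < 72, ∃ l < 6, ∃ c ∈ [1, -1, 2, -2],
    isZero (bracket (table ((k + 36) % 72) k) [(l, 1)] ++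
      [(l, c)]) = true ∧ ∀ q ∈ table ((k + 36) % 72) k, q.1 < 78 := by
  decide +kernel

theorem rootVec_ne_zero {k : ℕ} (hk : k < 72) : rootVec k ≠ 0 := by
  obtain ⟨l, hl, c, hc, h, h'⟩ := table_opposite k hk
  have hk' : ((k + 36) % 72) < 78 := by omega
  intro h0
  have h1 := lie_rootVec hk' (show k < 78 by omega)
  rw [h0, lie_zero] at h1
  have h2 := ev_eq_zero rootVec h
  rw [ev_append, ← ev_lie_ev, ← h1, zero_lie, zero_add, ev, ev, add_zero,
    ← Int.cast_smul_eq_zsmul ℂ, rootVec_simple hl] at h2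
  · refine genE_ne_zero hl ((smul_eq_zero.mp h2).resolve_left ?_)
    rintro h
    rw [show c = 0 from Int.cast_eq_zero.mp h] at hc
    simp at hc
  · intro p hp q hq
    simp only [List.mem_singleton] at hq
    exact lie_rootVec (h' p hp) (by rw [hq]; exact Nat.lt_of_lt_of_le hl (by norm_num))

theorem exists_label (n : ℕ → ℂ) : ∃ a, ∀ j < 6, label a j = n j := by
  refine ⟨fun i => if i = 0 then (4 * n 0 + 3 * n 1 + 5 * n 2 + 6 * n 3 + 4 * n 4 + 2 * n 5) / 3
    else if i = 1 then (3 * n 0 + 6 * n 1 + 6 * n 2 + 9 * n 3 + 6 * n 4 + 3 * n 5) / 3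
    else if i = 2 then (5 * n 0 + 6 * n 1 + 10 * n 2 + 12 * n 3 + 8 * n 4 + 4 * n 5) / 3
    else if i = 3 then (6 * n 0 + 9 * n 1 + 12 * n 2 + 18 * n 3 + 12 * n 4 + 6 * n 5) / 3
    else if i = 4 then (4 * n 0 + 6 * n 1 + 8 * n 2 + 12 * n 3 + 10 * n 4 + 5 * n 5) / 3
    else (2 * n 0 + 3 * n 1 + 4 * n 2 + 6 * n 3 + 5 * n 4 + 4 * n 5) / 3, fun j hj => ?_⟩
  generalize hb : (fun i => ite (i = 0) _ _ : ℕ → ℂ) = b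
  obtain ⟨e0, e1, e2, e3, e4, e5⟩ := label_formula b
  subst hb
  interval_cases j
  · rw [e0]; norm_num; ring
  · rw [e1]; norm_num; ring
  · rw [e2]; norm_num; ring
  · rw [e3]; norm_num; ring
  · rw [e4]; norm_num; ring
  · rw [e5]; norm_num; ring

theorem degree_congr {n n' : ℕ → ℂ} (h : ∀ j < 6, n j = n' j) (k : ℕ) :
    degree n k = degree n' k := by
  simp only [degree, h 0 (by norm_num), h 1 (by norm_num), h 2 (by norm_num), h 3 (by norm_num),
    h 4 (by norm_num), h 5 (by norm_num)]

theorem degree_intCast (n : ℕ → ℤ) (k : ℕ) :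
    degree (fun j => (n j : ℂ)) k = (degree n k : ℤ) := by
  simp [degree]

theorem degree_of_ge {R : Type*} [CommRing R] (n : ℕ → R) {k : ℕ} (hk : 72 ≤ k) (hk' : k < 78) :
    degree n k = 0 := by
  have h : ∀ k < 78, 72 ≤ k → ∀ j < 6, coeff k j = 0 := by decide +kernel
  simp [degree, h k hk' hk]

theorem degree_simple {R : Type*} [CommRing R] (n : ℕ → R) {k : ℕ} (hk : k < 6) :
    degree n k = n k := by
  have h : ∀ k < 6, ∀ j < 6, coeff k j = if k = j then 1 else 0 := by decide +kernel
  simp only [degree, h k hk _ (show 0 < 6 by norm_num), h k hk _ (show 1 < 6 by norm_num),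
    h k hk _ (show 2 < 6 by norm_num), h k hk _ (show 3 < 6 by norm_num),
    h k hk _ (show 4 < 6 by norm_num), h k hk _ (show 5 < 6 by norm_num)]
  interval_cases k <;> simp

theorem degree_injective : ∀ k < 72, degree (fun j => (16 : ℤ) ^ j) k ≠ 0 ∧
    ∀ k' < 72, degree (fun j => (16 : ℤ) ^ j) k = degree (fun j => 16 ^ j) k' → k = k' := by
  decide +kernel

theorem exists_generic : ∃ a : ℕ → ℂ, ∃ d : ℕ → ℤ, (∀ k < 78, degree (label a) k = d k) ∧
    (∀ k < 72, d k ≠ 0) ∧ (∀ k < 72, ∀ k' < 72, d k = d k' → k = k') ∧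
    ∀ k < 78, 72 ≤ k → d k = 0 := by
  obtain ⟨a, ha⟩ := exists_label fun j => ((16 ^ j : ℤ) : ℂ)
  refine ⟨a, degree (fun j => (16 : ℤ) ^ j), fun k hk => ?_, fun k hk => (degree_injective k hk).1,
    fun k hk => (degree_injective k hk).2, fun k hk hk' => degree_of_ge _ hk' hk⟩
  rw [degree_congr ha, degree_intCast]

theorem linearIndependent_genH : LinearIndependent ℂ fun i : Fin 6 => genH i := by
  rw [Fintype.linearIndependent_iff]
  intro g hg
  have h : toral (extend g) = 0 := by
    rw [← hg, Fin.sum_univ_six]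
    rfl
  have h1 : ∀ j < 6, label (extend g) j = 0 := by
    intro j hj
    have := lie_toral (extend g) (show j < 78 by omega)
    rw [h, zero_lie, degree_simple _ hj] at this
    exact (smul_eq_zero.mp this.symm).resolve_right (rootVec_ne_zero (by omega))
  intro i
  rw [← extend_val g i]
  exact eq_zero_of_label h1 i i.2

theorem linearIndependent_rootVec : LinearIndependent ℂ fun k : Fin 78 => rootVec k := by
  obtain ⟨a, d, hd, hd0, hinj, hd1⟩ := exists_generic
  let f := LieModule.toEnd ℂ (LieAlgebra.e₆ ℂ) (LieAlgebra.e₆ ℂ) (toral a)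
  have hf : ∀ k < 78, rootVec k ∈ f.eigenspace (d k : ℂ) := fun k hk =>
    Module.End.mem_eigenspace_iff.mpr ((lie_toral a hk).trans (by rw [hd k hk]))
  have h1 : LinearIndependent ℂ fun k : Fin 72 => rootVec k := by
    refine Module.End.eigenvectors_linearIndependent' f (fun k : Fin 72 => (d k : ℂ))
      (fun k k' h => Fin.ext (hinj k k.2 k' k'.2 (Int.cast_injective h))) _ fun k =>
      ⟨hf k (by omega), rootVec_ne_zero k.2⟩
  have h2 : Disjoint (Submodule.span ℂ (Set.range fun k : Fin 72 => rootVec k))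
      (Submodule.span ℂ (Set.range fun i : Fin 6 => genH i)) := by
    refine (Module.End.eigenspaces_iSupIndep f (0 : ℂ)).symm.mono ?_ ?_
    · rw [Submodule.span_le]
      rintro _ ⟨k, rfl⟩
      exact Submodule.mem_iSup_of_mem (d k : ℂ) (Submodule.mem_iSup_of_mem
        (Int.cast_ne_zero.mpr (hd0 k k.2)) (hf k (by omega)))
    · rw [Submodule.span_le]
      rintro _ ⟨i, rfl⟩
      have := hf (i + 72) (by omega)
      rwa [hd1 _ (by omega) (by omega), rootVec_coroot, Int.cast_zero] at this
  have h3 := (h1.sum_type linearIndependent_genH h2).comp _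
    (finSumFinEquiv (m := 72) (n := 6)).symm.injective
  have h4 : (fun k : Fin 78 => rootVec k) = Sum.elim (fun k : Fin 72 => rootVec k)
      (fun i : Fin 6 => genH i) ∘ (finSumFinEquiv (m := 72) (n := 6)).symm := by
    ext k
    obtain ⟨k | k, rfl⟩ := (finSumFinEquiv (m := 72) (n := 6)).surjective k
    · rw [Function.comp_apply, Equiv.symm_apply_apply, finSumFinEquiv_apply_left]
      rfl
    · rw [Function.comp_apply, Equiv.symm_apply_apply, finSumFinEquiv_apply_right, Sum.elim_inr,
        ← rootVec_coroot, add_comm]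
      rfl
  rw [h4]
  exact h3

/-- The Chevalley basis. -/
noncomputable def chevalleyBasis : Module.Basis (Fin 78) ℂ (LieAlgebra.e₆ ℂ) :=
  Module.Basis.mk linearIndependent_rootVec span_rootVec.ge

theorem chevalleyBasis_apply (k : Fin 78) : chevalleyBasis k = rootVec k :=
  Module.Basis.mk_apply _ _ k

instance : FiniteDimensional ℂ (LieAlgebra.e₆ ℂ) := chevalleyBasis.finiteDimensional_of_finite

end E6

/-! ### Counting weights of a representation -/

namespace Sl2

open Finset Module

theorem card_filter_val (N : ℕ) (p : ℕ → Prop) [DecidablePred p] :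
    #{i : Fin N | p i} = Nat.count p N := by
  rw [Nat.count_eq_card_filter_range, ← Nat.Iio_eq_range, ← Fin.map_valEmbedding_univ, filter_map,
    card_map]
  rfl

variable {M : Type*} [AddCommGroup M] [Module ℂ M]
  {H E F : Module.End ℂ M} (hE : H * E - E * H = (2 : ℂ) • E)
  (hF : H * F - F * H = (-2 : ℂ) • F) (hEF : E * F - F * E = H)
  {N : ℕ} {D : ℕ → ℤ}

theorem repr_apply_eq_sum (b : Basis (Fin N) ℂ M) (A : Module.End ℂ M) (x : M) (i : Fin N) :
    b.repr (A x) i = ∑ j, b.repr x j * b.repr (A (b j)) i := by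
  conv_lhs => rw [← b.sum_repr x]
  rw [map_sum, map_sum, Finsupp.finsetSum_apply]
  exact sum_congr rfl fun j _ => by rw [map_smul, map_smul, Finsupp.smul_apply, smul_eq_mul]

theorem repr_apply_of_diagonal (b : Basis (Fin N) ℂ M) {A : Module.End ℂ M} {μ : Fin N → ℂ}
    (hA : ∀ j, A (b j) = μ j • b j) (x : M) (i : Fin N) : b.repr (A x) i = μ i * b.repr x i := by
  rw [repr_apply_eq_sum, Finset.sum_eq_single i]
  · rw [hA, map_smul, b.repr_self, Finsupp.smul_apply, Finsupp.single_eq_same, smul_eq_mul,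
      mul_one, mul_comm]
  · intro j _ hj
    rw [hA, map_smul, b.repr_self, Finsupp.smul_apply, Finsupp.single_eq_of_ne hj.symm, smul_zero,
      mul_zero]
  · simp

theorem repr_eq_zero (b : Basis (Fin N) ℂ M) (hb : ∀ j, H (b j) = (D j : ℂ) • b j) {m : ℤ} {x : M}
    (hx : H x = (m : ℂ) • x) {i : Fin N} (hi : D i ≠ m) : b.repr x i = 0 := by
  have h1 := repr_apply_of_diagonal b hb x i
  rw [hx, map_smul, Finsupp.smul_apply, smul_eq_mul] at h1
  by_contra h0
  exact hi (Int.cast_injective (mul_right_cancel₀ h0 h1).symm)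

variable [FiniteDimensional ℂ M]

include hE hF hEF

/-- A Hall-type condition: raising is onto in positive weights, so the weights of a second grading
that raising does not lower cannot be too scarce below. -/
theorem count_le (b : Basis (Fin N) ℂ M) (hb : ∀ j, H (b j) = (D j : ℂ) • b j) {Z : ℕ → ℤ}
    (hZ : ∀ i j : Fin N, D i = D j + 2 → b.repr (E (b j)) i ≠ 0 → Z j ≤ Z i)
    {m : ℤ} (hm : 1 ≤ m) (c : ℤ) :
    Nat.count (fun i => D i = m ∧ Z i < c) N ≤ Nat.count (fun i => D i = m - 2 ∧ Z i < c) N := by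
  rw [← card_filter_val, ← card_filter_val, ← Fintype.card_coe, ← Fintype.card_coe]
  set T := ({i : Fin N | D i = m ∧ Z i < c} : Finset (Fin N))
  set S := ({i : Fin N | D i = m - 2 ∧ Z i < c} : Finset (Fin N))
  choose x hx hx' using fun i : T => raise_surjective hE hF hEF hm
    (y := b i) (by rw [hb, (mem_filter.mp i.2).2.1])
  let R : Matrix T S ℂ := fun i j => b.repr (x i) j
  let A : Matrix S T ℂ := fun j i => b.repr (E (b j)) i
  have hRA : R * A = 1 := by
    ext i i'
    have h1 := repr_apply_eq_sum b E (x i) i'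
    rw [hx', b.repr_self, Finsupp.single_apply] at h1
    rw [Matrix.mul_apply, Matrix.one_apply]
    simp only [← Subtype.ext_iff] at h1
    rw [h1]
    refine (sum_coe_sort S fun j => b.repr (x i) j * b.repr (E (b j)) i').trans
      (sum_subset (subset_univ _) fun j _ hj => ?_)
    by_cases hD : D j = m - 2
    · have hi' := (mem_filter.mp i'.2).2
      rw [mul_eq_zero]
      right
      by_contra h0
      have := hZ i' j (by omega) h0
      exact hj (mem_filter.mpr ⟨mem_univ _, hD, this.trans_lt hi'.2⟩)
    · rw [repr_eq_zero b hb (m := m - 2) (by rw [hx]; push_cast; rfl) hD, zero_mul]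
  have hinj : Function.Injective R.vecMulLinear := by
    refine Function.LeftInverse.injective (g := fun v => Matrix.vecMul v A) fun v => ?_
    simp [Matrix.vecMul_vecMul, hRA]
  simpa using LinearMap.finrank_le_finrank_of_injective hinj

/-- If there are no more vectors of weight `m - 2` than of weight `m > 0`, then raising is
injective on vectors of weight `m - 2`. -/
theorem eq_zero_of_count_le (b : Basis (Fin N) ℂ M) (hb : ∀ j, H (b j) = (D j : ℂ) • b j)
    {m : ℤ} (hm : 1 ≤ m)
    (hN : Nat.count (fun i => D i = m - 2) N ≤ Nat.count (fun i => D i = m) N) {y : M}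
    (hy : H y = ((m - 2 : ℤ) : ℂ) • y) (hEy : E y = 0) : y = 0 := by
  rw [← card_filter_val, ← card_filter_val, ← Fintype.card_coe, ← Fintype.card_coe] at hN
  set T := ({i : Fin N | D i = m} : Finset (Fin N))
  set S := ({i : Fin N | D i = m - 2} : Finset (Fin N))
  choose x hx hx' using fun i : T => raise_surjective hE hF hEF hm
    (y := b i) (by rw [hb, (mem_filter.mp i.2).2])
  let R : Matrix T S ℂ := fun i j => b.repr (x i) j
  let A : Matrix S T ℂ := fun j i => b.repr (E (b j)) i
  have key : ∀ (w : M), H w = ((m - 2 : ℤ) : ℂ) • w → ∀ i,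
      ∑ j : S, b.repr w j * b.repr (E (b j)) i = b.repr (E w) i := by
    intro w hw i
    rw [repr_apply_eq_sum b E w]
    refine (sum_coe_sort S fun j => b.repr w j * b.repr (E (b j)) i).trans
      (sum_subset (subset_univ _) fun j _ hj => ?_)
    rw [repr_eq_zero b hb hw fun h => hj (mem_filter.mpr ⟨mem_univ _, h⟩), zero_mul]
  have hRA : R * A = 1 := by
    ext i i'
    rw [Matrix.mul_apply, Matrix.one_apply]
    refine (key _ (by rw [hx]; push_cast; rfl) i').trans ?_
    rw [hx', b.repr_self, Finsupp.single_apply]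
    simp only [← Subtype.ext_iff]
  have hcard : Fintype.card T = Fintype.card S := by
    refine le_antisymm ?_ hN
    have hinj : Function.Injective R.vecMulLinear := by
      refine Function.LeftInverse.injective (g := fun v => Matrix.vecMul v A) fun v => ?_
      simp [Matrix.vecMul_vecMul, hRA]
    simpa using LinearMap.finrank_le_finrank_of_injective hinj
  have hAR := (Matrix.mul_eq_one_comm_of_card_eq T S ℂ hcard).mp hRA
  have h0 : Matrix.vecMul (fun j : S => b.repr y j) A = 0 := by
    ext i
    refine (key y hy i).trans ?_
    rw [hEy, map_zero, Finsupp.zero_apply, Pi.zero_apply]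
  have h1 : (fun j : S => b.repr y j) = 0 := by
    rw [← Matrix.vecMul_one (fun j : S => b.repr y j), ← hAR, ← Matrix.vecMul_vecMul, h0,
      Matrix.zero_vecMul]
  rw [← b.repr.map_eq_zero_iff]
  ext j
  by_cases hj : j ∈ S
  · exact congrFun h1 ⟨j, hj⟩
  · exact repr_eq_zero b hb hy fun h => hj (mem_filter.mpr ⟨mem_univ _, h⟩)

end Sl2

/-! ### Dominant characteristics -/

namespace E6

open Module LieExp

/-- The standard generators of a copy of `sl₂`. -/
structure IsTriple (h e f : LieAlgebra.e₆ ℂ) : Prop where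
  he : ⁅h, e⁆ = (2 : ℂ) • e
  hf : ⁅h, f⁆ = (-2 : ℂ) • f
  ef : ⁅e, f⁆ = h

/-- The adjoint operators. -/
noncomputable abbrev adj (x : LieAlgebra.e₆ ℂ) : Module.End ℂ (LieAlgebra.e₆ ℂ) :=
  LieModule.toEnd ℂ (LieAlgebra.e₆ ℂ) (LieAlgebra.e₆ ℂ) x

theorem adj_lie (x y : LieAlgebra.e₆ ℂ) : adj x * adj y - adj y * adj x = adj ⁅x, y⁆ := by
  ext z
  exact (lie_lie x y z).symm

namespace IsTriple

variable {h e f : LieAlgebra.e₆ ℂ} (ht : IsTriple h e f)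

include ht

theorem map (φ : LieAlgebra.e₆ ℂ ≃ₗ⁅ℂ⁆ LieAlgebra.e₆ ℂ) : IsTriple (φ h) (φ e) (φ f) where
  he := by rw [← LieEquiv.map_lie, ht.he, map_smul]
  hf := by rw [← LieEquiv.map_lie, ht.hf, map_smul]
  ef := by rw [← LieEquiv.map_lie, ht.ef]

theorem adj_he : adj h * adj e - adj e * adj h = (2 : ℂ) • adj e := by
  rw [adj_lie, ht.he, adj, map_smul]

theorem adj_hf : adj h * adj f - adj f * adj h = (-2 : ℂ) • adj f := by
  rw [adj_lie, ht.hf, adj, map_smul]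

theorem adj_ef : adj e * adj f - adj f * adj e = adj h := by
  rw [adj_lie, ht.ef]

end IsTriple

theorem exists_eq_lie_add {h : LieAlgebra.e₆ ℂ} (hh : ⨆ μ, (adj h).eigenspace μ = ⊤)
    (w : LieAlgebra.e₆ ℂ) : ∃ x z : LieAlgebra.e₆ ℂ, ⁅h, z⁆ = 0 ∧ w = ⁅x, h⁆ + z := by
  have hw : w ∈ ⨆ μ, (adj h).eigenspace μ := hh ▸ Submodule.mem_top
  induction hw using Submodule.iSup_induction' with
  | mem μ w hw =>
    rw [Module.End.mem_eigenspace_iff] at hw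
    replace hw : ⁅h, w⁆ = μ • w := hw
    rcases eq_or_ne μ 0 with rfl | hμ
    · exact ⟨0, w, by rw [hw, zero_smul], by simp⟩
    · refine ⟨-(μ⁻¹ • w), 0, lie_zero h, ?_⟩
      rw [neg_lie, smul_lie, ← smul_neg, lie_skew, hw, inv_smul_smul₀ hμ, add_zero]
  | zero => exact ⟨0, 0, by simp⟩
  | add w w' _ _ h1 h2 =>
    obtain ⟨x, z, h1, rfl⟩ := h1
    obtain ⟨x', z', h2, rfl⟩ := h2
    exact ⟨x + x', z + z', by rw [lie_add, h1, h2, add_zero], by rw [add_lie]; abel⟩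

theorem iSup_eigenspace_toral (a : ℕ → ℂ) : ⨆ μ, (adj (toral a)).eigenspace μ = ⊤ := by
  rw [eq_top_iff, ← span_rootVec, Submodule.span_le]
  rintro _ ⟨k, rfl⟩
  exact Submodule.mem_iSup_of_mem (degree (label a) k)
    (Module.End.mem_eigenspace_iff.mpr (lie_toral a k.2))

theorem repr_lie_toral (a : ℕ → ℂ) (x : LieAlgebra.e₆ ℂ) (k : Fin 78) :
    chevalleyBasis.repr ⁅toral a, x⁆ k = degree (label a) k * chevalleyBasis.repr x k := by
  refine Sl2.repr_apply_of_diagonal (A := adj (toral a)) (μ := fun j : Fin 78 => degree (label a) j)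
    chevalleyBasis (fun j => ?_) x k
  rw [chevalleyBasis_apply]
  exact lie_toral a j.2

theorem toral_lie_toral (a b : ℕ → ℂ) : ⁅toral a, toral b⁆ = 0 := by
  have h : ∀ i < 6, ⁅toral a, genH i⁆ = 0 := fun i hi => by
    rw [← rootVec_coroot, lie_toral a (by omega), degree_of_ge _ (by omega) (by omega), zero_smul]
  rw [toral.eq_1 b]
  simp [h]

/-- The Cartan subalgebra. -/
noncomputable def torus : Submodule ℂ (LieAlgebra.e₆ ℂ) :=
  Submodule.span ℂ (Set.range fun i : Fin 6 => genH i)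

theorem exists_toral {x : LieAlgebra.e₆ ℂ} (hx : x ∈ torus) : ∃ a, x = toral a := by
  obtain ⟨c, rfl⟩ := Submodule.mem_span_range_iff_exists_fun ℂ |>.mp hx
  exact ⟨extend c, by rw [Fin.sum_univ_six]; rfl⟩

theorem mem_torus {a : ℕ → ℂ} (ha : ∀ k < 72, degree (label a) k ≠ 0) {x : LieAlgebra.e₆ ℂ}
    (hx : x ∈ LieSubalgebra.engel ℂ (toral a)) : x ∈ torus := by
  obtain ⟨n, hn⟩ := LieSubalgebra.mem_engel_iff ℂ _ _ |>.mp hx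
  have h1 : ∀ n : ℕ, ∀ k : Fin 78, chevalleyBasis.repr (((LieAlgebra.ad ℂ _ (toral a)) ^ n) x) k =
      degree (label a) k ^ n * chevalleyBasis.repr x k := by
    intro n k
    induction n with
    | zero => simp
    | succ n ih =>
      rw [pow_succ', Module.End.mul_apply, LieAlgebra.ad_apply, repr_lie_toral, ih]
      ring
  rw [← chevalleyBasis.sum_repr x]
  refine Submodule.sum_mem _ fun k _ => ?_
  rcases lt_or_ge k.1 72 with hk | hk
  · have := h1 n k
    rw [hn, map_zero, Finsupp.zero_apply] at this
    rw [(mul_eq_zero.mp this.symm).resolve_left (pow_ne_zero _ (ha k hk)), zero_smul]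
    exact Submodule.zero_mem _
  · refine Submodule.smul_mem _ _ (Submodule.subset_span ⟨⟨k - 72, by omega⟩, ?_⟩)
    rw [chevalleyBasis_apply]
    exact (rootVec_coroot _).symm.trans (congrArg rootVec (Nat.sub_add_cancel hk))

theorem IsTriple.exists_toral {h e f : LieAlgebra.e₆ ℂ} (ht : IsTriple h e f) :
    ∃ φ : LieAlgebra.e₆ ℂ ≃ₗ⁅ℂ⁆ LieAlgebra.e₆ ℂ, ∃ a, φ h = toral a := by
  obtain ⟨a, d, hd, hd0, -, -⟩ := exists_generic
  obtain ⟨φ, hφ⟩ := exists_conj_mem (h := h) (h₀ := toral a)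
    (exists_eq_lie_add (Sl2.iSup_eigenspace ht.adj_he ht.adj_hf ht.adj_ef))
    (exists_eq_lie_add (iSup_eigenspace_toral a)) torus
    (by
      intro x hx y hy
      obtain ⟨b, rfl⟩ := E6.exists_toral hx
      obtain ⟨c, rfl⟩ := E6.exists_toral hy
      exact toral_lie_toral b c)
    (fun x hx => mem_torus (fun k hk => by
      rw [hd k (by omega)]
      exact Int.cast_ne_zero.mpr (hd0 k hk)) hx)
  exact ⟨φ, E6.exists_toral hφ⟩

theorem lie_genE {i : ℕ} (hi : i < 6) (a : ℕ → ℂ) : ⁅genE i, toral a⁆ = -(label a i • genE i) := by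
  rw [← lie_skew, ← rootVec_simple hi, lie_toral a (by omega), degree_simple _ hi]

theorem degree_neg_simple {R : Type*} [CommRing R] (n : ℕ → R) {k : ℕ} (hk : k < 6) :
    degree n (k + 36) = -n k := by
  have h : ∀ k < 6, ∀ j < 6, coeff (k + 36) j = if k = j then -1 else 0 := by decide +kernel
  simp only [degree, h k hk _ (show 0 < 6 by norm_num), h k hk _ (show 1 < 6 by norm_num),
    h k hk _ (show 2 < 6 by norm_num), h k hk _ (show 3 < 6 by norm_num),
    h k hk _ (show 4 < 6 by norm_num), h k hk _ (show 5 < 6 by norm_num)]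
  interval_cases k <;> simp

theorem neg_genF_lie {i : ℕ} (hi : i < 6) (a : ℕ → ℂ) :
    ⁅-genF i, toral a⁆ = -(label a i • genF i) := by
  rw [← lie_skew, ← rootVec_neg_simple hi, lie_toral a (by omega), degree_neg_simple _ hi,
    rootVec_neg_simple hi]
  simp

theorem pairing_self : ∀ i < 6, pairing i i = 2 := by decide +kernel

theorem pairing_neg_self : ∀ i < 6, pairing i (i + 36) = -2 := by decide +kernel

/-- The simple reflections are realised by automorphisms. -/
theorem exists_reflection {i : ℕ} (hi : i < 6) (a : ℕ → ℂ) :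
    ∃ φ : LieAlgebra.e₆ ℂ ≃ₗ⁅ℂ⁆ LieAlgebra.e₆ ℂ, φ (toral a) = toral a - label a i • genH i := by
  have hC := chevalley_gen
  have hEF : ⁅genE i, genF i⁆ = genH i := by
    have := hC.EF i hi i hi
    rwa [if_pos rfl] at this
  have hHE : ⁅genH i, genE i⁆ = (2 : ℂ) • genE i := by
    have := lie_genH hi (show i < 78 by omega)
    rwa [pairing_self i hi, rootVec_simple hi] at this
  have hHF : ⁅genH i, genF i⁆ = (-2 : ℂ) • genF i := by
    have := lie_genH hi (show i + 36 < 78 by omega)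
    rw [pairing_neg_self i hi,
      rootVec_neg_simple hi, lie_neg, smul_neg, neg_inj] at this
    simpa using this
  have h1 : expAd (genE i) (toral a) = toral a - label a i • genE i := by
    rw [expAd_apply_of_sq, lie_genE hi, sub_eq_add_neg]
    rw [lie_genE hi, lie_neg, lie_smul, lie_self, smul_zero, neg_zero]
  have h2 : expAd (-genF i) (toral a) = toral a - label a i • genF i := by
    rw [expAd_apply_of_sq, neg_genF_lie hi, sub_eq_add_neg]
    rw [neg_genF_lie hi, lie_neg, lie_smul, neg_lie, lie_self, neg_zero, smul_zero, neg_zero]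
  have hFE : ⁅-genF i, genE i⁆ = genH i := by rw [neg_lie, lie_skew, hEF]
  have hFH : ⁅-genF i, genH i⁆ = (-2 : ℂ) • genF i := by rw [neg_lie, lie_skew, hHF]
  have h3 : expAd (-genF i) (genE i) = genE i + genH i - genF i := by
    rw [expAd_apply_of_cube, hFE, hFH]
    · module
    · rw [hFE, hFH, lie_smul, neg_lie, lie_self, neg_zero, smul_zero]
  have hEH : ⁅genE i, genH i⁆ = (-2 : ℂ) • genE i := by
    rw [← lie_skew, hHE]; module
  have h4 : expAd (genE i) (genH i) = genH i - (2 : ℂ) • genE i := by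
    rw [expAd_apply_of_sq, hEH]
    · module
    · rw [hEH, lie_smul, lie_self, smul_zero]
  have h5 : expAd (genE i) (genE i) = genE i := by
    rw [expAd_apply_of_sq, lie_self, add_zero]
    rw [lie_self, lie_zero]
  refine ⟨((expAd (genE i)).trans (expAd (-genF i))).trans (expAd (genE i)), ?_⟩
  rw [LieEquiv.trans_apply, LieEquiv.trans_apply, h1, map_sub, map_smul, h2, h3]
  rw [show toral a - label a i • genF i - label a i • (genE i + genH i - genF i) =
    toral a - label a i • genE i - label a i • genH i by module]
  rw [map_sub, map_sub, map_smul, map_smul, h1, h4, h5]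
  module

theorem exists_toral_reflection {i : ℕ} (hi : i < 6) (a : ℕ → ℂ) :
    ∃ φ : LieAlgebra.e₆ ℂ ≃ₗ⁅ℂ⁆ LieAlgebra.e₆ ℂ, ∃ a', φ (toral a) = toral a' ∧
      a' 0 + a' 1 + a' 2 + a' 3 + a' 4 + a' 5 =
        a 0 + a 1 + a 2 + a 3 + a 4 + a 5 - label a i := by
  obtain ⟨φ, hφ⟩ := exists_reflection hi a
  refine ⟨φ, fun j => if j = i then a i - label a i else a j, ?_, ?_⟩
  · rw [hφ]
    generalize label a i = c
    simp only [toral]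
    interval_cases i <;> simp <;> module
  · generalize label a i = c
    interval_cases i <;> simp <;> ring

theorem IsTriple.label_int {a : ℕ → ℂ} {e f : LieAlgebra.e₆ ℂ} (ht : IsTriple (toral a) e f) :
    ∃ n : ℕ → ℤ, ∀ j < 6, label a j = n j := by
  have : ∀ j, ∃ n : ℤ, j < 6 → label a j = n := by
    intro j
    by_cases hj : j < 6
    · obtain ⟨n, hn⟩ := Sl2.weight_int ht.adj_he ht.adj_hf ht.adj_ef
        (rootVec_ne_zero (show j < 72 by omega)) (lie_toral a (show j < 78 by omega))
      exact ⟨n, fun _ => by rw [← hn, degree_simple _ hj]⟩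
    · exact ⟨0, fun h => absurd h hj⟩
  choose n hn using this
  exact ⟨n, hn⟩

/-- Twice the value of the half sum of the positive coroots. -/
def height (n : ℕ → ℤ) : ℤ :=
  16 * n 0 + 22 * n 1 + 30 * n 2 + 42 * n 3 + 30 * n 4 + 16 * n 5

theorem height_eq {a : ℕ → ℂ} {n : ℕ → ℤ} (hn : ∀ j < 6, label a j = n j) :
    (height n : ℂ) = 2 * (a 0 + a 1 + a 2 + a 3 + a 4 + a 5) := by
  obtain ⟨e0, e1, e2, e3, e4, e5⟩ := label_formula a
  simp only [height]
  push_cast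
  rw [← hn 0, ← hn 1, ← hn 2, ← hn 3, ← hn 4, ← hn 5] <;> try norm_num
  rw [e0, e1, e2, e3, e4, e5]
  ring

theorem IsTriple.exists_nonneg {h e f : LieAlgebra.e₆ ℂ} (ht : IsTriple h e f) :
    ∃ φ : LieAlgebra.e₆ ℂ ≃ₗ⁅ℂ⁆ LieAlgebra.e₆ ℂ, ∃ a, ∃ n : ℕ → ℤ, φ h = toral a ∧
      (∀ j < 6, label a j = n j) ∧ ∀ j < 6, 0 ≤ n j := by
  obtain ⟨B, hB⟩ : ∃ B : ℤ, ∀ m : ℤ, (adj h).HasEigenvalue (m : ℂ) → m ≤ B := by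
    have : {m : ℤ | (adj h).HasEigenvalue (m : ℂ)}.Finite :=
      (Module.End.finite_hasEigenvalue (adj h)).preimage Int.cast_injective.injOn
    exact this.bddAbove
  obtain ⟨s, ⟨φ, a, n, hφ, hn, hs⟩, hmax⟩ := Int.exists_greatest_of_bdd
    (P := fun s => ∃ φ : LieAlgebra.e₆ ℂ ≃ₗ⁅ℂ⁆ LieAlgebra.e₆ ℂ, ∃ a, ∃ n : ℕ → ℤ, φ h = toral a ∧
      (∀ j < 6, label a j = n j) ∧ s = height n) (by
    refine ⟨156 * B, ?_⟩
    rintro _ ⟨φ, a, n, hφ, hn, rfl⟩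
    have : ∀ j < 6, n j ≤ B := by
      intro j hj
      refine hB _ (Module.End.hasEigenvalue_of_hasEigenvector (x := φ.symm (rootVec j))
        ⟨Module.End.mem_eigenspace_iff.mpr ?_, ?_⟩)
      · apply φ.injective
        change φ ⁅h, φ.symm (rootVec j)⁆ = _
        rw [LieEquiv.map_lie, LieEquiv.apply_symm_apply, hφ, lie_toral a (by omega),
          degree_simple _ hj, hn j hj]
        exact ((map_smul φ _ _).trans (by rw [LieEquiv.apply_symm_apply])).symm
      · intro h0
        refine rootVec_ne_zero (show j < 72 by omega) ?_
        rw [← φ.apply_symm_apply (rootVec j), h0, map_zero]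
    simp only [height]
    linarith [this 0 (by norm_num), this 1 (by norm_num), this 2 (by norm_num),
      this 3 (by norm_num), this 4 (by norm_num), this 5 (by norm_num)]) (by
    obtain ⟨φ, a, hφ⟩ := ht.exists_toral
    obtain ⟨n, hn⟩ := (hφ ▸ ht.map φ).label_int
    exact ⟨_, φ, a, n, hφ, hn, rfl⟩)
  refine ⟨φ, a, n, hφ, hn, fun i hi => ?_⟩
  obtain ⟨ψ, a', hψ, hsum⟩ := exists_toral_reflection hi a
  have hφψ : (φ.trans ψ) h = toral a' := by rw [LieEquiv.trans_apply, hφ, hψ]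
  obtain ⟨n', hn'⟩ := (hφψ ▸ ht.map (φ.trans ψ)).label_int
  have h1 := hmax _ ⟨φ.trans ψ, a', n', hφψ, hn', rfl⟩
  have h2 : height n' = height n - 2 * n i := by
    have : (height n' : ℂ) = (height n - 2 * n i : ℤ) := by
      rw [height_eq hn', hsum]
      push_cast
      rw [height_eq hn, hn i hi]
      ring
    exact_mod_cast this
  omega

theorem coeff_sign : ∀ k < 78, ∀ j < 6, (k < 36 → 0 ≤ coeff k j) ∧ (36 ≤ k → coeff k j ≤ 0) := by
  decide +kernel

theorem degree_nonneg {n : ℕ → ℤ} (hn : ∀ j < 6, 0 ≤ n j) {k : ℕ} (hk : k < 36) :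
    0 ≤ degree n k := by
  have h : ∀ j < 6, 0 ≤ (coeff k j : ℤ) * n j := fun j hj =>
    mul_nonneg ((coeff_sign k (by omega) j hj).1 hk) (hn j hj)
  simp only [degree, Int.cast_id]
  linarith [h 0 (by norm_num), h 1 (by norm_num), h 2 (by norm_num),
      h 3 (by norm_num), h 4 (by norm_num), h 5 (by norm_num)]

theorem degree_nonpos {n : ℕ → ℤ} (hn : ∀ j < 6, 0 ≤ n j) {k : ℕ} (hk : 36 ≤ k) (hk' : k < 78) :
    degree n k ≤ 0 := by
  have h : ∀ j < 6, (coeff k j : ℤ) * n j ≤ 0 := fun j hj =>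
    mul_nonpos_of_nonpos_of_nonneg ((coeff_sign k hk' j hj).2 hk) (hn j hj)
  simp only [degree, Int.cast_id]
  linarith [h 0 (by norm_num), h 1 (by norm_num), h 2 (by norm_num),
      h 3 (by norm_num), h 4 (by norm_num), h 5 (by norm_num)]

theorem table_neg_simple : ∀ k < 72, 36 ≤ k → ∀ i < 6, k = i + 36 ∨
    table k i = [] ∨ ∃ k' < 72, 36 ≤ k' ∧ ∀ j < 6, coeff k' j = coeff k j + coeff i j := by
  decide +kernel

theorem degree_of_coeff_add {R : Type*} [CommRing R] (n : ℕ → R) {k k' i : ℕ}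
    (h : ∀ j < 6, coeff k' j = coeff k j + coeff i j) :
    degree n k' = degree n k + degree n i := by
  simp only [degree, h _ (show 0 < 6 by norm_num), h _ (show 1 < 6 by norm_num),
    h _ (show 2 < 6 by norm_num), h _ (show 3 < 6 by norm_num),
    h _ (show 4 < 6 by norm_num), h _ (show 5 < 6 by norm_num)]
  push_cast
  ring

theorem degree_label {a : ℕ → ℂ} {n : ℕ → ℤ} (hn : ∀ j < 6, label a j = n j) (k : ℕ) :
    degree (label a) k = (degree n k : ℤ) := by
  rw [degree_congr hn, degree_intCast]

/-- Homogeneous elements are supported on the basis vectors of the same degree. -/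
theorem repr_eq_zero {a : ℕ → ℂ} {n : ℕ → ℤ} (hn : ∀ j < 6, label a j = n j) {m : ℤ}
    {x : LieAlgebra.e₆ ℂ} (hx : ⁅toral a, x⁆ = (m : ℂ) • x) {k : Fin 78} (hk : degree n k ≠ m) :
    chevalleyBasis.repr x k = 0 := by
  refine Sl2.repr_eq_zero (H := adj (toral a)) (D := degree n) chevalleyBasis (fun j => ?_) hx hk
  rw [chevalleyBasis_apply, ← degree_label hn]
  exact lie_toral a j.2

theorem IsTriple.label_le_two {a : ℕ → ℂ} {n : ℕ → ℤ} {e f : LieAlgebra.e₆ ℂ}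
    (ht : IsTriple (toral a) e f) (hn : ∀ j < 6, label a j = n j) (h0 : ∀ j < 6, 0 ≤ n j) :
    ∀ j < 6, n j ≤ 2 := by
  intro i hi
  by_contra! h3
  refine rootVec_ne_zero (show i < 72 by omega)
    (Sl2.raise_lower_injective ht.adj_he ht.adj_ef (m := n i) (by omega) ?_ ?_)
  · refine (lie_toral a (by omega)).trans ?_
    rw [degree_simple _ hi, hn i hi]
  · suffices ⁅f, rootVec i⁆ = 0 by
      change ⁅e, ⁅f, rootVec i⁆⁆ = 0
      rw [this, lie_zero]
    rw [← chevalleyBasis.sum_repr f, sum_lie]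
    refine Finset.sum_eq_zero fun k _ => ?_
    by_cases hk : degree n k = -2
    · rw [chevalleyBasis_apply, smul_lie, lie_rootVec k.2 (by omega)]
      suffices table k i = [] by rw [this, ev, smul_zero]
      have hk1 : 36 ≤ k.1 := by
        by_contra! h
        have := degree_nonneg h0 h
        omega
      have hk2 : k.1 < 72 := by
        by_contra! h
        rw [degree_of_ge n h k.2] at hk
        norm_num at hk
      refine ((table_neg_simple k hk2 hk1 i hi).resolve_left ?_).resolve_right ?_
      · intro h
        rw [h, degree_neg_simple _ hi] at hk
        omega
      · rintro ⟨k', h1, h2, h⟩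
        have h4 := degree_of_coeff_add n h
        rw [hk, degree_simple _ hi] at h4
        have := degree_nonpos h0 h2 (by omega)
        omega
    · rw [repr_eq_zero hn (m := -2) (by rw [ht.hf]; norm_num) hk, zero_smul, zero_lie]

theorem IsTriple.exists_dominant {h e f : LieAlgebra.e₆ ℂ} (ht : IsTriple h e f) :
    ∃ φ : LieAlgebra.e₆ ℂ ≃ₗ⁅ℂ⁆ LieAlgebra.e₆ ℂ, ∃ a, ∃ n : ℕ → ℤ, φ h = toral a ∧
      (∀ j < 6, label a j = n j) ∧ ∀ j < 6, 0 ≤ n j ∧ n j ≤ 2 := by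
  obtain ⟨φ, a, n, hφ, hn, h0⟩ := ht.exists_nonneg
  exact ⟨φ, a, n, hφ, hn, fun j hj => ⟨h0 j hj, (hφ ▸ ht.map φ).label_le_two hn h0 j hj⟩⟩

end E6

/-! ### The possible characteristics -/

namespace E6

open Module

/-- A sequence of labels given by its digits in base `4`. -/
def labels (c j : ℕ) : ℤ := ((c >>> (2 * j)) % 4 : ℕ)

/-- The value of the `k`-th root for integral labels. -/
def deg (n : ℕ → ℤ) (k : ℕ) : ℤ :=
  coeff k 0 * n 0 + coeff k 1 * n 1 + coeff k 2 * n 2 + coeff k 3 * n 3 + coeff k 4 * n 4 +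
    coeff k 5 * n 5

theorem degree_eq_deg (n : ℕ → ℤ) (k : ℕ) : degree n k = deg n k := by simp [degree, deg]

/-- Three times the value of the `m`-th weight of the minuscule representation. -/
def weightDeg (n : ℕ → ℤ) (m : ℕ) : ℤ :=
  weightCoeff m 0 * n 0 + weightCoeff m 1 * n 1 + weightCoeff m 2 * n 2 + weightCoeff m 3 * n 3 +
    weightCoeff m 4 * n 4 + weightCoeff m 5 * n 5

/-- The value of the `m`-th weight of the minuscule representation. -/
noncomputable def weightValue (n : ℕ → ℂ) (m : ℕ) : ℂ :=
  (weightCoeff m 0 * n 0 + weightCoeff m 1 * n 1 + weightCoeff m 2 * n 2 + weightCoeff m 3 * n 3 +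
    weightCoeff m 4 * n 4 + weightCoeff m 5 * n 5) / 3

theorem three_mul_weightPairing : ∀ i < 6, ∀ m < 27, 3 * weightPairing i m =
    cartan i 0 * weightCoeff m 0 + cartan i 1 * weightCoeff m 1 + cartan i 2 * weightCoeff m 2 +
    cartan i 3 * weightCoeff m 3 + cartan i 4 * weightCoeff m 4 + cartan i 5 * weightCoeff m 5 := by
  decide +kernel

section

attribute [local instance] LieRing.ofAssociativeRing

theorem exists_weight_rep : ∃ φ : LieAlgebra.e₆ ℂ →ₗ[ℂ] Module.End ℂ (Fin 27 → ℂ),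
    (∀ x y, φ ⁅x, y⁆ = φ x * φ y - φ y * φ x) ∧
    ∀ (m : Fin 27) (a : ℕ → ℂ), φ (toral a) (Pi.basisFun ℂ (Fin 27) m) =
      weightValue (label a) m • Pi.basisFun ℂ (Fin 27) m := by
  obtain ⟨φ, hφ⟩ := exists_rep
  refine ⟨φ.toLinearMap, fun x y => LieHom.map_lie φ x y, fun m a => ?_⟩
  rw [Pi.basisFun_apply, ← weightVec_val]
  have h3 : ∀ i < 6, φ (genH i) (weightVec m) = (((cartan i 0 * weightCoeff m 0 +
      cartan i 1 * weightCoeff m 1 + cartan i 2 * weightCoeff m 2 +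
      cartan i 3 * weightCoeff m 3 + cartan i 4 * weightCoeff m 4 +
      cartan i 5 * weightCoeff m 5 : ℤ) : ℂ) / 3) • weightVec m := fun i hi => by
    rw [hφ i hi m m.2, ← three_mul_weightPairing i hi m m.2]
    congr 1
    push_cast
    ring
  change φ (toral a) _ = _
  simp only [toral, map_add, map_smul, LinearMap.add_apply, LinearMap.smul_apply,
    h3 0 (by norm_num), h3 1 (by norm_num), h3 2 (by norm_num), h3 3 (by norm_num),
    h3 4 (by norm_num), h3 5 (by norm_num), smul_smul, ← add_smul]
  congr 1
  simp only [weightValue, label]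
  push_cast
  ring

end

theorem exists_degree_of_repr_ne {M : Type*} [AddCommGroup M] [Module ℂ M] {N : ℕ}
    (b : Basis (Fin N) ℂ M) (φ : LieAlgebra.e₆ ℂ →ₗ[ℂ] Module.End ℂ M)
    (hφ : ∀ x y, φ ⁅x, y⁆ = φ x * φ y - φ y * φ x) {w : (ℕ → ℂ) → ℕ → ℂ}
    (hw : ∀ (j : Fin N) a, φ (toral a) (b j) = w (label a) j • b j) {x : LieAlgebra.e₆ ℂ}
    {n : ℕ → ℤ} {δ : ℤ} (hx : ∀ k : Fin 78, degree n k ≠ δ → chevalleyBasis.repr x k = 0)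
    {i j : Fin N} (hij : b.repr (φ x (b j)) i ≠ 0) :
    ∃ k < 78, deg n k = δ ∧ ∀ a, w (label a) i = degree (label a) k + w (label a) j := by
  let ψ : LieAlgebra.e₆ ℂ →ₗ[ℂ] ℂ := b.coord i ∘ₗ LinearMap.applyₗ (b j) ∘ₗ φ
  have h1 : ψ x = ∑ k, chevalleyBasis.repr x k • ψ (chevalleyBasis k) := by
    conv_lhs => rw [← chevalleyBasis.sum_repr x]
    rw [map_sum]
    simp only [map_smul]
  obtain ⟨k, -, hk⟩ := Finset.exists_ne_zero_of_sum_ne_zero (h1 ▸ show ψ x ≠ 0 from hij)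
  rw [smul_eq_mul, mul_ne_zero_iff] at hk
  replace hk : _ ∧ b.repr (φ (chevalleyBasis k) (b j)) i ≠ 0 := hk
  refine ⟨k, k.2, ?_, fun a => mul_right_cancel₀ hk.2 ?_⟩
  · rw [← degree_eq_deg]
    exact not_not.mp fun h => hk.1 (hx k h)
  · rw [← Sl2.repr_apply_of_diagonal (A := φ (toral a)) (μ := fun j : Fin N => w (label a) j) b
      fun j => hw j a]
    have h1 := LinearMap.congr_fun (hφ (toral a) (chevalleyBasis k)) (b j)
    rw [LinearMap.sub_apply, Module.End.mul_apply, Module.End.mul_apply, hw, map_smul,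
      eq_sub_iff_add_eq, chevalleyBasis_apply, lie_toral a k.2, map_smul, LinearMap.smul_apply,
      ← add_smul] at h1
    rw [chevalleyBasis_apply, ← h1, map_smul, Finsupp.smul_apply, smul_eq_mul]

/-- The second grading is compatible with the labels. -/
def Admissible (n z : ℕ → ℤ) : Prop :=
  ∀ k < 78, (deg n k = 2 → 0 ≤ deg z k) ∧ (deg n k = -2 → deg z k ≤ 0)

/-- The counting condition fails. -/
def Obstructed (D Z : ℕ → ℤ) (N : ℕ) (m c : ℤ) : Prop :=
  Nat.count (fun i => D i = m - 2 ∧ Z i < c) N < Nat.count (fun i => D i = m ∧ Z i < c) N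

instance (n z : ℕ → ℤ) : Decidable (Admissible n z) :=
  inferInstanceAs (Decidable (∀ k < 78, _ ∧ _))

instance (D Z : ℕ → ℤ) (N : ℕ) (m c : ℤ) : Decidable (Obstructed D Z N m c) :=
  inferInstanceAs (Decidable (_ < _))

/-- The counting condition fails for the adjoint representation. -/
def RootObstructed (n : ℕ → ℤ) (m c : ℤ) (z : ℕ → ℤ) : Prop :=
  Admissible n z ∧ Obstructed (deg n) (deg z) 78 m c

/-- The counting condition fails for the minuscule representation. -/
def WeightObstructed (n : ℕ → ℤ) (m c : ℤ) (z : ℕ → ℤ) : Prop :=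
  Admissible n z ∧ Obstructed (fun j => weightDeg n j / 3) (weightDeg z) 27 m c

/-- The counting condition fails for the dual of the minuscule representation. -/
def CoweightObstructed (n : ℕ → ℤ) (m c : ℤ) (z : ℕ → ℤ) : Prop :=
  Admissible n z ∧ Obstructed (fun j => -(weightDeg n j / 3)) (fun j => -weightDeg z j) 27 m c

instance (n : ℕ → ℤ) (m c : ℤ) (z : ℕ → ℤ) : Decidable (RootObstructed n m c z) :=
  inferInstanceAs (Decidable (_ ∧ _))

instance (n : ℕ → ℤ) (m c : ℤ) (z : ℕ → ℤ) : Decidable (WeightObstructed n m c z) :=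
  inferInstanceAs (Decidable (_ ∧ _))

instance (n : ℕ → ℤ) (m c : ℤ) (z : ℕ → ℤ) : Decidable (CoweightObstructed n m c z) :=
  inferInstanceAs (Decidable (_ ∧ _))

/-- There are no more roots of value `1` than of value `3`. -/
def Narrow (n : ℕ → ℤ) : Prop :=
  Nat.count (fun k => deg n k = 1) 78 ≤ Nat.count (fun k => deg n k = 3) 78

instance (n : ℕ → ℤ) : Decidable (Narrow n) := inferInstanceAs (Decidable (_ ≤ _))

/-- Some counting condition fails. -/
def SomewhereObstructed (n : ℕ → ℤ) : Prop :=
  (∃ p ∈ ([(5, 1, 1365), (4, 1, 1365), (8, 0, 549), (4, 0, 2193)] : List (ℤ × ℤ × ℕ)),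
    RootObstructed n p.1 p.2.1 fun j => labels p.2.2 j - 1) ∨
  (∃ p ∈ ([(1, 1, 1365), (2, 1, 1365), (1, -1, 405), (1, -1, 345), (2, 0, 597)] :
      List (ℤ × ℤ × ℕ)), WeightObstructed n p.1 p.2.1 fun j => labels p.2.2 j - 1) ∨
  ∃ p ∈ ([(1, 1, 1365), (2, 1, 1365)] : List (ℤ × ℤ × ℕ)),
    CoweightObstructed n p.1 p.2.1 fun j => labels p.2.2 j - 1

instance (n : ℕ → ℤ) : Decidable (SomewhereObstructed n) :=
  inferInstanceAs (Decidable (_ ∨ _ ∨ _))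

/-- The conclusion of the case analysis for given labels. -/
def CharacteristicCases (c : ℕ) : Prop :=
  (∀ j < 6, labels c j ≤ 2) → weightDeg (labels c) 0 % 3 = 0 → Narrow (labels c) ∨
    c ∈ [4, 64, 272, 1025, 1029, 1089, 276, 1301, 1305] ∨ SomewhereObstructed (labels c)

instance (c : ℕ) : Decidable (CharacteristicCases c) := inferInstanceAs (Decidable (_ → _ → _))

theorem characteristic_cases : ∀ c < 64, ∀ c' < 64, CharacteristicCases (64 * c + c') := by
  decide +kernel

end E6

namespace E6

open Module

theorem weightValue_eq {n : ℕ → ℂ} {z : ℕ → ℤ} (h : ∀ j < 6, n j = z j) (m : ℕ) :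
    weightValue n m = (weightDeg z m : ℂ) / 3 := by
  simp only [weightValue, weightDeg, h _ (show 0 < 6 by norm_num), h _ (show 1 < 6 by norm_num),
    h _ (show 2 < 6 by norm_num), h _ (show 3 < 6 by norm_num),
    h _ (show 4 < 6 by norm_num), h _ (show 5 < 6 by norm_num)]
  push_cast
  rfl

theorem degree_label_eq {a : ℕ → ℂ} {n : ℕ → ℤ} (hn : ∀ j < 6, label a j = n j) (k : ℕ) :
    degree (label a) k = (deg n k : ℂ) := by
  rw [degree_label hn, degree_eq_deg]

variable {a : ℕ → ℂ} {n : ℕ → ℤ} {e f : LieAlgebra.e₆ ℂ}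

theorem deg_mono {M : Type*} [AddCommGroup M] [Module ℂ M] {N : ℕ}
    (b : Basis (Fin N) ℂ M) (φ : LieAlgebra.e₆ ℂ →ₗ[ℂ] Module.End ℂ M)
    (hφ : ∀ x y, φ ⁅x, y⁆ = φ x * φ y - φ y * φ x)
    (hw : ∀ (j : Fin N) a, φ (toral a) (b j) = degree (label a) j • b j)
    (hn : ∀ j < 6, label a j = n j) {x : LieAlgebra.e₆ ℂ} {δ : ℤ} (hx : ⁅toral a, x⁆ = (δ : ℂ) • x)
    {i j : Fin N} (hij : b.repr (φ x (b j)) i ≠ 0) (z : ℕ → ℤ) :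
    ∃ k < 78, deg n k = δ ∧ deg z i = deg z k + deg z j := by
  obtain ⟨k, hk, hd, h⟩ := exists_degree_of_repr_ne b φ hφ hw (n := n) (δ := δ)
    (fun k hk => repr_eq_zero hn hx hk) hij
  obtain ⟨a', ha'⟩ := exists_label fun j => z j
  have := h a'
  simp only [degree_label_eq ha'] at this
  exact ⟨k, hk, hd, by exact_mod_cast this⟩

theorem weightDeg_mono {M : Type*} [AddCommGroup M] [Module ℂ M] {N : ℕ}
    (b : Basis (Fin N) ℂ M) (φ : LieAlgebra.e₆ ℂ →ₗ[ℂ] Module.End ℂ M)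
    (hφ : ∀ x y, φ ⁅x, y⁆ = φ x * φ y - φ y * φ x)
    (hw : ∀ (j : Fin N) a, φ (toral a) (b j) = weightValue (label a) j • b j)
    (hn : ∀ j < 6, label a j = n j) {x : LieAlgebra.e₆ ℂ} {δ : ℤ} (hx : ⁅toral a, x⁆ = (δ : ℂ) • x)
    {i j : Fin N} (hij : b.repr (φ x (b j)) i ≠ 0) (z : ℕ → ℤ) :
    ∃ k < 78, deg n k = δ ∧ weightDeg z i = 3 * deg z k + weightDeg z j := by
  obtain ⟨k, hk, hd, h⟩ := exists_degree_of_repr_ne b φ hφ hw (n := n) (δ := δ)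
    (fun k hk => repr_eq_zero hn hx hk) hij
  obtain ⟨a', ha'⟩ := exists_label fun j => z j
  have := h a'
  simp only [degree_label_eq ha', weightValue_eq ha'] at this
  have h2 : (weightDeg z i : ℂ) = 3 * deg z k + weightDeg z j := by linear_combination 3 * this
  exact ⟨k, hk, hd, by exact_mod_cast h2⟩

theorem neg_commutator {M : Type*} [AddCommGroup M] [Module ℂ M] {A B : Module.End ℂ M} {c : ℂ}
    (h : A * B - B * A = c • B) : -A * B - B * -A = (-c) • B := by
  refine LinearMap.ext fun v => ?_
  have := LinearMap.congr_fun h v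
  simp only [LinearMap.sub_apply, Module.End.mul_apply, LinearMap.neg_apply, LinearMap.smul_apply,
    map_neg, neg_smul] at this ⊢
  rw [← this]
  abel

/-- The adjoint representation as a linear map. -/
noncomputable def adjHom : LieAlgebra.e₆ ℂ →ₗ[ℂ] Module.End ℂ (LieAlgebra.e₆ ℂ) where
  toFun := adj
  map_add' x y := map_add _ x y
  map_smul' c x := map_smul _ c x

theorem adjHom_apply (x y : LieAlgebra.e₆ ℂ) : adjHom x y = ⁅x, y⁆ := rfl

theorem adjHom_lie (x y : LieAlgebra.e₆ ℂ) :
    adjHom ⁅x, y⁆ = adjHom x * adjHom y - adjHom y * adjHom x := by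
  ext z
  exact lie_lie x y z

namespace IsTriple

variable (ht : IsTriple (toral a) e f) (hn : ∀ j < 6, label a j = n j)

include ht hn

theorem not_rootObstructed {m c : ℤ} (hm : 1 ≤ m) (z : ℕ → ℤ) : ¬ RootObstructed n m c z := by
  rintro ⟨hz, h⟩
  have hw : ∀ (j : Fin 78) a, adjHom (toral a) (chevalleyBasis j) =
      degree (label a) j • chevalleyBasis j := fun j a => by
    rw [adjHom_apply, chevalleyBasis_apply, lie_toral a j.2]
  refine h.not_ge (Sl2.count_le (H := adjHom (toral a)) (E := adjHom e) (F := adjHom f)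
    ht.adj_he ht.adj_hf ht.adj_ef chevalleyBasis (fun j => ?_) ?_ hm c)
  · rw [hw, degree_label_eq hn]
  · intro i j _ hij
    obtain ⟨k, hk, hd, h⟩ := deg_mono chevalleyBasis adjHom adjHom_lie hw hn (δ := 2) (x := e)
      (by rw [ht.he]; norm_num) hij z
    have := (hz k hk).1 hd
    omega

section

variable {φ : LieAlgebra.e₆ ℂ →ₗ[ℂ] Module.End ℂ (Fin 27 → ℂ)}
    (hφ : ∀ x y, φ ⁅x, y⁆ = φ x * φ y - φ y * φ x)
    (hw : ∀ (m : Fin 27) (a : ℕ → ℂ), φ (toral a) (Pi.basisFun ℂ (Fin 27) m) =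
      weightValue (label a) m • Pi.basisFun ℂ (Fin 27) m)

include hφ hw

theorem rep_int (m : Fin 27) :
    weightValue (label a) m = (weightDeg n m / 3 : ℤ) ∧ weightDeg n m % 3 = 0 := by
  obtain ⟨t, ht⟩ := Sl2.weight_int (H := φ (toral a)) (E := φ e) (F := φ f)
    (by rw [← hφ, ht.he, map_smul]) (by rw [← hφ, ht.hf, map_smul]) (by rw [← hφ, ht.ef])
    ((Pi.basisFun ℂ (Fin 27)).ne_zero m) (hw m a)
  have h1 : weightDeg n m = 3 * t := by
    rw [weightValue_eq hn] at ht
    have : (weightDeg n m : ℂ) = 3 * t := by linear_combination 3 * ht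
    exact_mod_cast this
  exact ⟨by rw [ht, h1, Int.mul_ediv_cancel_left _ (by norm_num)], by omega⟩

theorem not_weightObstructed {m c : ℤ} (hm : 1 ≤ m) (z : ℕ → ℤ) : ¬ WeightObstructed n m c z := by
  rintro ⟨hz, h⟩
  refine h.not_ge (Sl2.count_le (H := φ (toral a)) (E := φ e) (F := φ f)
    (by rw [← hφ, ht.he, map_smul]) (by rw [← hφ, ht.hf, map_smul]) (by rw [← hφ, ht.ef])
    (Pi.basisFun ℂ (Fin 27)) (fun j => ?_) ?_ hm c)
  · rw [hw, (ht.rep_int hn hφ hw j).1]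
  · intro i j _ hij
    obtain ⟨k, hk, hd, h⟩ := weightDeg_mono _ φ hφ hw hn (δ := 2) (x := e)
      (by rw [ht.he]; norm_num) hij z
    have := (hz k hk).1 hd
    omega

theorem not_coweightObstructed {m c : ℤ} (hm : 1 ≤ m) (z : ℕ → ℤ) :
    ¬ CoweightObstructed n m c z := by
  rintro ⟨hz, h⟩
  refine h.not_ge (Sl2.count_le (H := -φ (toral a)) (E := φ f) (F := φ e) ?_ ?_ ?_
    (Pi.basisFun ℂ (Fin 27)) (fun j => ?_) ?_ hm c)
  · simpa using neg_commutator (c := -2) (by rw [← hφ, ht.hf, map_smul])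
  · exact neg_commutator (by rw [← hφ, ht.he, map_smul])
  · rw [← neg_sub, ← hφ, ht.ef]
  · rw [LinearMap.neg_apply, hw, (ht.rep_int hn hφ hw j).1, ← neg_smul]
    push_cast
    rfl
  · intro i j _ hij
    obtain ⟨k, hk, hd, h⟩ := weightDeg_mono _ φ hφ hw hn (δ := -2) (x := f)
      (by rw [ht.hf]; norm_num) hij z
    have := (hz k hk).2 hd
    omega

end

theorem weightDeg_mod_three : weightDeg n 0 % 3 = 0 := by
  obtain ⟨φ, hφ, hw⟩ := exists_weight_rep
  exact (ht.rep_int hn hφ hw 0).2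

theorem not_somewhereObstructed : ¬ SomewhereObstructed n := by
  obtain ⟨φ, hφ, hw⟩ := exists_weight_rep
  have hrows : ∀ p ∈ ([(5, 1, 1365), (4, 1, 1365), (8, 0, 549), (4, 0, 2193)] : List (ℤ × ℤ × ℕ)),
      1 ≤ p.1 := by decide
  have hrows1 : ∀ p ∈ ([(1, 1, 1365), (2, 1, 1365), (1, -1, 405), (1, -1, 345), (2, 0, 597)] :
      List (ℤ × ℤ × ℕ)),
      1 ≤ p.1 := by decide
  have hrows2 : ∀ p ∈ ([(1, 1, 1365), (2, 1, 1365)] : List (ℤ × ℤ × ℕ)),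
      1 ≤ p.1 := by decide
  rintro (⟨p, hp, h⟩ | ⟨p, hp, h⟩ | ⟨p, hp, h⟩)
  · refine ht.not_rootObstructed hn (hrows _ hp) _ h
  · refine ht.not_weightObstructed hn hφ hw (hrows1 _ hp) _ h
  · refine ht.not_coweightObstructed hn hφ hw (hrows2 _ hp) _ h

end IsTriple

theorem labels_add : ∀ c < 64, ∀ c' < 64, ∀ j < 6, labels (64 * c + c') j =
    ([c' / 1 % 4, c' / 4 % 4, c' / 16 % 4, c / 1 % 4, c / 4 % 4, c / 16 % 4].getD j 0 : ℕ) := by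
  decide +kernel

theorem exists_labels {n : ℕ → ℤ} (hn : ∀ j < 6, 0 ≤ n j ∧ n j ≤ 2) :
    ∃ c < 64, ∃ c' < 64, ∀ j < 6, n j = labels (64 * c + c') j := by
  have h0 := hn 0 (by norm_num)
  have h1 := hn 1 (by norm_num)
  have h2 := hn 2 (by norm_num)
  have h3 := hn 3 (by norm_num)
  have h4 := hn 4 (by norm_num)
  have h5 := hn 5 (by norm_num)
  refine ⟨(n 5 * 16 + n 4 * 4 + n 3).toNat, by omega, (n 2 * 16 + n 1 * 4 + n 0).toNat, by omega,
    fun j hj => ?_⟩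
  rw [labels_add _ (by omega) _ (by omega) j hj]
  interval_cases j <;> simp only [List.getD_cons_zero, List.getD_cons_succ] <;> omega

end E6

/-! ### Reachable elements -/

namespace E6

open Module

/-- The homogeneous components of the centralizer of `e`. -/
noncomputable def piece (h e : LieAlgebra.e₆ ℂ) (μ : ℂ) : Submodule ℂ (LieAlgebra.e₆ ℂ) :=
  centralizer e ⊓ (adj h).eigenspace μ

theorem mem_centralizer {e x : LieAlgebra.e₆ ℂ} : x ∈ centralizer e ↔ ⁅e, x⁆ = 0 := by
  rw [centralizer, LinearMap.mem_ker, LieAlgebra.ad_apply]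

theorem mem_eigenspace {h x : LieAlgebra.e₆ ℂ} {μ : ℂ} :
    x ∈ (adj h).eigenspace μ ↔ ⁅h, x⁆ = μ • x := Module.End.mem_eigenspace_iff

theorem mem_piece {h e x : LieAlgebra.e₆ ℂ} {μ : ℂ} :
    x ∈ piece h e μ ↔ ⁅e, x⁆ = 0 ∧ ⁅h, x⁆ = μ • x := by
  rw [piece, Submodule.mem_inf, mem_centralizer, mem_eigenspace]

theorem lie_mem_eigenspace {h x y : LieAlgebra.e₆ ℂ} {μ ν : ℂ} (hx : x ∈ (adj h).eigenspace μ)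
    (hy : y ∈ (adj h).eigenspace ν) : ⁅x, y⁆ ∈ (adj h).eigenspace (μ + ν) := by
  rw [mem_eigenspace] at *
  rw [leibniz_lie, hx, hy, smul_lie, lie_smul, add_smul]

theorem lie_mem_centralizer {e x y : LieAlgebra.e₆ ℂ} (hx : x ∈ centralizer e)
    (hy : y ∈ centralizer e) : ⁅x, y⁆ ∈ centralizer e := by
  rw [mem_centralizer] at *
  rw [leibniz_lie, hx, hy, zero_lie, lie_zero, add_zero]

/-- The elements of weight `1` in the centralizer. -/
def firstPiece (h e : LieAlgebra.e₆ ℂ) : Set (LieAlgebra.e₆ ℂ) := {x | ⁅e, x⁆ = 0 ∧ ⁅h, x⁆ = x}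

namespace IsTriple

variable {h e f : LieAlgebra.e₆ ℂ} (ht : IsTriple h e f)

include ht

theorem lie_mem {x : LieAlgebra.e₆ ℂ} (hx : x ∈ centralizer e) : ⁅h, x⁆ ∈ centralizer e := by
  rw [mem_centralizer] at *
  rw [leibniz_lie, hx, lie_zero, add_zero, ← lie_skew e h, ht.he, neg_lie, smul_lie, hx, smul_zero,
    neg_zero]

theorem lie_mem_derived {z : LieAlgebra.e₆ ℂ} (hz : z ∈ derived e) : ⁅h, z⁆ ∈ derived e := by
  have : derived e ≤ (derived e).comap (adj h) := by
    refine Submodule.span_le.mpr ?_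
    rintro _ ⟨x, hx, y, hy, rfl⟩
    change ⁅h, ⁅x, y⁆⁆ ∈ derived e
    rw [leibniz_lie]
    exact add_mem (Submodule.subset_span ⟨_, ht.lie_mem hx, y, hy, rfl⟩)
      (Submodule.subset_span ⟨x, hx, _, ht.lie_mem hy, rfl⟩)
  exact this hz

/-- The sums of an element of weight `1` and an element of the derived subalgebra. -/
noncomputable def firstPieceAddDerived (_ : IsTriple h e f) :
    LieSubalgebra ℂ (LieAlgebra.e₆ ℂ) where
  toSubmodule := centralizer e ⊓ ((adj h).eigenspace 1 ⊔ derived e)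
  lie_mem' {x y} hx hy := ⟨lie_mem_centralizer hx.1 hy.1,
    Submodule.mem_sup_right (Submodule.subset_span ⟨x, hx.1, y, hy.1, rfl⟩)⟩

theorem mem_derived_of_mem_lieSpan
    (he : e ∈ LieSubalgebra.lieSpan ℂ (LieAlgebra.e₆ ℂ) (firstPiece h e)) : e ∈ derived e := by
  have h1 : LieSubalgebra.lieSpan ℂ _ (firstPiece h e) ≤ ht.firstPieceAddDerived :=
    LieSubalgebra.lieSpan_le.mpr fun x hx =>
      ⟨mem_centralizer.mpr hx.1, Submodule.mem_sup_left (mem_eigenspace.mpr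
        (by rw [hx.2, one_smul]))⟩
  obtain ⟨x, hx, z, hz, hxz⟩ := Submodule.mem_sup.mp (h1 he).2
  rw [mem_eigenspace, one_smul] at hx
  have h2 := ht.he
  rw [← hxz, lie_add, hx] at h2
  have h3 : e = ⁅h, z⁆ - z := by
    rw [← hxz, eq_sub_iff_add_eq, ← add_right_inj x, h2]
    module
  exact Set.mem_of_eq_of_mem h3 (sub_mem (ht.lie_mem_derived hz) hz)

theorem centralizer_eq : centralizer e = ⨆ μ, piece h e μ := by
  have := Submodule.inf_iSup_genEigenspace (p := centralizer e) (f := adj h)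
    (fun x hx => ht.lie_mem hx) 1
  refine Eq.trans ?_ this
  exact (inf_eq_left.mpr (le_top.trans_eq
    (Sl2.iSup_eigenspace ht.adj_he ht.adj_hf ht.adj_ef).symm)).symm

theorem piece_nat {x : LieAlgebra.e₆ ℂ} {μ : ℂ} (hx : x ∈ piece h e μ) (h0 : x ≠ 0) :
    ∃ n : ℕ, μ = n :=
  Sl2.primitive_weight ht.adj_hf ht.adj_ef h0 (mem_piece.mp hx).2 (mem_piece.mp hx).1

theorem apply_eq_zero (ψ : LieAlgebra.e₆ ℂ →ₗ[ℂ] ℂ)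
    (h02 : ∀ x ∈ piece h e 0, ∀ y ∈ piece h e 2, ψ ⁅x, y⁆ = 0)
    (h11 : ∀ x ∈ piece h e 1, ∀ y ∈ piece h e 1, ψ ⁅x, y⁆ = 0) (he : e ∈ derived e) : ψ e = 0 := by
  set W := LinearMap.ker ψ ⊓ (adj h).eigenspace 2
  set B := ⨆ μ, ⨆ (_ : μ ≠ 2), (adj h).eigenspace μ
  have hB : ∀ μ, ∀ x ∈ piece h e μ, ∀ ν, ∀ y ∈ piece h e ν, ⁅x, y⁆ ∈ W ⊔ B := by
    intro μ x hx ν y hy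
    have hxy := lie_mem_eigenspace hx.2 hy.2
    by_cases hμν : μ + ν = 2
    · rcases eq_or_ne x 0 with rfl | hx0
      · simp
      rcases eq_or_ne y 0 with rfl | hy0
      · simp
      obtain ⟨m, rfl⟩ := ht.piece_nat hx hx0
      obtain ⟨n, rfl⟩ := ht.piece_nat hy hy0
      refine Submodule.mem_sup_left ⟨?_, hμν ▸ hxy⟩
      have hmn : m + n = 2 := by exact_mod_cast hμν
      obtain ⟨rfl, rfl⟩ | ⟨rfl, rfl⟩ | ⟨rfl, rfl⟩ :
        m = 0 ∧ n = 2 ∨ m = 1 ∧ n = 1 ∨ m = 2 ∧ n = 0 := by omega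
      · exact h02 x (by simpa using hx) y (by simpa using hy)
      · exact h11 x (by simpa using hx) y (by simpa using hy)
      · change ψ ⁅x, y⁆ = 0
        rw [← lie_skew, map_neg, neg_eq_zero]
        exact h02 y (by simpa using hy) x (by simpa using hx)
    · exact Submodule.mem_sup_right
        (Submodule.mem_iSup_of_mem _ (Submodule.mem_iSup_of_mem hμν hxy))
  have hd : derived e ≤ W ⊔ B := by
    refine Submodule.span_le.mpr ?_
    rintro _ ⟨x, hx, y, hy, rfl⟩
    rw [ht.centralizer_eq] at hx hy
    induction hx using Submodule.iSup_induction' with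
    | mem μ x hx =>
      induction hy using Submodule.iSup_induction' with
      | mem ν y hy => exact hB μ x hx ν y hy
      | zero => simp
      | add y y' _ _ h1 h2 =>
        rw [lie_add]
        exact add_mem h1 h2
    | zero => simp
    | add x x' _ _ h1 h2 =>
      rw [add_lie]
      exact add_mem h1 h2
  obtain ⟨w, hw, b, hb, hwb⟩ := Submodule.mem_sup.mp (hd he)
  have hb2 : b ∈ (adj h).eigenspace 2 := by
    rw [← add_sub_cancel_left w b, hwb]
    exact sub_mem (mem_eigenspace.mpr ht.he) hw.2
  have hb0 := ((adj h).eigenspaces_iSupIndep 2).le_bot ⟨hb2, hb⟩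
  rw [← hwb, hb0, add_zero]
  exact hw.1

end IsTriple

theorem killing_toral {a : ℕ → ℂ} {n : ℕ → ℤ} (hn : ∀ j < 6, label a j = n j) :
    LieModule.traceForm ℂ (LieAlgebra.e₆ ℂ) (LieAlgebra.e₆ ℂ) (toral a) (toral a) =
      ((∑ k : Fin 78, deg n k ^ 2 : ℤ) : ℂ) := by
  rw [LieModule.traceForm_apply_apply, LinearMap.trace_eq_matrix_trace ℂ chevalleyBasis,
    Matrix.trace, Int.cast_sum]
  refine Finset.sum_congr rfl fun k _ => ?_
  rw [Matrix.diag_apply, LinearMap.toMatrix_apply]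
  change chevalleyBasis.repr ⁅toral a, ⁅toral a, chevalleyBasis k⁆⁆ k = _
  rw [repr_lie_toral, repr_lie_toral, degree_label_eq hn, Basis.repr_self, Finsupp.single_eq_same]
  push_cast
  ring

namespace IsTriple

variable {a : ℕ → ℂ} {n : ℕ → ℤ} {e f : LieAlgebra.e₆ ℂ}
variable (ht : IsTriple (toral a) e f) (hn : ∀ j < 6, label a j = n j)

include ht hn

theorem eq_zero_of_narrow (hN : Narrow n) (he : e ∈ derived e) : e = 0 := by
  set κ := LieModule.traceForm ℂ (LieAlgebra.e₆ ℂ) (LieAlgebra.e₆ ℂ)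
  have h1 : ∀ y ∈ piece (toral a) e 1, y = 0 := fun y hy => by
    rw [mem_piece] at hy
    refine Sl2.eq_zero_of_count_le (H := adj (toral a)) (E := adj e) (F := adj f) (D := deg n)
      ht.adj_he ht.adj_hf ht.adj_ef chevalleyBasis (fun j => ?_) (m := 3) (by norm_num) hN ?_ hy.1
    · rw [chevalleyBasis_apply, ← degree_label_eq hn]
      exact lie_toral a j.2
    · exact hy.2.trans (by norm_num)
  have h0 : ∀ x ∈ piece (toral a) e 0, ⁅x, f⁆ = 0 := fun x hx => by
    rw [mem_piece, zero_smul] at hx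
    by_contra h
    have h2 : ⁅toral a, ⁅x, f⁆⁆ = (-2 : ℂ) • ⁅x, f⁆ := by
      rw [leibniz_lie, hx.2, zero_lie, zero_add, ht.hf, lie_smul]
    obtain ⟨m, hm⟩ := ht.piece_nat (x := ⁅x, f⁆) (mem_piece.mpr ⟨by
      rw [leibniz_lie, hx.1, zero_lie, zero_add, ht.ef, ← lie_skew, hx.2, neg_zero], h2⟩) h
    have : ((m + 2 : ℕ) : ℂ) = 0 := by push_cast; rw [← hm]; norm_num
    exact absurd (Nat.cast_eq_zero.mp this) (by omega)
  have hκ : κ e f = 0 := by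
    refine ht.apply_eq_zero (κ.flip f) (fun x hx y _ => ?_) (fun x hx y _ => ?_) he
    · change κ ⁅x, y⁆ f = 0
      rw [← lie_skew, map_neg, LinearMap.neg_apply,
        LieModule.traceForm_apply_lie_apply, h0 x hx, map_zero, neg_zero]
    · rw [h1 x hx, zero_lie, map_zero]
  have h2 : κ (toral a) (toral a) = 0 := by
    rw [← ht.ef, ← LieModule.traceForm_apply_lie_apply, ht.ef, ht.he, map_smul,
      LinearMap.smul_apply, hκ, smul_zero]
  rw [killing_toral hn, Int.cast_eq_zero, Finset.sum_eq_zero_iff_of_nonneg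
    fun _ _ => sq_nonneg _] at h2
  have h3 : ∀ j < 6, label a j = 0 := fun j hj => by
    have := h2 ⟨j, by omega⟩ (Finset.mem_univ _)
    rw [← degree_simple (label a) hj, degree_label_eq hn, pow_eq_zero_iff two_ne_zero |>.mp this,
      Int.cast_zero]
  have h4 : toral a = 0 := by
    have := eq_zero_of_label h3
    simp [toral, this 0 (by norm_num), this 1 (by norm_num), this 2 (by norm_num),
      this 3 (by norm_num), this 4 (by norm_num), this 5 (by norm_num)]
  have h5 := ht.he
  rw [h4, zero_lie] at h5
  exact (smul_eq_zero.mp h5.symm).resolve_left two_ne_zero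

end IsTriple

/-- If `e` is reachable then the part of its centralizer of positive weight is generated in
weight `1`. -/
def ReachableGenerated (h e : LieAlgebra.e₆ ℂ) : Prop :=
  e ∈ derived e → ∀ k : ℤ, 1 ≤ k → ∀ x : LieAlgebra.e₆ ℂ, ⁅e, x⁆ = 0 → ⁅h, x⁆ = (k : ℂ) • x →
    x ∈ LieSubalgebra.lieSpan ℂ (LieAlgebra.e₆ ℂ) (firstPiece h e)

theorem reachableGenerated_zero {h f : LieAlgebra.e₆ ℂ} (ht : IsTriple h 0 f) :
    ReachableGenerated h 0 := by
  intro _ k hk x _ hx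
  rw [← ht.ef, zero_lie, zero_lie] at hx
  rw [(smul_eq_zero.mp hx.symm).resolve_left (by norm_cast; omega)]
  exact zero_mem _

theorem ReachableGenerated.of_map {h e : LieAlgebra.e₆ ℂ}
    (φ : LieAlgebra.e₆ ℂ ≃ₗ⁅ℂ⁆ LieAlgebra.e₆ ℂ) (H : ReachableGenerated (φ h) (φ e)) :
    ReachableGenerated h e := by
  intro he k hk x hx hhx
  have h1 : derived e ≤ (derived (φ e)).comap (φ : LieAlgebra.e₆ ℂ →ₗ[ℂ] LieAlgebra.e₆ ℂ) := by
    refine Submodule.span_le.mpr ?_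
    rintro _ ⟨x, hx, y, hy, rfl⟩
    rw [mem_centralizer] at hx hy
    refine Submodule.subset_span ⟨φ x, ?_, φ y, ?_, (LieEquiv.map_lie φ x y).symm⟩
    · rw [mem_centralizer, ← LieEquiv.map_lie, hx, map_zero]
    · rw [mem_centralizer, ← LieEquiv.map_lie, hy, map_zero]
  have h2 := H (h1 he) k hk (φ x) (by rw [← LieEquiv.map_lie, hx, map_zero])
    (by rw [← LieEquiv.map_lie, hhx, map_smul])
  have h3 : LieSubalgebra.lieSpan ℂ _ (firstPiece (φ h) (φ e)) ≤
      (LieSubalgebra.lieSpan ℂ _ (firstPiece h e)).comap φ.symm.toLieHom := by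
    refine LieSubalgebra.lieSpan_le.mpr fun y hy => LieSubalgebra.subset_lieSpan ⟨?_, ?_⟩
    · change ⁅e, φ.symm y⁆ = 0
      rw [← φ.symm_apply_apply e, ← LieEquiv.map_lie, hy.1, map_zero]
    · change ⁅h, φ.symm y⁆ = φ.symm y
      rw [← φ.symm_apply_apply h, ← LieEquiv.map_lie, hy.2]
  have h4 : φ.symm (φ x) ∈ LieSubalgebra.lieSpan ℂ _ (firstPiece h e) := h3 h2
  rwa [φ.symm_apply_apply] at h4

theorem IsTriple.exists_characteristic {h e f : LieAlgebra.e₆ ℂ} (ht : IsTriple h e f) :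
    ∃ (φ : LieAlgebra.e₆ ℂ ≃ₗ⁅ℂ⁆ LieAlgebra.e₆ ℂ) (a : ℕ → ℂ) (c : ℕ), φ h = toral a ∧
      (∀ j < 6, label a j = labels c j) ∧
      (Narrow (labels c) ∨ c ∈ [4, 64, 272, 1025, 1029, 1089, 276, 1301, 1305]) := by
  obtain ⟨φ, a, n, hφ, hn, hn2⟩ := ht.exists_dominant
  obtain ⟨c, hc, c', hc', hcn⟩ := exists_labels hn2
  have hn' : ∀ j < 6, label a j = labels (64 * c + c') j := fun j hj => by rw [hn j hj, hcn j hj]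
  have ht' := hφ ▸ ht.map φ
  refine ⟨φ, a, 64 * c + c', hφ, hn', ?_⟩
  rcases characteristic_cases c hc c' hc' (fun j hj => hcn j hj ▸ (hn2 j hj).2)
    (ht'.weightDeg_mod_three hn') with h | h | h
  · exact .inl h
  · exact .inr h
  · exact absurd h (ht'.not_somewhereObstructed hn')

end E6

/-! ### Standard triples -/

namespace E6

open Module

/-- The formal combination only involves basis elements. -/
def Bounded (l : List (ℕ × ℤ)) : Prop := ∀ p ∈ l, p.1 < 78

namespace Bounded

theorem append {l l' : List (ℕ × ℤ)} (h : Bounded l) (h' : Bounded l') : Bounded (l ++ l') :=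
  fun p hp => (List.mem_append.mp hp).elim (h p) (h' p)

theorem scale {l : List (ℕ × ℤ)} (h : Bounded l) (c : ℤ) : Bounded (scale c l) := by
  intro p hp
  obtain ⟨q, hq, rfl⟩ := List.mem_map.mp hp
  exact h q hq

theorem act {l : List (ℕ × ℤ)} (h : Bounded l) {t : ℕ} (ht : t < 78) : Bounded (act t l) := by
  induction l with
  | nil => simp [Bounded, E6.act]
  | cons p l ih =>
    exact (Bounded.scale (Chevalley.table_lt t ht p.1 (h p (by simp))) _).append
      (ih fun q hq => h q (by simp [hq]))

theorem bracket {l l' : List (ℕ × ℤ)} (h : Bounded l) (h' : Bounded l') :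
    Bounded (bracket l l') := by
  induction l with
  | nil => simp [Bounded, E6.bracket]
  | cons p l ih =>
    exact ((h'.act (h p (by simp))).scale _).append (ih fun q hq => h q (by simp [hq]))

theorem insertTerm {k : ℕ} (hk : k < 78) (c : ℤ) {l : List (ℕ × ℤ)} (h : Bounded l) :
    Bounded (insertTerm k c l) := by
  induction l with
  | nil =>
    intro p hp
    rw [E6.insertTerm, List.mem_singleton] at hp
    rwa [hp]
  | cons q l ih =>
    have hl : Bounded l := fun p hp => h p (by simp [hp])
    have ih' := ih hl
    intro p hp
    rw [E6.insertTerm] at hp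
    cases h1 : k.blt q.1 <;> rw [h1] at hp
    · cases h2 : k.beq q.1 <;> rw [h2] at hp
      · rcases List.mem_cons.mp hp with rfl | hp
        · exact h p (by simp)
        · exact ih' p hp
      · cases h3 : (c + q.2 == 0) <;> rw [h3] at hp
        · rcases List.mem_cons.mp hp with rfl | hp
          · exact hk
          · exact hl p hp
        · exact hl p hp
    · rcases List.mem_cons.mp hp with rfl | hp
      · exact hk
      · exact h p hp

theorem normalize {l : List (ℕ × ℤ)} (h : Bounded l) : Bounded (normalize l) := by
  induction l with
  | nil => simp [Bounded, E6.normalize]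
  | cons p l ih =>
    have hl : Bounded (E6.normalize l) := ih fun q hq => h q (by simp [hq])
    rw [E6.normalize]
    cases p.2 == 0
    · exact hl.insertTerm (h p (by simp)) _
    · exact hl

end Bounded

theorem ev_bracket {l l' : List (ℕ × ℤ)} (h : Bounded l) (h' : Bounded l') :
    ev rootVec (bracket l l') = ⁅ev rootVec l, ev rootVec l'⁆ :=
  (ev_lie_ev fun _ hp _ hq => lie_rootVec (h _ hp) (h' _ hq)).symm

theorem toral_congr {a b : ℕ → ℂ} (h : ∀ j < 6, label a j = label b j) : toral a = toral b := by
  have h1 : ∀ j < 6, label (a - b) j = 0 := fun j hj => by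
    rw [← sub_eq_zero.mpr (h j hj)]
    simp only [label, Pi.sub_apply]
    ring
  have h2 : ∀ i < 6, a i = b i := fun i hi => sub_eq_zero.mp (eq_zero_of_label h1 i hi)
  simp only [toral, h2 0 (by norm_num), h2 1 (by norm_num), h2 2 (by norm_num),
    h2 3 (by norm_num), h2 4 (by norm_num), h2 5 (by norm_num)]

/-- The formal combinations represent a triple, where the first member is given by its coroot
coordinates, whose labels are given. -/
def Standard (n : ℕ → ℤ) (t : ℕ → ℤ) (l l' : List (ℕ × ℤ)) : Prop :=
  (∀ p ∈ l, p.1 < 78 ∧ deg n p.1 = 2) ∧ (∀ p ∈ l', p.1 < 78 ∧ deg n p.1 = -2) ∧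
  isZero (bracket l l' ++ scale (-1)
    [(72, t 0), (73, t 1), (74, t 2), (75, t 3), (76, t 4), (77, t 5)]) = true ∧
  ∀ j < 6, cartan 0 j * t 0 + cartan 1 j * t 1 + cartan 2 j * t 2 + cartan 3 j * t 3 +
    cartan 4 j * t 4 + cartan 5 j * t 5 = n j

instance (n t : ℕ → ℤ) (l l' : List (ℕ × ℤ)) : Decidable (Standard n t l l') :=
  inferInstanceAs (Decidable (_ ∧ _ ∧ _ ∧ _))

namespace Standard

variable {n t : ℕ → ℤ} {l l' : List (ℕ × ℤ)} (hs : Standard n t l l') {a : ℕ → ℂ}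

include hs

theorem bounded : Bounded l := fun p hp => (hs.1 p hp).1

theorem bounded' : Bounded l' := fun p hp => (hs.2.1 p hp).1

theorem isTriple (hn : ∀ j < 6, label a j = n j) :
    IsTriple (toral a) (ev rootVec l) (ev rootVec l') where
  he := by
    refine mem_eigenspace.mp (ev_mem _ fun p hp => mem_eigenspace.mpr ?_)
    rw [lie_toral a (hs.1 p hp).1, degree_label_eq hn, (hs.1 p hp).2]
    norm_num
  hf := by
    refine mem_eigenspace.mp (ev_mem _ fun p hp => mem_eigenspace.mpr ?_)
    rw [lie_toral a (hs.2.1 p hp).1, degree_label_eq hn, (hs.2.1 p hp).2]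
    norm_num
  ef := by
    rw [← ev_bracket hs.bounded hs.bounded', ev_eq_of_isZero rootVec hs.2.2.1]
    have h : toral a = toral fun i => t i := toral_congr fun j hj => by
      rw [hn j hj, ← hs.2.2.2 j hj, label]
      push_cast
      rfl
    have h' : ∀ i, rootVec (72 + i) = genH i := fun i => by rw [add_comm, rootVec_coroot]
    rw [h, toral]
    simp only [ev, ← Int.cast_smul_eq_zsmul ℂ, h' 1, h' 2, h' 3, h' 4, h' 5, h' 0]
    module

end Standard

namespace IsTriple

theorem exists_lie_eq {h e f : LieAlgebra.e₆ ℂ} (ht : IsTriple h e f) {w : LieAlgebra.e₆ ℂ}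
    (hw : w ∈ (adj h).eigenspace 2) : ∃ x : LieAlgebra.e₆ ℂ, ⁅h, x⁆ = 0 ∧ ⁅x, e⁆ = w := by
  obtain ⟨x, hx, hx'⟩ := Sl2.raise_surjective ht.adj_he ht.adj_hf ht.adj_ef (m := 2) (y := w)
    (by norm_num) ((mem_eigenspace.mp hw).trans (by norm_num))
  refine ⟨-x, ?_, ?_⟩
  · have : ⁅h, x⁆ = 0 := hx.trans (by norm_num)
    rw [lie_neg, this, neg_zero]
  · rw [neg_lie, lie_skew]
    exact hx'

theorem exists_conj {h e f e' f' : LieAlgebra.e₆ ℂ} (ht : IsTriple h e f)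
    (ht' : IsTriple h e' f') : ∃ φ : LieAlgebra.e₆ ℂ ≃ₗ⁅ℂ⁆ LieAlgebra.e₆ ℂ, φ h = h ∧ φ e = e' := by
  refine LieExp.exists_conj_of_lie_eq (G := (adj h).eigenspace 2)
    (B := ⨆ μ, ⨆ (_ : μ ≠ 2), (adj h).eigenspace μ) (fun x hx w hw => ?_)
    ((adj h).eigenspaces_iSupIndep 2) (fun w => ?_) (mem_eigenspace.mpr ht.he)
    (mem_eigenspace.mpr ht'.he) (fun w hw => ht.exists_lie_eq hw) fun w hw => ht'.exists_lie_eq hw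
  · rw [← zero_add (2 : ℂ)]
    exact lie_mem_eigenspace (mem_eigenspace.mpr (by rw [hx, zero_smul])) hw
  · have hw : w ∈ ⨆ μ, (adj h).eigenspace μ := by
      rw [Sl2.iSup_eigenspace ht.adj_he ht.adj_hf ht.adj_ef]
      exact Submodule.mem_top
    have hle : ⨆ μ, (adj h).eigenspace μ ≤
        (adj h).eigenspace 2 ⊔ ⨆ μ, ⨆ (_ : μ ≠ 2), (adj h).eigenspace μ := by
      refine iSup_le fun μ => ?_
      by_cases hμ : μ = 2
      · exact hμ ▸ le_sup_left
      · exact le_sup_of_le_right (le_iSup₂_of_le μ hμ le_rfl)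
    obtain ⟨u, hu, b, hb, h⟩ := Submodule.mem_sup.mp (hle hw)
    exact ⟨u, hu, b, hb, h.symm⟩

end IsTriple

/-- The alternating sum `∑ cᵢ (ad f)ⁱ (ad e)ⁱ` applied to a formal combination. -/
def alternate (l l' : List (ℕ × ℤ)) : List ℤ → List (ℕ × ℤ) → List (ℕ × ℤ)
  | [], _ => []
  | c :: cs, x => normalize (scale c x ++ bracket l' (alternate l l' cs (normalize (bracket l x))))

/-- The operator `∑ cᵢ (ad f)ⁱ (ad e)ⁱ`. -/
noncomputable def alternating (e f : LieAlgebra.e₆ ℂ) : List ℤ → Module.End ℂ (LieAlgebra.e₆ ℂ)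
  | [] => 0
  | c :: cs => (c : ℂ) • 1 + adj f * (alternating e f cs * adj e)

theorem bounded_alternate {l l' : List (ℕ × ℤ)} (h : Bounded l) (h' : Bounded l') (cs : List ℤ)
    {x : List (ℕ × ℤ)} (hx : Bounded x) : Bounded (alternate l l' cs x) := by
  induction cs generalizing x with
  | nil => simp [Bounded, alternate]
  | cons c cs ih => exact ((hx.scale c).append (h'.bracket (ih (h.bracket hx).normalize))).normalize

theorem ev_alternate {l l' : List (ℕ × ℤ)} (h : Bounded l) (h' : Bounded l') (cs : List ℤ)
    {x : List (ℕ × ℤ)} (hx : Bounded x) : ev rootVec (alternate l l' cs x) =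
      alternating (ev rootVec l) (ev rootVec l') cs (ev rootVec x) := by
  induction cs generalizing x with
  | nil => rfl
  | cons c cs ih =>
    have hb := (h.bracket hx).normalize
    rw [alternate, ev_normalize, ev_append, ev_scale,
      ev_bracket h' (bounded_alternate h h' cs hb), ih hb, ev_normalize, ev_bracket h hx,
      alternating, ← Int.cast_smul_eq_zsmul ℂ]
    rfl

theorem alternating_apply {e x : LieAlgebra.e₆ ℂ} (hx : ⁅e, x⁆ = 0) (f : LieAlgebra.e₆ ℂ) (c : ℤ)
    (cs : List ℤ) : alternating e f (c :: cs) x = (c : ℂ) • x := by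
  have : adj e x = 0 := hx
  rw [alternating, LinearMap.add_apply, Module.End.mul_apply, Module.End.mul_apply, this, map_zero,
    map_zero, add_zero]
  rfl

/-- A multiple of the projection of a basis element onto the centralizer. -/
def project (n : ℕ → ℤ) (l l' : List (ℕ × ℤ)) (cs : List (ℤ × List ℤ)) (j : ℕ) : List (ℕ × ℤ) :=
  alternate l l' ((cs.getD (deg n j).toNat (1, [])).1 :: (cs.getD (deg n j).toNat (1, [])).2)
    [(j, 1)]

theorem mem_of_project {n t : ℕ → ℤ} {l l' : List (ℕ × ℤ)} (hs : Standard n t l l') {a : ℕ → ℂ}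
    (hn : ∀ j < 6, label a j = n j) {cs : List (ℤ × List ℤ)}
    (hcs : ∀ p ∈ cs, p.1 ≠ 0) {k : ℤ} {p : Submodule ℂ (LieAlgebra.e₆ ℂ)}
    (hp : ∀ j < 78, deg n j = k → ev rootVec (project n l l' cs j) ∈ p) {x : LieAlgebra.e₆ ℂ}
    (hx : x ∈ piece (toral a) (ev rootVec l) k) : x ∈ p := by
  obtain ⟨hex, hhx⟩ := mem_piece.mp hx
  set q := cs.getD k.toNat (1, []) with hq
  have hq0 : (q.1 : ℂ) ≠ 0 := by
    rw [Int.cast_ne_zero, hq, List.getD_eq_getElem?_getD]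
    rcases h : cs[k.toNat]? with _ | r
    · simp
    · exact hcs r (List.mem_of_getElem? h)
  have h1 := alternating_apply hex (ev rootVec l') q.1 q.2
  rw [← inv_smul_smul₀ hq0 x, ← h1, ← chevalleyBasis.sum_repr x, map_sum]
  refine p.smul_mem _ (p.sum_mem fun j _ => ?_)
  rw [map_smul]
  by_cases hj : deg n j = k
  · refine p.smul_mem _ ?_
    have h2 := hp j j.2 hj
    have hb : Bounded [((j : ℕ), (1 : ℤ))] := fun r hr => by
      rw [List.mem_singleton] at hr
      rw [hr]
      exact j.2
    rwa [project, hj, ev_alternate hs.bounded hs.bounded' _ hb, ev, ev, one_smul, add_zero,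
      ← chevalleyBasis_apply] at h2
  · rw [repr_eq_zero hn hhx (by rwa [degree_eq_deg]), zero_smul]
    exact p.zero_mem

end E6

/-! ### The nine remaining characteristics -/

namespace E6

/-- The sum of the brackets of projections with the given coefficients and indices. -/
def sumBrackets (b : ℕ → List (ℕ × ℤ)) : List (ℤ × ℕ × ℕ) → List (ℕ × ℤ)
  | [] => []
  | q :: qs => scale q.1 (bracket (b q.2.1) (b q.2.2)) ++ sumBrackets b qs

theorem ev_sumBrackets_mem {b : ℕ → List (ℕ × ℤ)} (hb : ∀ j < 78, Bounded (b j))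
    {S : LieSubalgebra ℂ (LieAlgebra.e₆ ℂ)} {qs : List (ℤ × ℕ × ℕ)}
    (hqs : ∀ q ∈ qs, (q.2.1 < 78 ∧ ev rootVec (b q.2.1) ∈ S) ∧
      q.2.2 < 78 ∧ ev rootVec (b q.2.2) ∈ S) : ev rootVec (sumBrackets b qs) ∈ S := by
  induction qs with
  | nil => exact zero_mem S
  | cons q qs ih =>
    obtain ⟨⟨h1, h1'⟩, h2, h2'⟩ := hqs q (by simp)
    rw [sumBrackets, ev_append, ev_scale, ev_bracket (hb _ h1) (hb _ h2)]
    exact add_mem (zsmul_mem (S.lie_mem h1' h2') _) (ih fun r hr => hqs r (by simp [hr]))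

/-- The centralizer is generated in weight `1`, as witnessed by expressions for multiples of the
projections as sums of brackets. -/
def GeneratedBy (n : ℕ → ℤ) (l l' : List (ℕ × ℤ)) (cs : List (ℤ × List ℤ))
    (ws : List (ℕ × ℤ × List (ℤ × ℕ × ℕ))) : Prop :=
  (∀ j < 78, deg n j = 1 → isZero (bracket l (project n l l' cs j)) = true ∧
    ∀ p ∈ project n l l' cs j, deg n p.1 = 1) ∧
  (∀ j < 78, 2 ≤ deg n j → j ∈ ws.map Prod.fst) ∧
  ∀ w ∈ ws, w.2.1 ≠ 0 ∧ (∀ q ∈ w.2.2, (q.2.1 < 78 ∧ deg n q.2.1 = 1) ∧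
    q.2.2 < 78 ∧ deg n q.2.2 = deg n w.1 - 1) ∧
    isZero (scale w.2.1 (project n l l' cs w.1) ++
      scale (-1) (sumBrackets (project n l l' cs) w.2.2)) = true

instance (n : ℕ → ℤ) (l l' : List (ℕ × ℤ)) (cs : List (ℤ × List ℤ))
    (ws : List (ℕ × ℤ × List (ℤ × ℕ × ℕ))) : Decidable (GeneratedBy n l l' cs ws) :=
  inferInstanceAs (Decidable (_ ∧ _ ∧ _))

/-- The functional does not vanish on `e`, but it does so on the brackets of weight `2` in the
centralizer. -/
def SeparatedBy (n : ℕ → ℤ) (l l' : List (ℕ × ℤ)) (cs : List (ℤ × List ℤ)) (v : ℕ → ℤ) : Prop :=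
  ev v l ≠ 0 ∧ ∀ i < 78, (deg n i = 0 ∨ deg n i = 1) → ∀ j < 78, deg n j = 2 - deg n i →
    ev v (bracket (project n l l' cs i) (project n l l' cs j)) = 0

instance (n : ℕ → ℤ) (l l' : List (ℕ × ℤ)) (cs : List (ℤ × List ℤ)) (v : ℕ → ℤ) :
    Decidable (SeparatedBy n l l' cs v) :=
  inferInstanceAs (Decidable (_ ∧ _))

theorem map_ev_rootVec {v : ℕ → ℤ} {ψ : LieAlgebra.e₆ ℂ →ₗ[ℂ] ℂ}
    (hψ : ∀ k < 78, ψ (rootVec k) = v k) {l : List (ℕ × ℤ)} (hl : Bounded l) :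
    ψ (ev rootVec l) = (ev v l : ℤ) := by
  induction l with
  | nil => simp [ev]
  | cons p l ih =>
    rw [ev, ev, map_add, map_zsmul, hψ _ (hl p (by simp)), ih fun q hq => hl q (by simp [hq])]
    simp

namespace Standard

variable {n t : ℕ → ℤ} {l l' : List (ℕ × ℤ)} (hs : Standard n t l l') {a : ℕ → ℂ}
  (hn : ∀ j < 6, label a j = n j) {cs : List (ℤ × List ℤ)} (hcs : ∀ p ∈ cs, p.1 ≠ 0)

include hs

theorem bounded_project (cs : List (ℤ × List ℤ)) {j : ℕ} (hj : j < 78) :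
    Bounded (project n l l' cs j) :=
  bounded_alternate hs.bounded hs.bounded' _ fun r hr => by
    rw [List.mem_singleton] at hr
    rwa [hr]

include hn hcs

theorem reachableGenerated_of_generatedBy {ws : List (ℕ × ℤ × List (ℤ × ℕ × ℕ))}
    (hw : GeneratedBy n l l' cs ws) : ReachableGenerated (toral a) (ev rootVec l) := by
  set S := LieSubalgebra.lieSpan ℂ (LieAlgebra.e₆ ℂ) (firstPiece (toral a) (ev rootVec l)) with hS
  obtain ⟨hw1, hw2, hw3⟩ := hw
  have h1 : ∀ j < 78, deg n j = 1 → ev rootVec (project n l l' cs j) ∈ S := fun j hj hdj => by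
    obtain ⟨h1, h2⟩ := hw1 j hj hdj
    have hb := hs.bounded_project cs hj
    refine LieSubalgebra.subset_lieSpan ⟨?_, ?_⟩
    · rw [← ev_bracket hs.bounded hb, ev_eq_zero rootVec h1]
    · refine (mem_eigenspace.mp (ev_mem ((adj (toral a)).eigenspace 1) fun p hp =>
        mem_eigenspace.mpr ?_)).trans (one_smul _ _)
      rw [lie_toral a (hb p hp), degree_label_eq hn, h2 p hp, Int.cast_one]
  have key : ∀ m : ℕ, ∀ j < 78, deg n j = m + 1 → ev rootVec (project n l l' cs j) ∈ S := by
    intro m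
    induction m with
    | zero => exact fun j hj hdj => h1 j hj (by simpa using hdj)
    | succ m ih =>
      intro j hj hdj
      obtain ⟨w, hw, rfl⟩ := List.mem_map.mp (hw2 j hj (by omega))
      obtain ⟨h0, hq, hz⟩ := hw3 w hw
      have h0' : (w.2.1 : ℂ) ≠ 0 := Int.cast_ne_zero.mpr h0
      have h3 := ev_sumBrackets_mem (S := S) (fun j hj => hs.bounded_project cs hj) (qs := w.2.2)
        fun q hqm => by
          obtain ⟨⟨h4, h4'⟩, h5, h5'⟩ := hq q hqm
          exact ⟨⟨h4, h1 _ h4 h4'⟩, h5, ih _ h5 (by rw [h5', hdj]; push_cast; ring)⟩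
      rw [← ev_eq_of_isZero rootVec hz, ev_scale, ← Int.cast_smul_eq_zsmul ℂ] at h3
      rw [← inv_smul_smul₀ h0' (ev rootVec (project n l l' cs w.1))]
      exact S.smul_mem _ h3
  intro _ k hk x hx hhx
  obtain ⟨m, rfl⟩ : ∃ m : ℕ, k = m + 1 := ⟨(k - 1).toNat, by omega⟩
  exact mem_of_project hs hn hcs (p := S.toSubmodule) (key m) (mem_piece.mpr ⟨hx, hhx⟩)

theorem reachableGenerated_of_separatedBy {v : ℕ → ℤ} (hv : SeparatedBy n l l' cs v) :
    ReachableGenerated (toral a) (ev rootVec l) := by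
  intro he
  exfalso
  set ψ : LieAlgebra.e₆ ℂ →ₗ[ℂ] ℂ := chevalleyBasis.constr ℂ fun k : Fin 78 => (v k : ℂ) with hψ
  have h1 : ∀ k < 78, ψ (rootVec k) = v k := fun k hk => by
    have := chevalleyBasis.constr_basis ℂ (fun k : Fin 78 => (v k : ℂ)) ⟨k, hk⟩
    rwa [chevalleyBasis_apply] at this
  have key : ∀ μ : ℤ, (μ = 0 ∨ μ = 1) → ∀ x ∈ piece (toral a) (ev rootVec l) μ,
      ∀ y ∈ piece (toral a) (ev rootVec l) ((2 - μ : ℤ) : ℂ), ψ ⁅x, y⁆ = 0 := by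
    intro μ hμ x hx y hy
    let β : LieAlgebra.e₆ ℂ →ₗ[ℂ] LieAlgebra.e₆ ℂ →ₗ[ℂ] ℂ :=
      (LieModule.toEnd ℂ (LieAlgebra.e₆ ℂ) (LieAlgebra.e₆ ℂ) : _ →ₗ[ℂ] _).compr₂ ψ
    refine mem_of_project hs hn hcs (p := LinearMap.ker (β.flip y)) (fun i hi hdi => ?_) hx
    refine mem_of_project hs hn hcs (p := LinearMap.ker (β (ev rootVec (project n l l' cs i))))
      (fun j hj hdj => ?_) hy
    change ψ ⁅ev rootVec (project n l l' cs i), ev rootVec (project n l l' cs j)⁆ = 0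
    have hbi := hs.bounded_project cs hi
    have hbj := hs.bounded_project cs hj
    rw [← ev_bracket hbi hbj, map_ev_rootVec h1 (hbi.bracket hbj),
      hv.2 i hi (hdi ▸ hμ) j hj (by rw [hdi, hdj]), Int.cast_zero]
  have h2 := (hs.isTriple hn).apply_eq_zero ψ
    (fun x hx y hy => key 0 (.inl rfl) x (by simpa using hx) y (by simpa using hy))
    (fun x hx y hy => key 1 (.inr rfl) x (by simpa using hx) y (by norm_num; exact hy)) he
  rw [map_ev_rootVec h1 hs.bounded, Int.cast_eq_zero] at h2
  exact hv.1 h2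

end Standard

theorem IsTriple.reachableGenerated_of_standard {n t : ℕ → ℤ} {l l' : List (ℕ × ℤ)} {a : ℕ → ℂ}
    {e f : LieAlgebra.e₆ ℂ} (ht : IsTriple (toral a) e f) (hs : Standard n t l l')
    (hn : ∀ j < 6, label a j = n j) (H : ReachableGenerated (toral a) (ev rootVec l)) :
    ReachableGenerated (toral a) e := by
  obtain ⟨φ, hφ, hφ'⟩ := ht.exists_conj (hs.isTriple hn)
  exact .of_map φ (by rwa [hφ, hφ'])

section

variable {a : ℕ → ℂ} {e f : LieAlgebra.e₆ ℂ}

theorem reachableGenerated_A1 (hn : ∀ j < 6, label a j = labels 4 j)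
    (ht : IsTriple (toral a) e f) : ReachableGenerated (toral a) e := by
  have hs : Standard (labels 4) (fun i => ([1, 2, 2, 3, 2, 1] : List ℤ).getD i 0)
      [(35, 1)]
      [(71, -1)] := by decide +kernel
  refine ht.reachableGenerated_of_standard hs hn (hs.reachableGenerated_of_generatedBy hn
    (cs := [(2, [-1]), (1, []), (1, [])]) ?_
    (ws := [(35, 1, [(1, 1, 34)])]) ?_) <;> decide +kernel

theorem reachableGenerated_twoA1 (hn : ∀ j < 6, label a j = labels 1025 j)
    (ht : IsTriple (toral a) e f) : ReachableGenerated (toral a) e := by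
  have hs : Standard (labels 1025) (fun i => ([2, 2, 3, 4, 3, 2] : List ℤ).getD i 0)
      [(23, 1), (35, 1)]
      [(59, -1), (71, -1)] := by decide +kernel
  refine ht.reachableGenerated_of_standard hs hn (hs.reachableGenerated_of_generatedBy hn
    (cs := [(2, [-1]), (1, []), (1, [])]) ?_
    (ws := [(23, 1, [(-1, 0, 16)]), (26, 1, [(-1, 0, 21)]), (29, 1, [(-1, 0, 25)]),
      (31, 1, [(-1, 0, 28)]), (32, 1, [(1, 5, 30)]), (33, 1, [(-1, 6, 30)]), (34, 1, [(1, 11, 30)]),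
      (35, 1, [(-1, 17, 30)])]) ?_) <;> decide +kernel

theorem reachableGenerated_threeA1 (hn : ∀ j < 6, label a j = labels 64 j)
    (ht : IsTriple (toral a) e f) : ReachableGenerated (toral a) e := by
  have hs : Standard (labels 64) (fun i => ([2, 3, 4, 6, 4, 2] : List ℤ).getD i 0)
      [(22, 1), (29, 1), (33, 1)]
      [(58, -1), (65, -1), (69, -1)] := by decide +kernel
  refine ht.reachableGenerated_of_standard hs hn (hs.reachableGenerated_of_generatedBy hn
    (cs := [(2, [-1]), (3, [-1]), (1, []), (1, [])]) ?_
    (ws := [(22, 9, [(-1, 7, 14)]), (25, 6, [(1, 3, 21)]), (27, 6, [(1, 3, 24)]),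
      (28, 3, [(1, 3, 17)]), (29, 9, [(-1, 11, 20)]), (30, 3, [(1, 3, 20)]), (31, 3, [(-1, 3, 13)]),
      (32, 3, [(-1, 3, 14)]), (33, 9, [(-1, 16, 24)]), (34, 1, [(-1, 3, 22)]),
      (35, 1, [(1, 9, 22)])]) ?_) <;> decide +kernel

theorem reachableGenerated_A2_A1 (hn : ∀ j < 6, label a j = labels 1029 j)
    (ht : IsTriple (toral a) e f) : ReachableGenerated (toral a) e := by
  have hs : Standard (labels 1029) (fun i => ([3, 4, 5, 7, 5, 3] : List ℤ).getD i 0)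
      [(17, 1), (23, 1), (30, 1)]
      [(53, -2), (59, -1), (66, -2)] := by decide +kernel
  refine ht.reachableGenerated_of_standard hs hn (hs.reachableGenerated_of_generatedBy hn
    (cs := [(12, [-6, 1]), (3, [-1]), (4, [-1]), (1, []), (1, [])]) ?_
    (ws := [(17, 9, [(-2, 0, 16), (-9, 1, 11)]), (20, 3, [(-4, 0, 5)]), (21, 3, [(-2, 1, 16)]),
      (23, 9, [(-4, 0, 16)]), (24, 3, [(4, 0, 6)]), (25, 1, [(2, 5, 11)]), (27, 3, [(-4, 0, 11)]),
      (28, 1, [(-2, 6, 11)]), (30, 9, [(-2, 0, 16), (-9, 1, 11)]), (26, 12, [(-1, 0, 21)]),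
      (29, 12, [(-1, 0, 25)]), (31, 12, [(-1, 0, 28)]), (32, 8, [(-1, 1, 25)]),
      (33, 8, [(-1, 1, 28)]), (34, 8, [(-1, 9, 28)]), (35, 2, [(1, 1, 34)])]) ?_) <;> decide +kernel

theorem reachableGenerated_A2_twoA1 (hn : ∀ j < 6, label a j = labels 272 j)
    (ht : IsTriple (toral a) e f) : ReachableGenerated (toral a) e := by
  have hs : Standard (labels 272) (fun i => ([3, 4, 6, 8, 6, 3] : List ℤ).getD i 0)
      [(12, 1), (21, 1), (23, 1), (27, 1)]
      [(48, -1), (57, -2), (59, -1), (63, -2)] := by decide +kernel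
  refine ht.reachableGenerated_of_standard hs hn (hs.reachableGenerated_of_generatedBy hn
    (cs := [(12, [-6, 1]), (3, [-1]), (4, [-1]), (1, []), (1, [])]) ?_
    (ws := [(12, 9, [(4, 4, 8)]), (16, 3, [(-1, 2, 11), (1, 6, 8)]),
      (18, 3, [(3, 2, 6), (1, 4, 14)]), (19, 3, [(3, 2, 6), (-1, 4, 14)]),
      (21, 9, [(18, 2, 7), (2, 4, 8)]), (22, 3, [(-1, 2, 11), (-3, 6, 8)]), (23, 9, [(-4, 10, 11)]),
      (24, 3, [(-4, 2, 4)]), (25, 3, [(-4, 7, 8)]), (26, 3, [(-9, 2, 6), (1, 4, 14)]),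
      (27, 9, [(18, 2, 7), (2, 4, 8)]), (29, 3, [(3, 2, 11), (1, 6, 8)]), (28, 12, [(1, 4, 25)]),
      (30, 4, [(1, 2, 12)]), (31, 3, [(-1, 4, 16)]), (32, 3, [(1, 2, 16)]), (33, 1, [(-1, 2, 31)]),
      (34, 1, [(-1, 7, 32)]), (35, 1, [(-1, 2, 28)])]) ?_) <;> decide +kernel

theorem reachableGenerated_twoA2_A1 (hn : ∀ j < 6, label a j = labels 1089 j)
    (ht : IsTriple (toral a) e f) : ReachableGenerated (toral a) e := by
  have hs : Standard (labels 1089) (fun i => ([4, 5, 7, 10, 7, 4] : List ℤ).getD i 0)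
      [(11, 1), (15, 1), (21, 1), (22, 1), (24, 1)]
      [(47, -2), (51, -2), (57, -2), (58, -1), (60, -2)] := by decide +kernel
  refine ht.reachableGenerated_of_standard hs hn (hs.reachableGenerated_of_generatedBy hn
    (cs := [(12, [-6, 1]), (24, [-8, 1]), (4, [-1]), (5, [-1]), (1, []), (1, [])]) ?_
    (ws := [(11, 96, [(1, 0, 6), (1, 0, 7), (-1, 3, 7)]),
      (15, 192, [(5, 0, 6), (-4, 0, 7), (-2, 3, 7)]), (16, 96, [(1, 0, 12)]),
      (17, 32, [(-1, 0, 3)]), (19, 96, [(-1, 0, 12)]), (20, 32, [(1, 0, 3)]),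
      (21, 192, [(5, 0, 6), (-4, 0, 7), (-2, 3, 7)]), (22, 48, [(1, 3, 18)]),
      (24, 96, [(1, 0, 6), (1, 0, 7), (-1, 3, 7)]), (23, 8, [(-1, 0, 16)]), (25, 8, [(1, 14, 11)]),
      (26, 8, [(-1, 6, 17)]), (27, 8, [(1, 13, 15)]), (28, 8, [(1, 7, 15)]), (30, 8, [(1, 8, 11)]),
      (29, 40, [(-1, 0, 25)]), (31, 240, [(-1, 0, 23), (-6, 0, 28)]),
      (32, 120, [(2, 0, 23), (-3, 0, 28)]), (33, 40, [(1, 6, 28)]), (34, 8, [(1, 3, 33)]),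
      (35, 8, [(-1, 0, 31)])]) ?_) <;> decide +kernel

theorem reachableGenerated_A3_A1 (hn : ∀ j < 6, label a j = labels 276 j)
    (ht : IsTriple (toral a) e f) : ReachableGenerated (toral a) e := by
  have hs : Standard (labels 276) (fun i => ([4, 6, 8, 11, 8, 4] : List ℤ).getD i 0)
      [(12, 1), (13, 1), (14, 1), (23, 1)]
      [(48, -1), (49, -3), (50, -3), (59, -4)] := by decide +kernel
  refine ht.reachableGenerated_of_standard hs hn (hs.reachableGenerated_of_separatedBy hn
    (cs := [(144, [-72, 12, -1]), (24, [-8, 1]), (40, [-10, 1])]) ?_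
    (v := fun i => ([0, 0, 0, 0, 0, 0, 0, 0, 0, 0, 0, 0, 0, 1] : List ℤ).getD i 0) ?_) <;>
    decide +kernel

theorem reachableGenerated_A4_A1 (hn : ∀ j < 6, label a j = labels 1301 j)
    (ht : IsTriple (toral a) e f) : ReachableGenerated (toral a) e := by
  have hs : Standard (labels 1301) (fun i => ([6, 8, 11, 15, 11, 6] : List ℤ).getD i 0)
      [(6, 1), (12, 1), (13, 1), (14, 1), (15, 1)]
      [(42, -6), (48, -1), (49, -4), (50, -4), (51, -6)] := by decide +kernel
  refine ht.reachableGenerated_of_standard hs hn (hs.reachableGenerated_of_separatedBy hn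
    (cs := [(2880, [-1440, 240, -20, 1]), (360, [-120, 15, -1]), (720, [-180, 18, -1])]) ?_
    (v := fun i => ([0, 0, 0, 0, 0, 0, 5, 0, 0, 0, 0, 0, 1] : List ℤ).getD i 0) ?_) <;>
    decide +kernel

theorem reachableGenerated_D5a1 (hn : ∀ j < 6, label a j = labels 1305 j)
    (ht : IsTriple (toral a) e f) : ReachableGenerated (toral a) e := by
  have hs : Standard (labels 1305) (fun i => ([7, 10, 13, 18, 13, 7] : List ℤ).getD i 0)
      [(1, 1), (6, 1), (9, 1), (12, 1), (15, 1)]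
      [(37, -5), (42, -7), (45, -5), (46, 5), (47, -5), (48, -6), (51, -7)] := by decide +kernel
  refine ht.reachableGenerated_of_standard hs hn (hs.reachableGenerated_of_separatedBy hn
    (cs := [(86400, [-43200, 7200, -600, 30, -1]), (8640, [-2880, 360, -24, 1]),
      (20160, [-5040, 504, -28, 1])]) ?_
    (v := fun i => ([0, 1] : List ℤ).getD i 0) ?_) <;>
    decide +kernel

end

theorem IsTriple.reachableGenerated {h e f : LieAlgebra.e₆ ℂ} (ht : IsTriple h e f) :
    ReachableGenerated h e := by
  obtain ⟨φ, a, c, hφ, hn, hc⟩ := ht.exists_characteristic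
  have ht' := hφ ▸ ht.map φ
  refine .of_map φ ?_
  rw [hφ]
  rcases hc with hc | hc
  · intro he
    have h0 := ht'.eq_zero_of_narrow hn hc he
    rw [h0] at ht' he ⊢
    exact reachableGenerated_zero ht' he
  · simp only [List.mem_cons, List.not_mem_nil, or_false] at hc
    rcases hc with rfl | rfl | rfl | rfl | rfl | rfl | rfl | rfl | rfl
    · exact reachableGenerated_A1 hn ht'
    · exact reachableGenerated_threeA1 hn ht'
    · exact reachableGenerated_A2_twoA1 hn ht'
    · exact reachableGenerated_twoA1 hn ht'
    · exact reachableGenerated_A2_A1 hn ht'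
    · exact reachableGenerated_twoA2_A1 hn ht'
    · exact reachableGenerated_A3_A1 hn ht'
    · exact reachableGenerated_A4_A1 hn ht'
    · exact reachableGenerated_D5a1 hn ht'

end E6

/-- Panyushev property for the simple Lie algebra of type E6:
`e` is reachable iff the Lie subalgebra generated by `g(1)_e` contains every `g(k)_e`, `k ≥ 1`. -/
theorem panyushev_property_E6 (h e f : LieAlgebra.e₆ ℂ)
    (hhe : ⁅h, e⁆ = (2 : ℂ) • e) (hhf : ⁅h, f⁆ = (-2 : ℂ) • f) (hef : ⁅e, f⁆ = h) :
    e ∈ derived e ↔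
      ∀ k : ℤ, 1 ≤ k → ∀ x : LieAlgebra.e₆ ℂ, ⁅e, x⁆ = 0 → ⁅h, x⁆ = (k : ℂ) • x →
        x ∈ LieSubalgebra.lieSpan ℂ (LieAlgebra.e₆ ℂ)
            {x : LieAlgebra.e₆ ℂ | ⁅e, x⁆ = 0 ∧ ⁅h, x⁆ = x} := by
  have ht : E6.IsTriple h e f := ⟨hhe, hhf, hef⟩
  refine ⟨ht.reachableGenerated, fun H => ht.mem_derived_of_mem_lieSpan ?_⟩
  exact H 2 (by norm_num) e (lie_self e) (hhe.trans (by norm_num))
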